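/- arXiv:math/0204213 — 2 statements merged into one kernel-verified Lean document; each statement's English description precedes it below -/
import Mathlib

section
/- In the situation of the residual-point lemma — K' a field of characteristic zero, d ≥ 3, 2d−2 ≤ q < r, G = Σ_{|I|<2d} b_{I,J} Z^I Y^J homogeneous of degree 2d with every monomial involving a Y-variable and all coefficients algebraically independent over K', η = (1,η_1,…,η_{2d−2},0,…,0) with η_1,…,η_{2d−2} algebraically independent over K'(b), and ξ = (0,1,ξ_2,…,ξ_r) a generic point over K'(b,η) of the (assumed irreducible, (r−2d+1)-dimensional) variety F*_η cut out by Z_0 = 0 and Δ^j_η(G) = 0 for j = 1,…,2d−2 — let u be transcendental over K'(b,η,ξ) and set α := η + uξ = (1, α_1,…,α_r). Then trdeg_{K'(b)} K'(b)(α_1,…,α_r) = r; that is, α is a generic point of P^r over K'_1 = K'(b). -/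
set_option synthInstance.maxHeartbeats 1000000
set_option maxHeartbeats 1000000

universe u

/-- The `j`-th polar of the point `η` with respect to the (homogeneous) polynomial `G`:
the polynomial in `X = (X_0, …, X_{n-1})` obtained by applying the derivation
`X_0 ∂/∂U_0 + … + X_{n-1} ∂/∂U_{n-1}` to `G(U)` `j` times and then evaluating at
`U = η`. -/
noncomputable def polar {R : Type*} [CommRing R] {n : ℕ}
    (G : MvPolynomial (Fin n) R) (η : Fin n → R) (j : ℕ) : MvPolynomial (Fin n) R :=
  MvPolynomial.aeval (Sum.elim (fun i => MvPolynomial.C (η i)) MvPolynomial.X)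
    ((fun p => ∑ i : Fin n,
        MvPolynomial.X (Sum.inr i) * MvPolynomial.pderiv (Sum.inl i) p)^[j]
      (MvPolynomial.rename Sum.inl G))

/-- `FieldTrdegEq F Ω s n` says that the subfield `F(s)` of `Ω` generated over `F` by
the set `s` has transcendence degree `n` over `F`: there is a transcendence basis of
`F(s)/F` consisting of `n` elements. -/
def FieldTrdegEq (F Ω : Type*) [Field F] [Field Ω] [Algebra F Ω] (s : Set Ω) (n : ℕ) :
    Prop :=
  ∃ v : Fin n → Ω, AlgebraicIndependent F v ∧
    (∀ i, v i ∈ IntermediateField.adjoin F s) ∧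
    ∀ x ∈ s, IsAlgebraic (↥(IntermediateField.adjoin F (Set.range v))) x


open MvPolynomial in
theorem chain_rule {R B : Type*} [CommRing R] [CommRing B] [Algebra R B] {n : ℕ}
    (D : Derivation R B B) (x : Fin n → B) (p : MvPolynomial (Fin n) R) :
    D (aeval x p) = ∑ i, aeval x (pderiv i p) * D (x i) := by
  induction p using MvPolynomial.induction_on with
  | C a => simp
  | add p q hp hq => simp [hp, hq, add_mul, Finset.sum_add_distrib]
  | mul_X p i hp =>
    simp [hp, Derivation.leibniz, add_mul, Finset.sum_add_distrib, Pi.single_apply,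
      Finset.mul_sum, pderiv_X, apply_ite, mul_ite, ite_mul]
    simp [mul_assoc]

theorem exists_derivation {F L : Type*} [Field F] [Field L] [CharZero F] [Algebra F L] (x : L)
    (hx : Transcendental F x) : ∃ D : Derivation F L L, D x ≠ 0 := by
  have h1 : AlgebraicIndependent F ((↑) : ({x} : Set L) → L) := by
    have := (algebraicIndependent_singleton_iff (R := F) (x := ((↑) : ({x} : Set L) → L)) ⟨x, rfl⟩)
    exact this.2 hx
  obtain ⟨s, hs, hb⟩ := exists_isTranscendenceBasis_superset (R := F) (A := L) h1
  let S := MvPolynomial s F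
  let : Algebra S L := (MvPolynomial.aeval (R := F) ((↑) : s → L)).toAlgebra
  have : IsScalarTower F S L := IsScalarTower.of_algebraMap_eq' (by
    ext a; simp [RingHom.algebraMap_toAlgebra, S])
  have hinj : Function.Injective (algebraMap S L) := hb.1
  have : FaithfulSMul S L := (faithfulSMul_iff_algebraMap_injective S L).2 hinj
  let := FractionRing.liftAlgebra S L
  have := FractionRing.isScalarTower_liftAlgebra S L
  have : Algebra.IsAlgebraic S L := by
    have := hb.isAlgebraic
    refine Algebra.IsAlgebraic.of_ringHom_of_comp_eq hb.1.aevalEquiv.toRingEquiv.toRingHom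
      (RingHom.id L) hb.1.aevalEquiv.surjective Function.injective_id ?_
    refine RingHom.ext fun z => ?_
    exact hb.1.algebraMap_aevalEquiv z
  have : Algebra.IsAlgebraic (FractionRing S) L := by
    exact Algebra.IsAlgebraic.extendScalars (R := S) (IsFractionRing.injective S (FractionRing S))
  have : CharZero S := charZero_of_injective_algebraMap (R := F) (MvPolynomial.C_injective _ _)
  have : CharZero (FractionRing S) := charZero_of_injective_algebraMap (R := S) (IsFractionRing.injective S (FractionRing S))
  have : Algebra.FormallyEtale (FractionRing S) L := Algebra.FormallyEtale.of_isSeparable _ _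
  have : Algebra.FormallyEtale S (FractionRing S) :=
    Algebra.FormallyEtale.of_isLocalization (nonZeroDivisors S)
  have : Algebra.FormallyEtale S L := Algebra.FormallyEtale.comp S (FractionRing S) L
  let b := ((KaehlerDifferential.mvPolynomialBasis F s).baseChange L).map
    (KaehlerDifferential.tensorKaehlerEquivOfFormallyEtale F S L)
  let i : s := ⟨x, hs rfl⟩
  refine ⟨(b.coord i).compDer (KaehlerDifferential.D F L), ?_⟩
  have h2 : x = algebraMap S L (MvPolynomial.X i) := by
    simp [RingHom.algebraMap_toAlgebra, S, i]
  rw [h2]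
  simp [b, KaehlerDifferential.tensorKaehlerEquivOfFormallyEtale_symm_D_algebraMap, S, -KaehlerDifferential.mvPolynomialBasis_repr_apply]

open MvPolynomial in
theorem exchange {K A : Type*} [Field K] [Field A] [Algebra K A] {ι κ : Type*} [Finite ι]
    [Finite κ] (x : ι → A) (y : κ → A) (hx : AlgebraicIndependent K x)
    (h : ∀ i, IsAlgebraic (IntermediateField.adjoin K (Set.range y)) (x i)) :
    Nat.card ι ≤ Nat.card κ ∧ (Nat.card κ ≤ Nat.card ι → AlgebraicIndependent K y) := by
  let M := AlgebraicIndependent.matroid K A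
  have hI : M.Indep (Set.range x) := AlgebraicIndependent.matroid_indep_iff.2 hx.to_subtype_range
  have hsub : Set.range x ⊆ M.closure (Set.range y) := by
    rintro _ ⟨i, rfl⟩
    rw [AlgebraicIndependent.matroid_closure_eq]
    have := IntermediateField.isAlgebraic_adjoin_iff.1 (h i)
    exact this
  have h1 := hI.encard_le_eRk_of_subset hsub
  rw [M.eRk_closure_eq] at h1
  have h2 := M.eRk_le_encard (Set.range y)
  have hxc : (Set.range x).encard = Nat.card ι := by
    rw [← Set.image_univ, hx.injective.encard_image, Set.encard_univ, ENat.card_eq_coe_natCard]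
  have hyc : (Set.range y).encard ≤ Nat.card κ := by
    rw [← Set.image_univ]; refine (Set.encard_image_le _ _).trans ?_; rw [Set.encard_univ, ENat.card_eq_coe_natCard]
  refine ⟨by exact_mod_cast (hxc ▸ h1).trans (h2.trans hyc), fun hc => ?_⟩
  have hc' : (Nat.card κ : ℕ∞) ≤ Nat.card ι := by exact_mod_cast hc
  have hy1 : (Set.range y).encard = Nat.card κ := le_antisymm hyc (hc'.trans (hxc ▸ h1.trans h2))
  have hind : M.Indep (Set.range y) := by
    obtain ⟨B, hB⟩ := M.exists_isBasis (Set.range y) (fun _ _ => trivial)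
    have h3 := hB.encard_eq_eRk
    have h4 : B = Set.range y := Set.Finite.eq_of_subset_of_encard_le ((Set.finite_range y).subset hB.subset)
      hB.subset (by rw [h3, hy1]; exact hc'.trans (hxc ▸ h1))
    exact h4 ▸ hB.indep
  have hinj : Function.Injective y := by
    rw [← Set.image_univ] at hy1
    refine Set.injOn_univ.1 ((Set.finite_univ).injOn_of_encard_image_eq ?_)
    rw [hy1, Set.encard_univ, ENat.card_eq_coe_natCard]
  exact AlgebraicIndependent.of_subtype_range hinj (AlgebraicIndependent.matroid_indep_iff.1 hind)

open Polynomial in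
/-- The restriction of `G` to the line `η + t x`. -/
noncomputable def lineRes {B : Type*} [CommRing B] {n : ℕ} (η x : Fin n → B)
    (G : MvPolynomial (Fin n) B) : B[X] :=
  MvPolynomial.aeval (fun i => C (η i) + X * C (x i)) G

open Polynomial in
theorem lineRes_map {B B' : Type*} [CommRing B] [CommRing B'] {n : ℕ} (f : B →+* B') (η x : Fin n → B)
    (G : MvPolynomial (Fin n) B) :
    (lineRes η x G).map f = lineRes (fun i => f (η i)) (fun i => f (x i)) (MvPolynomial.map f G) := by
  unfold lineRes
  induction G using MvPolynomial.induction_on with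
  | C a => simp
  | add p q hp hq => simp only [map_add, Polynomial.map_add, hp, hq]
  | mul_X p i hp =>
    simp only [map_mul, Polynomial.map_mul, hp]
    simp

open Polynomial in
theorem lineRes_eval {B : Type*} [CommRing B] {n : ℕ} (η x : Fin n → B)
    (G : MvPolynomial (Fin n) B) (t : B) :
    (lineRes η x G).eval t = MvPolynomial.eval (fun i => η i + t * x i) G := by
  unfold lineRes
  induction G using MvPolynomial.induction_on with
  | C a => simp
  | add p q hp hq => simp only [map_add, eval_add, hp, hq]
  | mul_X p i hp =>
    simp only [map_mul, eval_mul, hp]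
    simp
    ring

theorem aeval_eq_zero_of_Y {R B : Type*} [CommRing R] [CommRing B] [Algebra R B] {n q : ℕ}
    (G : MvPolynomial (Fin n) R)
    (hY : ∀ μ ∈ G.support, ∃ i : Fin n, q < (i : ℕ) ∧ μ i ≠ 0)
    (w : Fin n → B) (hw : ∀ i : Fin n, q < (i : ℕ) → w i = 0) :
    MvPolynomial.aeval w G = 0 := by
  rw [MvPolynomial.aeval_def, MvPolynomial.eval₂_eq']
  refine Finset.sum_eq_zero fun μ hμ => ?_
  obtain ⟨i, hi, hi'⟩ := hY μ hμ
  rw [Finset.prod_eq_zero (Finset.mem_univ i), mul_zero]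
  rw [hw i hi, zero_pow hi']

open Polynomial in
theorem lineRes_eq_zero_of_Y {R B : Type*} [CommRing R] [CommRing B] [Algebra R B] {n q : ℕ}
    (G : MvPolynomial (Fin n) R)
    (hY : ∀ μ ∈ G.support, ∃ i : Fin n, q < (i : ℕ) ∧ μ i ≠ 0)
    (η x : Fin n → B) (hη : ∀ i : Fin n, q < (i : ℕ) → η i = 0)
    (hx : ∀ i : Fin n, q < (i : ℕ) → x i = 0) :
    lineRes η x (MvPolynomial.map (algebraMap R B) G) = 0 := by
  unfold lineRes
  rw [MvPolynomial.aeval_map_algebraMap]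
  exact aeval_eq_zero_of_Y G hY _ fun i hi => by simp [hη i hi, hx i hi]

open Polynomial in
theorem lineRes_derivative {B : Type*} [CommRing B] {n : ℕ} (η x : Fin n → B)
    (G : MvPolynomial (Fin n) B) :
    derivative (lineRes η x G) = ∑ i, lineRes η x (MvPolynomial.pderiv i G) * C (x i) := by
  have := chain_rule (R := B) (B := B[X]) (Polynomial.derivative') (fun i => C (η i) + X * C (x i)) G
  simpa [lineRes] using this

open Polynomial in
/-- coefficientwise derivation -/
noncomputable def coeffDer {R B : Type*} [CommRing R] [CommRing B] [Algebra R B]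
    (D : Derivation R B B) : Derivation R B[X] B[X] :=
  Derivation.mk' 
    { toFun := fun p => (PolynomialModule.equivPolynomialSelf (D.mapCoeffs p))
      map_add' := fun p q => by simp
      map_smul' := fun r p => by
        ext i
        simp [PolynomialModule.equivPolynomialSelf] }
    (fun a b => by
      change PolynomialModule.equivPolynomialSelf (D.mapCoeffs (a * b)) =
        a • PolynomialModule.equivPolynomialSelf (D.mapCoeffs b) +
        b • PolynomialModule.equivPolynomialSelf (D.mapCoeffs a)
      rw [Derivation.leibniz, map_add, LinearEquiv.map_smul, LinearEquiv.map_smul])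

open Polynomial in
theorem coeffDer_coeff {R B : Type*} [CommRing R] [CommRing B] [Algebra R B]
    (D : Derivation R B B) (p : B[X]) (j : ℕ) : (coeffDer D p).coeff j = D (p.coeff j) := rfl

open Polynomial in
theorem lineRes_coeffDer {R B : Type*} [CommRing R] [CommRing B] [Algebra R B] {n : ℕ}
    (D : Derivation R B B) (η x : Fin n → B) (G : MvPolynomial (Fin n) R) :
    coeffDer D (lineRes η x (MvPolynomial.map (algebraMap R B) G)) =
      ∑ i, lineRes η x (MvPolynomial.pderiv i (MvPolynomial.map (algebraMap R B) G)) *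
        (C (D (η i)) + X * C (D (x i))) := by
  have hC : ∀ a, coeffDer D (C a) = C (D a) := fun a => by
    ext j; rw [coeffDer_coeff, coeff_C, coeff_C]; split_ifs <;> simp
  have hX : coeffDer D X = 0 := by
    ext j; rw [coeffDer_coeff, coeff_X]; split_ifs <;> simp
  have := chain_rule (R := R) (B := B[X]) (coeffDer D) (fun i => C (η i) + X * C (x i)) G
  simp only [MvPolynomial.pderiv_map, lineRes, MvPolynomial.aeval_map_algebraMap]
  rw [this]
  simp [hC, hX, Derivation.leibniz]

open Polynomial in
theorem polar_eval {R B : Type*} [CommRing R] [CommRing B] [Algebra R B] {n : ℕ}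
    (G : MvPolynomial (Fin n) R) (η : Fin n → R) (x : Fin n → B) (j : ℕ) :
    MvPolynomial.aeval x (polar G η j) = (j.factorial : B) *
      (lineRes (fun i => algebraMap R B (η i)) x (MvPolynomial.map (algebraMap R B) G)).coeff j := by
  let φ : MvPolynomial (Fin n ⊕ Fin n) R →ₐ[R] B[X] :=
    MvPolynomial.aeval (Sum.elim (fun i => C (algebraMap R B (η i)) + X * C (x i)) (fun i => C (x i)))
  let T : MvPolynomial (Fin n ⊕ Fin n) R → MvPolynomial (Fin n ⊕ Fin n) R := fun p => ∑ i : Fin n,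
        MvPolynomial.X (Sum.inr i) * MvPolynomial.pderiv (Sum.inl i) p
  have h1 : ∀ p, φ (T p) = derivative (φ p) := by
    intro p
    induction p using MvPolynomial.induction_on with
    | C a => simp [T, φ]
    | add p q hp hq => 
      have : T (p + q) = T p + T q := by simp [T, mul_add, Finset.sum_add_distrib]
      simp [this, hp, hq]
    | mul_X p i hp => 
      have : T (p * MvPolynomial.X i) = T p * MvPolynomial.X i + p * T (MvPolynomial.X i) := by
        simp only [T, Derivation.leibniz, smul_eq_mul, mul_add, Finset.sum_add_distrib,
          Finset.sum_mul, Finset.mul_sum]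
        rw [add_comm]
        congr 1 <;> refine Finset.sum_congr rfl fun _ _ => by ring
      rw [this, map_add, map_mul, map_mul, hp, map_mul, derivative_mul]
      congr 2
      rcases i with i | i
      · simp [T, φ, MvPolynomial.pderiv_X, Pi.single_apply]
      · simp [T, φ, MvPolynomial.pderiv_X, Pi.single_apply]
  have h2 : ∀ j p, φ (T^[j] p) = derivative^[j] (φ p) := by
    intro j
    induction j with
    | zero => simp
    | succ j ih => intro p; rw [Function.iterate_succ_apply, ih, h1, Function.iterate_succ_apply]
  have h3 : φ (MvPolynomial.rename Sum.inl G) =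
      lineRes (fun i => algebraMap R B (η i)) x (MvPolynomial.map (algebraMap R B) G) := by
    simp only [φ, lineRes, MvPolynomial.aeval_map_algebraMap, MvPolynomial.aeval_rename]
    rfl
  have h4 : ∀ p, MvPolynomial.aeval x (MvPolynomial.aeval
      (Sum.elim (fun i => MvPolynomial.C (η i)) MvPolynomial.X) p : MvPolynomial (Fin n) R)
      = (φ p).coeff 0 := by
    intro p
    rw [Polynomial.coeff_zero_eq_eval_zero]
    induction p using MvPolynomial.induction_on with
    | C a => simp [φ]
    | add p q hp hq => simp only [map_add, eval_add, hp, hq]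
    | mul_X p i hp => 
      rw [map_mul, map_mul, hp, map_mul, eval_mul]
      rcases i with i | i <;> simp [φ]
  unfold polar
  rw [h4, h2, h3, Polynomial.coeff_iterate_derivative]
  simp [Nat.descFactorial_self]

open Polynomial in
theorem key_div {F L : Type*} [Field F] [Field L] [Algebra F L] {n N : ℕ}
    (D : Derivation F L L) (GF : MvPolynomial (Fin n) F) (G : MvPolynomial (Fin n) L)
    (hG : G = MvPolynomial.map (algebraMap F L) GF) (η ξ : Fin n → L) (u : L) (hu : u ≠ 0)
    (hα : ∀ i, D (η i + u * ξ i) = 0) (hdiv : X ^ N ∣ lineRes η ξ G) :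
    X ^ N ∣ ∑ i, C (D (η i)) * lineRes η ξ (MvPolynomial.pderiv i G) := by
  have h1 : X ^ N ∣ coeffDer D (lineRes η ξ G) := by
    rw [X_pow_dvd_iff] at hdiv ⊢
    intro j hj
    rw [coeffDer_coeff, hdiv j hj, map_zero]
  have h2 : X ^ N ∣ X * derivative (lineRes η ξ G) := by
    rw [X_pow_dvd_iff] at hdiv ⊢
    rintro (_ | j) hj
    · simp
    · rw [coeff_X_mul, coeff_derivative, hdiv _ hj, zero_mul]
  have h3 : (C u - X) * ∑ i, C (D (η i)) * lineRes η ξ (MvPolynomial.pderiv i G) =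
      C u * coeffDer D (lineRes η ξ G) + C (D u) * (X * derivative (lineRes η ξ G)) := by
    rw [lineRes_derivative]
    conv_rhs => rw [hG, lineRes_coeffDer, ← hG]
    simp only [Finset.mul_sum, ← Finset.sum_add_distrib]
    refine Finset.sum_congr rfl fun i _ => ?_
    have h4 := hα i
    rw [map_add, Derivation.leibniz, smul_eq_mul, smul_eq_mul] at h4
    have h5 : C (D (η i)) = - (C u * C (D (ξ i)) + C (ξ i) * C (D u)) := by
      rw [← C_mul, ← C_mul, ← C_add, ← C_neg]
      congr 1; linear_combination h4
    rw [h5]; ring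
  have h4 : X ^ N ∣ (C u - X) * ∑ i, C (D (η i)) * lineRes η ξ (MvPolynomial.pderiv i G) := by
    rw [h3]; exact dvd_add (h1.mul_left _) (h2.mul_left _)
  refine IsCoprime.dvd_of_dvd_mul_left ?_ h4
  refine IsCoprime.pow_left ⟨C u⁻¹, C u⁻¹, ?_⟩
  rw [mul_sub, ← C_mul, inv_mul_cancel₀ hu]; simp

open Polynomial in
/-- The determinant of coefficients of partial derivatives along a line. -/
noncomputable def detM {B : Type*} [CommRing B] {n m : ℕ} (η x : Fin n → B)
    (G : MvPolynomial (Fin n) B) (e : Fin m → Fin n) (s : Fin m → ℕ) : B :=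
  (Matrix.of fun j i => (lineRes η x (MvPolynomial.pderiv (e i) G)).coeff (s j)).det

theorem detM_map {B B' : Type*} [CommRing B] [CommRing B'] {n m : ℕ} (f : B →+* B')
    (η x : Fin n → B)
    (G : MvPolynomial (Fin n) B) (e : Fin m → Fin n) (s : Fin m → ℕ) :
    f (detM η x G e s) =
      detM (fun i => f (η i)) (fun i => f (x i)) (MvPolynomial.map f G) e s := by
  unfold detM
  rw [RingHom.map_det]
  congr 1
  ext j i
  simp only [RingHom.mapMatrix_apply, Matrix.map_apply, Matrix.of_apply, MvPolynomial.pderiv_map]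
  rw [← lineRes_map, Polynomial.coeff_map]

/-- substitution `(0, 1, X_2, …, X_r)` -/
noncomputable def sig (Ω : Type*) [Field Ω] (r : ℕ) :
    Fin (r + 1) → MvPolynomial (Fin (r - 1)) Ω := fun i =>
          if _h1 : (i : ℕ) = 0 then 0
          else if _h2 : (i : ℕ) = 1 then 1
          else MvPolynomial.X (⟨(i : ℕ) - 2, by have := i.isLt; omega⟩ : Fin (r - 1))

/-- The point `(0, 1, s, 0, …, 0)`. -/
def zz {B : Type*} [CommRing B] (n : ℕ) (s : B) : Fin n → B := fun i =>
  if (i : ℕ) = 1 then 1 else if (i : ℕ) = 2 then s else 0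

theorem zz_map {B B' : Type*} [CommRing B] [CommRing B'] (f : B →+* B') {n : ℕ} (s : B) :
    (fun i => f (zz n s i)) = zz n (f s) := by
  funext i; unfold zz; split_ifs <;> simp

open Polynomial in
theorem step1 {Ω : Type*} [Field Ω] {m q r : ℕ} (h2 : 2 ≤ q) (hr : q + m ≤ r)
    (G : MvPolynomial (Fin (r + 1)) Ω)
    (hY : ∀ μ ∈ G.support, ∃ i : Fin (r + 1), q < (i : ℕ) ∧ μ i ≠ 0)
    (η : Fin (r + 1) → Ω) (hη : ∀ i : Fin (r + 1), q < (i : ℕ) → η i = 0)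
    (H : ∀ k : Fin m, ∃ h : Fin m → MvPolynomial (Fin (r - 1)) Ω,
      MvPolynomial.X ⟨q + 1 + k - 2, by have := k.2; omega⟩ =
        ∑ j : Fin m, h j * MvPolynomial.aeval (sig Ω r) (polar G η (j + 1))) :
    detM η (zz _ 0) G (fun k : Fin m => (⟨q + 1 + k, by have := k.2; omega⟩ : Fin (r + 1)))
        (fun j => (j : ℕ)) =
      detM η (zz _ 1) G (fun k : Fin m => (⟨q + 1 + k, by have := k.2; omega⟩ : Fin (r + 1)))
        (fun j => (j : ℕ)) := by
  choose h hh using H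
  set κ : Fin m → Fin (r + 1) := fun k => ⟨q + 1 + k, by have := k.2; omega⟩ with hκ
  let ψ : MvPolynomial (Fin (r - 1)) Ω →ₐ[Ω] (Polynomial Ω) :=
    MvPolynomial.aeval (fun i => if (i : ℕ) = 0 then X else 0)
  have hψσ : ∀ i, ψ (sig Ω r i) = zz (r + 1) (X : (Polynomial Ω)) i := by
    intro i
    unfold sig zz
    split_ifs with h1 h2 h3 h4 h4
    all_goals first | omega | simp [ψ]
    all_goals omega
  have hδ : ∀ j, ψ (MvPolynomial.aeval (sig Ω r) (polar G η j)) = 0 := by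
    intro j
    have : ψ (MvPolynomial.aeval (sig Ω r) (polar G η j)) =
      MvPolynomial.aeval (zz (r + 1) (X : (Polynomial Ω))) (polar G η j) := by
      rw [← AlgHom.comp_apply, MvPolynomial.comp_aeval]
      simp only [hψσ]
    rw [this, polar_eval, lineRes_eq_zero_of_Y (q := q) G hY]
    · simp
    · intro i hi; simp [hη i hi]
    · intro i hi; unfold zz; rw [if_neg (by omega), if_neg (by omega)]
  let Lm : Matrix (Fin m) (Fin m) (Polynomial Ω) := Matrix.of fun j i =>
    (lineRes (fun i => C (η i)) (zz _ X) (MvPolynomial.pderiv (κ i) (MvPolynomial.map C G))).coeff j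
  have hpd : ∀ (l : Fin m) (j : Fin m),
      ψ (MvPolynomial.pderiv ⟨q + 1 + l - 2, by have := l.2; omega⟩
        (MvPolynomial.aeval (sig Ω r) (polar G η (j + 1)))) =
      (((j : ℕ) + 1).factorial : (Polynomial Ω)) * Lm j l := by
    intro l j
    rw [polar_eval, Derivation.leibniz, Derivation.map_natCast, smul_zero, add_zero, smul_eq_mul,
      map_mul, map_natCast]
    congr 1
    rw [← coeffDer_coeff, lineRes_coeffDer]
    rw [Finset.sum_eq_single (κ l)]
    · have h1 : MvPolynomial.pderiv (⟨q + 1 + l - 2, by have := l.2; omega⟩ : Fin (r - 1)) (sig Ω r (κ l)) = 1 := by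
        unfold sig
        rw [dif_neg (by simp [hκ]), dif_neg (by simp [hκ]; omega)]
        simp [hκ]
      rw [h1]
      simp only [MvPolynomial.algebraMap_eq, MvPolynomial.pderiv_C, map_zero, zero_add, C_1, mul_one, coeff_mul_X]
      have := congrArg (fun p => Polynomial.coeff p j) (lineRes_map (ψ : MvPolynomial (Fin (r - 1)) Ω →+* (Polynomial Ω)) (fun i => MvPolynomial.C (η i)) (sig Ω r) (MvPolynomial.pderiv (κ l) (MvPolynomial.map MvPolynomial.C G)))
      simp only [Polynomial.coeff_map] at this
      refine Eq.trans this ?_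
      simp only [Lm, Matrix.of_apply]
      congr 2
      · funext i; simp [ψ]
      · funext i; exact hψσ i
      · rw [← MvPolynomial.pderiv_map, MvPolynomial.map_map]
        have hc : ((ψ : MvPolynomial (Fin (r - 1)) Ω →+* (Polynomial Ω)).comp MvPolynomial.C) = C := by
          refine RingHom.ext fun a => ?_
          simp [ψ]
        rw [hc]
    · intro i _ hi
      have h1 : MvPolynomial.pderiv (⟨q + 1 + l - 2, by have := l.2; omega⟩ : Fin (r - 1)) (sig Ω r i) = 0 := by
        unfold sig
        split_ifs with h1 h2
        · simp
        · simp
        · rw [MvPolynomial.pderiv_X_of_ne]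
          intro h3
          apply hi
          rw [Fin.ext_iff] at h3 ⊢
          simp [hκ] at h3 ⊢
          omega
      rw [h1]
      simp
    · simp
  have hmat : (Matrix.of fun k j => ψ (h k j) * (((j : ℕ) + 1).factorial : (Polynomial Ω))) * Lm = 1 := by
    ext1 k l
    rw [Matrix.mul_apply]
    have h1 := congrArg (fun p => ψ (MvPolynomial.pderiv ⟨q + 1 + l - 2, by have := l.2; omega⟩ p)) (hh k)
    simp only [map_sum, Derivation.leibniz, smul_eq_mul, map_add, map_mul, hδ, zero_mul, add_zero, hpd] at h1
    simp only [Matrix.of_apply, mul_assoc]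
    rw [← h1, MvPolynomial.pderiv_X, Matrix.one_apply]
    by_cases hkl : k = l
    · subst hkl; simp
    · rw [if_neg hkl, Pi.single_eq_of_ne, map_zero]
      intro h3
      apply hkl
      rw [Fin.ext_iff] at h3 ⊢
      simp at h3
      omega
  have hunit : IsUnit Lm.det := by
    have := congrArg Matrix.det hmat
    rw [Matrix.det_mul, Matrix.det_one] at this
    exact IsUnit.of_mul_eq_one_right _ this
  obtain ⟨c, _, hc⟩ := Polynomial.isUnit_iff.1 hunit
  have hev : ∀ a : Ω, detM η (zz _ a) G κ (fun j => (j : ℕ)) = c := by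
    intro a
    have h1 := detM_map (Polynomial.evalRingHom a) (fun i => C (η i)) (zz _ X) (MvPolynomial.map C G) κ (fun j => (j : ℕ))
    rw [zz_map, MvPolynomial.map_map] at h1
    have h2 : detM (fun i => C (η i)) (zz _ X) (MvPolynomial.map C G) κ (fun j => (j : ℕ)) = C c := hc.symm
    rw [h2] at h1
    have h3 : (Polynomial.evalRingHom a).comp C = RingHom.id Ω := by ext; simp
    rw [h3, MvPolynomial.map_id] at h1
    simpa using h1.symm
  rw [hev, hev]


open Polynomial in
theorem lineRes_monomial_two {B : Type*} [CommRing B] {n : ℕ} (η x : Fin n → B) (o c : Fin n)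
    (hη0 : η o = 1) (hηc : η c = 0) (hx0 : x o = 0) (a b : ℕ) :
    lineRes η x (MvPolynomial.monomial (Finsupp.single o a + Finsupp.single c b) 1) =
      X ^ b * C (x c ^ b) := by
  rw [← mul_one (1 : B), ← MvPolynomial.monomial_mul]
  unfold lineRes
  rw [map_mul, MvPolynomial.monomial_eq, MvPolynomial.monomial_eq]
  simp [hη0, hηc, hx0, mul_pow]
  ring

theorem pderiv_dm {B : Type*} [CommRing B] {n m : ℕ} (o c : Fin n) (e : Fin m → Fin n)
    (he : Function.Injective e) (heo : ∀ k, e k ≠ o) (hec : ∀ k, e k ≠ c)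
    (A b : Fin m → ℕ) (k l : Fin m) :
    MvPolynomial.pderiv (e l) (MvPolynomial.monomial (Finsupp.single (e k) 1 +
      (Finsupp.single o (A k) + Finsupp.single c (b k))) (1 : B)) =
      if k = l then MvPolynomial.monomial (Finsupp.single o (A k) + Finsupp.single c (b k)) 1
        else 0 := by
  rw [MvPolynomial.pderiv_monomial]
  split_ifs with h
  · subst h
    have h1 := heo k
    have h2 := hec k
    simp [Finsupp.single_apply, h1.symm, h2.symm]
  · have h0 : e k ≠ e l := fun h' => h (he h')
    have h1 := heo l
    have h2 := hec l
    simp [Finsupp.single_apply, h1.symm, h2.symm, h0]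

theorem detM_spec {B : Type*} [CommRing B] {n m : ℕ} (o c : Fin n) (e : Fin m → Fin n)
    (he : Function.Injective e) (heo : ∀ k, e k ≠ o) (hec : ∀ k, e k ≠ c)
    (A b : Fin m → ℕ) (hb : Function.Injective b) (η x : Fin n → B)
    (hη0 : η o = 1) (hηc : η c = 0) (hx0 : x o = 0) :
    detM η x (∑ k, MvPolynomial.monomial (Finsupp.single (e k) 1 +
      (Finsupp.single o (A k) + Finsupp.single c (b k))) (1 : B)) e b = ∏ k, x c ^ b k := by
  unfold detM
  rw [← Matrix.det_diagonal]
  congr 1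
  ext j i
  rw [Matrix.of_apply, map_sum]
  simp only [pderiv_dm o c e he heo hec]
  rw [Finset.sum_ite_eq' Finset.univ i, if_pos (Finset.mem_univ _),
    lineRes_monomial_two η x o c hη0 hηc hx0, Polynomial.coeff_mul_C, Polynomial.coeff_X_pow,
    Matrix.diagonal_apply]
  by_cases h : j = i
  · subst h; simp
  · rw [if_neg (fun h' => h (hb h')), if_neg h, zero_mul]

theorem spec_sum {B : Type*} [CommRing B] {n m : ℕ} {ι : Type*} [Fintype ι]
    (mon : ι → Fin n →₀ ℕ) (hmon : Function.Injective mon) (dm : Fin m → Fin n →₀ ℕ)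
    (hdm : ∀ k, ∃ a, mon a = dm k) :
    ∑ a, MvPolynomial.monomial (mon a) (∑ k, if mon a = dm k then (1 : B) else 0) =
      ∑ k, MvPolynomial.monomial (dm k) (1 : B) := by
  simp only [map_sum]
  rw [Finset.sum_comm]
  refine Finset.sum_congr rfl fun k _ => ?_
  obtain ⟨a, ha⟩ := hdm k
  rw [Finset.sum_eq_single a]
  · rw [if_pos ha, ha]
  · intro b _ hb
    rw [if_neg (fun h => hb (hmon (h.trans ha.symm))), map_zero]
  · simp

theorem ai_ne {K A : Type*} [Field K] [Field A] [Algebra K A] {ι : Type*} {z : ι → A}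
    (hz : AlgebraicIndependent K z) (P : MvPolynomial ι K) (w : ι → K)
    (hw : MvPolynomial.aeval w P ≠ 0) : MvPolynomial.aeval z P ≠ 0 := by
  intro h
  apply hw
  have : P = 0 := hz (by rw [h, map_zero])
  rw [this, map_zero]

/-- `η = (1, y_1, …, y_m, 0, …)`. -/
def etaOf {B : Type*} [CommRing B] (n m : ℕ) (y : Fin m → B) : Fin n → B := fun i =>
  if (i : ℕ) = 0 then 1 else if h : (i : ℕ) - 1 < m then y ⟨i - 1, h⟩ else 0

theorem etaOf_map {B B' : Type*} [CommRing B] [CommRing B'] (f : B →+* B') (n m : ℕ)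
    (y : Fin m → B) : (fun i => f (etaOf n m y i)) = etaOf n m (fun i => f (y i)) := by
  funext i; unfold etaOf; split_ifs <;> simp

theorem detM_aeval {K C : Type*} [Field K] [Field C] [Algebra K C] {n m : ℕ} {ι τ : Type*}
    [Fintype ι] (mon : ι → Fin n →₀ ℕ) (cA : ι → MvPolynomial τ K)
    (ηA xA : Fin n → MvPolynomial τ K) (e : Fin m → Fin n) (s : Fin m → ℕ) (v : τ → C) :
    MvPolynomial.aeval v (detM ηA xA (∑ a, MvPolynomial.monomial (mon a) (cA a)) e s) =
      detM (fun i => MvPolynomial.aeval v (ηA i)) (fun i => MvPolynomial.aeval v (xA i))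
        (∑ a, MvPolynomial.monomial (mon a) (MvPolynomial.aeval v (cA a))) e s := by
  have h := detM_map (RingHomClass.toRingHom (MvPolynomial.aeval (R := K) v)) ηA xA
    (∑ a, MvPolynomial.monomial (mon a) (cA a)) e s
  refine Eq.trans h ?_
  congr 1
  simp [map_sum, MvPolynomial.map_monomial]

theorem etaOf_aeval {K C : Type*} [Field K] [Field C] [Algebra K C] {τ : Type*} (v : τ → C)
    (n m : ℕ) (y : Fin m → MvPolynomial τ K) :
    (fun i => MvPolynomial.aeval v (etaOf n m y i)) =
      etaOf n m (fun i => MvPolynomial.aeval v (y i)) :=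
  etaOf_map (RingHomClass.toRingHom (MvPolynomial.aeval (R := K) v)) n m y

theorem zz_aeval {K C : Type*} [Field K] [Field C] [Algebra K C] {τ : Type*} (v : τ → C)
    (n : ℕ) (s : MvPolynomial τ K) :
    (fun i => MvPolynomial.aeval v (zz n s i)) = zz n (MvPolynomial.aeval v s) :=
  zz_map (RingHomClass.toRingHom (MvPolynomial.aeval (R := K) v)) s

theorem step2 {K A : Type*} [Field K] [Field A] [Algebra K A] {D m q r : ℕ}
    (hm : 2 ≤ m) (hmD : m + 2 = D) (h2 : m ≤ q) (hr : q + m ≤ r) {ι : Type*} [Fintype ι]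
    (mon : ι → Fin (r + 1) →₀ ℕ) (hmon : Function.Injective mon)
    (hmon' : ∀ μ : Fin (r + 1) →₀ ℕ, (∑ i, μ i) = D →
      (∃ i : Fin (r + 1), q < (i : ℕ) ∧ μ i ≠ 0) → ∃ a, mon a = μ)
    (b : ι → A) (y : Fin m → A) (hz : AlgebraicIndependent K (Sum.elim b y)) :
    let κ := fun k : Fin m => (⟨q + 1 + k, by have := k.2; omega⟩ : Fin (r + 1))
    let G := ∑ a, MvPolynomial.monomial (mon a) (b a)
    detM (etaOf _ m y) (zz _ 0) G κ (fun j => (j : ℕ)) ≠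
      detM (etaOf _ m y) (zz _ 1) G κ (fun j => (j : ℕ)) := by
  intro κ G
  let GA : MvPolynomial (Fin (r + 1)) (MvPolynomial (ι ⊕ Fin m) K) :=
    ∑ a, MvPolynomial.monomial (mon a) (MvPolynomial.X (Sum.inl a))
  let ηA : Fin (r + 1) → MvPolynomial (ι ⊕ Fin m) K :=
    etaOf _ m (fun k => MvPolynomial.X (Sum.inr k))
  let Q : MvPolynomial (ι ⊕ Fin m) K :=
    detM ηA (zz _ 0) GA κ (fun j => (j : ℕ)) - detM ηA (zz _ 1) GA κ (fun j => (j : ℕ))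
  let dm : Fin m → Fin (r + 1) →₀ ℕ := fun k => Finsupp.single (κ k) 1 +
      (Finsupp.single (0 : Fin (r + 1)) (D - 1 - k) + Finsupp.single ⟨2, by omega⟩ (k : ℕ))
  let w : ι ⊕ Fin m → K := Sum.elim (fun a => ∑ k, if mon a = dm k then (1 : K) else 0) 0
  have hQ := ai_ne hz Q w (by
    simp only [Q, map_sub, GA, ηA, detM_aeval, etaOf_aeval, zz_aeval, MvPolynomial.aeval_X,
      map_zero, map_one]
    have h1 : ∑ a, MvPolynomial.monomial (mon a) (w (Sum.inl a)) =
        ∑ k, MvPolynomial.monomial (dm k) (1 : K) := spec_sum mon hmon dm (by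
          intro k
          apply hmon'
          · simp only [dm, Finsupp.add_apply, Finset.sum_add_distrib]
            simp only [Finsupp.single_apply, Finset.sum_ite_eq, Finset.mem_univ, if_true]
            have := k.2
            omega
          · refine ⟨κ k, by simp [κ]; omega, by simp [dm]⟩)
    rw [h1]
    have h4 := fun x hx0 => detM_spec (B := K) (0 : Fin (r + 1)) ⟨2, by omega⟩ κ (by
        intro a b hab; simp [κ] at hab; omega) (by intro k h; simp [κ, Fin.ext_iff] at h)
        (by intro k h; simp [κ] at h; omega) (fun k => D - 1 - k) (fun k => k)
        (fun a b hab => Fin.ext hab) (etaOf _ m (fun k => w (Sum.inr k))) x (by simp [etaOf])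
        (by simp [etaOf, w]) hx0
    rw [h4 _ (by simp [zz]), h4 _ (by simp [zz])]
    have h5 : ∏ k : Fin m, (zz (r + 1) (0 : K) ⟨2, by omega⟩) ^ (k : ℕ) = 0 := by
      refine Finset.prod_eq_zero (Finset.mem_univ (⟨1, by omega⟩ : Fin m)) ?_
      simp [zz]
    rw [h5]
    simp [zz])
  simp only [Q, map_sub, GA, ηA, detM_aeval, etaOf_aeval, zz_aeval, MvPolynomial.aeval_X,
      map_zero, map_one] at hQ
  exact fun h => hQ (sub_eq_zero.2 h)


/-- `ξ = (0, 1, x_2, …)`. -/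
def xiOf {B : Type*} [CommRing B] (r : ℕ) (x : Fin (r - 1) → B) : Fin (r + 1) → B := fun i =>
  if h0 : (i : ℕ) = 0 then 0 else if h : (i : ℕ) = 1 then 1 else
    x ⟨i - 2, by have := i.2; omega⟩

theorem xiOf_aeval {K C : Type*} [Field K] [Field C] [Algebra K C] {τ : Type*} (v : τ → C)
    (r : ℕ) (x : Fin (r - 1) → MvPolynomial τ K) :
    (fun i => MvPolynomial.aeval v (xiOf r x i)) =
      xiOf r (fun i => MvPolynomial.aeval v (x i)) := by
  funext i; unfold xiOf; split_ifs <;> simp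

theorem step6 {K A : Type*} [Field K] [Field A] [Algebra K A] {D m q r : ℕ}
    (hmD : m + 2 = D) (h2 : m ≤ q) (h1q : 1 ≤ q) (hr : q < r) (c : Fin (r + 1)) (hc : q < (c : ℕ))
    {ι : Type*} [Fintype ι]
    (mon : ι → Fin (r + 1) →₀ ℕ) (hmon : Function.Injective mon)
    (hmon' : ∀ k : Fin m, ∃ a, mon a =
      Finsupp.single (⟨k + 1, by have := k.2; omega⟩ : Fin (r + 1)) 1 +
        (Finsupp.single (0 : Fin (r + 1)) (D - 2 - k) + Finsupp.single c ((k : ℕ) + 1)))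
    (b : ι → A) (y : Fin m → A) (x : Fin (r - 1) → A)
    (hz : AlgebraicIndependent K (Sum.elim b (Sum.elim y x))) :
    detM (etaOf _ m y) (xiOf _ x) (∑ a, MvPolynomial.monomial (mon a) (b a))
      (fun k : Fin m => (⟨k + 1, by have := k.2; omega⟩ : Fin (r + 1))) (fun j => (j : ℕ) + 1)
      ≠ 0 := by
  set e : Fin m → Fin (r + 1) := fun k => ⟨k + 1, by have := k.2; omega⟩ with he
  let GA : MvPolynomial (Fin (r + 1)) (MvPolynomial (ι ⊕ (Fin m ⊕ Fin (r - 1))) K) :=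
    ∑ a, MvPolynomial.monomial (mon a) (MvPolynomial.X (Sum.inl a))
  let ηA : Fin (r + 1) → MvPolynomial (ι ⊕ (Fin m ⊕ Fin (r - 1))) K :=
    etaOf _ m (fun k => MvPolynomial.X (Sum.inr (Sum.inl k)))
  let xA : Fin (r + 1) → MvPolynomial (ι ⊕ (Fin m ⊕ Fin (r - 1))) K :=
    xiOf _ (fun k => MvPolynomial.X (Sum.inr (Sum.inr k)))
  let Q : MvPolynomial (ι ⊕ (Fin m ⊕ Fin (r - 1))) K :=
    detM ηA xA GA e (fun j => (j : ℕ) + 1)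
  let dm : Fin m → Fin (r + 1) →₀ ℕ := fun k => Finsupp.single (e k) 1 +
      (Finsupp.single (0 : Fin (r + 1)) (D - 2 - k) + Finsupp.single c ((k : ℕ) + 1))
  let w : ι ⊕ (Fin m ⊕ Fin (r - 1)) → K :=
    Sum.elim (fun a => ∑ k, if mon a = dm k then (1 : K) else 0) (Sum.elim 0 1)
  have hQ := ai_ne hz Q w (by
    simp only [Q, GA, ηA, xA, detM_aeval, etaOf_aeval, xiOf_aeval, MvPolynomial.aeval_X]
    have h1 : ∑ a, MvPolynomial.monomial (mon a) (w (Sum.inl a)) =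
        ∑ k, MvPolynomial.monomial (dm k) (1 : K) := spec_sum mon hmon dm hmon'
    rw [h1]
    have h4 := fun x hx0 => detM_spec (B := K) (0 : Fin (r + 1)) c e (by
        intro a b hab; simp [e] at hab; omega) (by intro k h; simp [e, Fin.ext_iff] at h)
        (by intro k h; simp [e, Fin.ext_iff] at h; have := k.2; omega)
        (fun k => D - 2 - k) (fun k => k + 1)
        (fun a b hab => by simp at hab; omega)
        (etaOf _ m (fun k => w (Sum.inr (Sum.inl k)))) x (by simp [etaOf])
        (by simp [etaOf, w]; intro h; simp [h] at hc) hx0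
    rw [h4 _ (by simp [xiOf])]
    have h5 : xiOf r (fun i => w (Sum.inr (Sum.inr i))) c = 1 := by
      unfold xiOf
      rw [dif_neg (by omega)]
      split_ifs <;> simp [w]
    rw [h5]
    simp)
  simp only [Q, GA, ηA, xA, detM_aeval, etaOf_aeval, xiOf_aeval, MvPolynomial.aeval_X] at hQ
  exact hQ

theorem coeff_lineRes_mem {K A : Type*} [Field K] [Field A] [Algebra K A]
    (F : IntermediateField K A) {n : ℕ} (η ξ : Fin n → A) (hη : ∀ i, η i ∈ F) (hξ : ∀ i, ξ i ∈ F)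
    (G : MvPolynomial (Fin n) A) (hG : ∀ μ, G.coeff μ ∈ F) (j : ℕ) :
    (lineRes η ξ G).coeff j ∈ F := by
  obtain ⟨GF, rfl⟩ : ∃ GF : MvPolynomial (Fin n) F, MvPolynomial.map (algebraMap F A) GF = G := by
    have := (MvPolynomial.mem_range_map_iff_coeffs_subset (f := algebraMap F A) (x := G)).2 (by
      intro z hz
      obtain ⟨μ, _, rfl⟩ := MvPolynomial.mem_coeffs_iff.1 hz
      exact ⟨⟨_, hG μ⟩, rfl⟩)
    exact this
  have := lineRes_map (algebraMap F A) (fun i => (⟨η i, hη i⟩ : F)) (fun i => ⟨ξ i, hξ i⟩) GF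
  have h2 := congrArg (fun p => Polynomial.coeff p j) this
  simp only [Polynomial.coeff_map] at h2
  change _ = (lineRes η ξ _).coeff j at h2
  rw [← h2]
  exact SetLike.coe_mem _

theorem stepC {K A : Type*} [Field K] [Field A] [Algebra K A]
    (F : IntermediateField K A) {n m : ℕ} (η ξ : Fin n → A) (hη : ∀ i, η i ∈ F)
    (hξ : ∀ i, ξ i ∈ F)
    (G : MvPolynomial (Fin n) A) (hG : ∀ μ, G.coeff μ ∈ F) (o c : Fin n) (hηo : η o = 1)
    (hηc : η c = 0) (hξo : ξ o = 0) (hξc : ξ c ≠ 0) (aa : Fin m → ℕ) (bs : Fin m → A)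
    (hvan : ∀ j : Fin m, (lineRes η ξ (G + ∑ k, MvPolynomial.monomial
      (Finsupp.single o (aa k) + Finsupp.single c ((k : ℕ) + 1)) (bs k))).coeff (j + 1) = 0)
    (k : Fin m) : bs k ∈ F := by
  have h := hvan k
  have h1 : ∀ i : Fin m, (lineRes η ξ (MvPolynomial.monomial
      (Finsupp.single o (aa i) + Finsupp.single c ((i : ℕ) + 1)) (bs i))).coeff (k + 1) =
      if i = k then bs k * ξ c ^ ((k : ℕ) + 1) else 0 := by
    intro i
    rw [← mul_one (bs i), ← MvPolynomial.C_mul_monomial]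
    have : lineRes η ξ (MvPolynomial.C (bs i) * MvPolynomial.monomial
      (Finsupp.single o (aa i) + Finsupp.single c ((i : ℕ) + 1)) 1) = Polynomial.C (bs i) *
      lineRes η ξ (MvPolynomial.monomial
      (Finsupp.single o (aa i) + Finsupp.single c ((i : ℕ) + 1)) 1) := by
      unfold lineRes; rw [map_mul]; simp
    rw [this, lineRes_monomial_two η ξ o c hηo hηc hξo, Polynomial.coeff_C_mul,
      Polynomial.coeff_mul_C, Polynomial.coeff_X_pow]
    by_cases hik : i = k
    · subst hik; simp
    · rw [if_neg hik, if_neg (fun h => hik (Fin.ext (by omega)))]; simp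
  have h2 : (lineRes η ξ (G + ∑ k, MvPolynomial.monomial
      (Finsupp.single o (aa k) + Finsupp.single c ((k : ℕ) + 1)) (bs k))).coeff (k + 1) =
      (lineRes η ξ G).coeff (k + 1) + bs k * ξ c ^ ((k : ℕ) + 1) := by
    unfold lineRes at h1 ⊢
    rw [map_add, map_sum, Polynomial.coeff_add, Polynomial.finset_sum_coeff]
    simp only [h1]
    simp
  rw [h2] at h
  have h3 : bs k = - (lineRes η ξ G).coeff (k + 1) / ξ c ^ ((k : ℕ) + 1) := by
    field_simp
    linear_combination h
  rw [h3]
  exact F.div_mem (F.neg_mem (coeff_lineRes_mem F η ξ hη hξ G hG _)) (pow_mem (hξ c) _)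

theorem mons_finite (n D : ℕ) (p : (Fin n →₀ ℕ) → Prop) :
    Finite {μ : Fin n →₀ ℕ // (∑ i, μ i) = D ∧ p μ} := by
  have : Set.Finite {μ : Fin n →₀ ℕ | (∑ i, μ i) = D ∧ p μ} := by
    refine (Finset.finite_toSet (Finset.finsuppAntidiag Finset.univ D)).subset ?_
    intro μ hμ
    simp [Finset.mem_finsuppAntidiag, hμ.1]
  exact this

theorem G_eq_sum {A : Type*} [Field A] {n D q : ℕ} (G : MvPolynomial (Fin n) A)
    (hG : G.IsHomogeneous D)
    (hY : ∀ μ ∈ G.support, ∃ i : Fin n, q < (i : ℕ) ∧ μ i ≠ 0)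
    [Fintype {μ : Fin n →₀ ℕ // (∑ i, μ i) = D ∧ ∃ i : Fin n, q < (i : ℕ) ∧ μ i ≠ 0}] :
    G = ∑ μ : {μ : Fin n →₀ ℕ // (∑ i, μ i) = D ∧ ∃ i : Fin n, q < (i : ℕ) ∧ μ i ≠ 0},
      MvPolynomial.monomial μ.1 (G.coeff μ.1) := by
  classical
  ext ν
  rw [MvPolynomial.coeff_sum]
  simp only [MvPolynomial.coeff_monomial]
  by_cases hν : ν ∈ G.support
  · have h1 : (∑ i, ν i) = D := by
      have := hG (MvPolynomial.mem_support_iff.1 hν)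
      rw [← this, Finsupp.weight_apply, Finsupp.sum_fintype] <;> simp
    rw [Finset.sum_eq_single ⟨ν, h1, hY ν hν⟩]
    · simp
    · intro b _ hb
      rw [if_neg (fun h => hb (Subtype.ext h))]
    · simp
  · rw [MvPolynomial.notMem_support_iff] at hν
    rw [hν, Finset.sum_eq_zero]
    intro x _
    split_ifs with h
    · rw [h, hν]
    · rfl


theorem aeval_X_eq_map {R B σ : Type*} [CommRing R] [CommRing B] [Algebra R B]
    (p : MvPolynomial σ R) :
    MvPolynomial.aeval (MvPolynomial.X : σ → MvPolynomial σ B) p =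
      MvPolynomial.map (algebraMap R B) p := by
  induction p using MvPolynomial.induction_on with
  | C a => simp
  | add p q hp hq => rw [map_add, map_add, hp, hq]
  | mul_X p i hp => rw [map_mul, map_mul, hp]; simp

theorem step3 {K Ω : Type*} [Field K] [Field Ω] [Algebra K Ω] (E : IntermediateField K Ω)
    {m q r : ℕ} (h2 : 2 ≤ q) (hmq : m ≤ q) (hqr : q < r)
    (G : MvPolynomial (Fin (r + 1)) Ω)
    (hY : ∀ μ ∈ G.support, ∃ i : Fin (r + 1), q < (i : ℕ) ∧ μ i ≠ 0)
    (η : Fin (r + 1) → Ω) (hη : ∀ i : Fin (r + 1), q < (i : ℕ) → η i = 0)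
    (x : Fin (r - 1) → Ω) (hx : ∀ i : Fin (r - 1), q < (i : ℕ) + 2 → x i = 0)
    (δ' : ℕ → MvPolynomial (Fin (r - 1)) E)
    (hδ' : ∀ j, MvPolynomial.map (algebraMap E Ω) (δ' j)
      = MvPolynomial.aeval (sig Ω r) (polar G η j))
    (J : Ideal (MvPolynomial (Fin (r - 1)) E))
    (hJ : J = Ideal.span {p | ∃ j : ℕ, 1 ≤ j ∧ j ≤ m ∧ p = δ' j})
    (hgen : ∀ p, MvPolynomial.aeval x p = 0 ↔ p ∈ J)
    (htr : FieldTrdegEq E Ω (Set.range x) (r - 1 - m)) :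
    ∃ hr : q + m ≤ r,
      detM η (zz _ 0) G (fun k : Fin m => (⟨q + 1 + k, by have := k.2; omega⟩ : Fin (r + 1)))
        (fun j => (j : ℕ)) =
      detM η (zz _ 1) G (fun k : Fin m => (⟨q + 1 + k, by have := k.2; omega⟩ : Fin (r + 1)))
        (fun j => (j : ℕ)) := by
  have hr : q + m ≤ r := by
    obtain ⟨v, _, _, hv⟩ := htr
    let inc : Fin (q - 1) → Fin (r - 1) := fun i => ⟨i, by omega⟩
    have hinc : Function.Injective inc := fun a b h => by simpa [inc, Fin.ext_iff] using h
    have hAI : AlgebraicIndependent E (fun i => x (inc i)) := by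
      rw [algebraicIndependent_iff]
      intro p hp
      have h1 : MvPolynomial.aeval x (MvPolynomial.rename inc p) = 0 := by
        rw [MvPolynomial.aeval_rename]; exact hp
      rw [hgen, hJ] at h1
      let w : Fin (r - 1) → MvPolynomial (Fin (q - 1)) Ω :=
        fun i => if h : (i : ℕ) < q - 1 then MvPolynomial.X ⟨i, h⟩ else 0
      let φ : MvPolynomial (Fin (r - 1)) E →ₐ[E] MvPolynomial (Fin (q - 1)) Ω :=
        MvPolynomial.aeval w
      have hle : Ideal.span {p | ∃ j : ℕ, 1 ≤ j ∧ j ≤ m ∧ p = δ' j} ≤ RingHom.ker φ := by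
        rw [Ideal.span_le]
        rintro _ ⟨j, _, _, rfl⟩
        have h3 : φ (δ' j) = MvPolynomial.aeval (R := Ω) w
            (MvPolynomial.map (algebraMap E Ω) (δ' j)) := by
          rw [MvPolynomial.aeval_map_algebraMap]
        rw [SetLike.mem_coe, RingHom.mem_ker, h3, hδ', ← AlgHom.comp_apply,
          MvPolynomial.comp_aeval, polar_eval, lineRes_eq_zero_of_Y (q := q) G hY]
        · simp
        · intro i hi; simp [hη i hi]
        · intro i hi
          unfold sig
          rw [dif_neg (by omega), dif_neg (by omega), MvPolynomial.aeval_X]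
          simp only [w]
          rw [dif_neg (by omega)]
      have h4 := hle h1
      rw [RingHom.mem_ker] at h4
      have h5 : φ (MvPolynomial.rename inc p) = MvPolynomial.map (algebraMap E Ω) p := by
        simp only [φ]
        rw [MvPolynomial.aeval_rename]
        have : w ∘ inc = MvPolynomial.X := by
          funext i; simp [w, inc]
        rw [this]
        exact aeval_X_eq_map p
      rw [h5] at h4
      exact MvPolynomial.map_injective _ (algebraMap E Ω).injective (by rw [h4, map_zero])
    have := (exchange (K := E) _ v hAI (fun i => hv _ ⟨_, rfl⟩)).1
    simp at this
    omega
  refine ⟨hr, step1 h2 hr G hY η hη fun k => ?_⟩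
  have hmem : MvPolynomial.X (⟨q + 1 + k - 2, by have := k.2; omega⟩ : Fin (r - 1)) ∈ J := by
    rw [← hgen, MvPolynomial.aeval_X, hx]
    simp; omega
  have hset : {p | ∃ j : ℕ, 1 ≤ j ∧ j ≤ m ∧ p = δ' j} =
      Set.range (fun j : Fin m => δ' (j + 1)) := by
    ext p
    constructor
    · rintro ⟨j, h1, h2, rfl⟩
      exact ⟨⟨j - 1, by omega⟩, by simp [Nat.sub_add_cancel h1]⟩
    · rintro ⟨j, rfl⟩
      exact ⟨j + 1, by omega, j.2, rfl⟩
  rw [hJ, hset, Ideal.mem_span_range_iff_exists_fun] at hmem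
  obtain ⟨c, hc⟩ := hmem
  refine ⟨fun j => MvPolynomial.map (algebraMap E Ω) (c j), ?_⟩
  have := congrArg (MvPolynomial.map (algebraMap E Ω)) hc
  rw [MvPolynomial.map_X, map_sum] at this
  rw [← this]
  refine Finset.sum_congr rfl fun j _ => ?_
  rw [map_mul, hδ']

open Polynomial in
theorem step7 {K Ω : Type*} [Field K] [CharZero K] [Field Ω] [Algebra K Ω]
    (F : IntermediateField K Ω)
    {m n : ℕ} (G : MvPolynomial (Fin n) Ω) (hG : ∀ μ, G.coeff μ ∈ F) (η ξ : Fin n → Ω) (u : Ω)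
    (hu : u ≠ 0) (hα : ∀ i, η i + u * ξ i ∈ F) (e : Fin m → Fin n) (he : Function.Injective e)
    (hη : ∀ i, i ∉ Set.range e → η i ∈ F) (hdiv : X ^ (m + 1) ∣ lineRes η ξ G)
    (hdet : detM η ξ G e (fun j => (j : ℕ) + 1) ≠ 0) (k : Fin m) : IsAlgebraic F (η (e k)) := by
  by_contra htr
  obtain ⟨D, hD⟩ := exists_derivation (F := F) (η (e k)) htr
  have hDF : ∀ z ∈ F, D z = 0 := fun z hz => D.map_algebraMap ⟨z, hz⟩
  obtain ⟨GF, hGF⟩ : ∃ GF : MvPolynomial (Fin n) F, MvPolynomial.map (algebraMap F Ω) GF = G := by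
    have := (MvPolynomial.mem_range_map_iff_coeffs_subset (f := algebraMap F Ω) (x := G)).2 (by
      intro z hz
      obtain ⟨μ, _, rfl⟩ := MvPolynomial.mem_coeffs_iff.1 hz
      exact ⟨⟨_, hG μ⟩, rfl⟩)
    exact this
  have h1 := key_div D GF G hGF.symm η ξ u hu (fun i => hDF _ (hα i)) hdiv
  rw [X_pow_dvd_iff] at h1
  have h2 := Matrix.eq_zero_of_mulVec_eq_zero (v := fun k => D (η (e k))) hdet (by
    funext j
    have h3 := h1 (j + 1) (by omega)
    rw [finset_sum_coeff] at h3
    rw [Pi.zero_apply, ← h3]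
    simp only [Matrix.mulVec, dotProduct, Matrix.of_apply, coeff_C_mul]
    refine Finset.sum_of_injOn e he.injOn (fun _ _ => by simp) ?_ ?_
    · intro i _ hi
      rw [hDF _ (hη i (by simpa using hi)), zero_mul]
    · intro i _
      rw [mul_comm])
  exact hD (congrFun h2 k)


/-- The monomials of degree `D` involving a `Y`-variable. -/
abbrev IBt (n D q : ℕ) : Type :=
  {μ : Fin n →₀ ℕ // (∑ i, μ i) = D ∧ ∃ i : Fin n, q < (i : ℕ) ∧ μ i ≠ 0}

/-- The relative algebraic closure of an intermediate field. -/
noncomputable def clos {K Ω : Type*} [Field K] [Field Ω] [Algebra K Ω]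
    (L : IntermediateField K Ω) : IntermediateField K Ω :=
  (algebraicClosure L Ω).restrictScalars K

theorem mem_clos {K Ω : Type*} [Field K] [Field Ω] [Algebra K Ω]
    {L : IntermediateField K Ω} {z : Ω} : z ∈ clos L ↔ IsAlgebraic L z := by
  unfold clos
  rw [IntermediateField.mem_restrictScalars, mem_algebraicClosure_iff]

theorem le_clos {K Ω : Type*} [Field K] [Field Ω] [Algebra K Ω]
    (L : IntermediateField K Ω) : L ≤ clos L := fun z hz =>
  mem_clos.2 (isAlgebraic_algebraMap (⟨z, hz⟩ : L))

theorem adjoin_adjoin_mem {K Ω : Type*} [Field K] [Field Ω] [Algebra K Ω]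
    (E F : IntermediateField K Ω) (hEF : E ≤ F) (S : Set Ω) (hS : S ⊆ F) {z : Ω}
    (hz : z ∈ IntermediateField.adjoin E S) : z ∈ F := by
  have : IntermediateField.adjoin E S ≤ IntermediateField.extendScalars hEF :=
    IntermediateField.adjoin_le_iff.2 hS
  exact this hz

theorem coeff_mem_of {K A : Type*} [Field K] [Field A] [Algebra K A] {n D q : ℕ}
    (G : MvPolynomial (Fin n) A)
    (hG : G.IsHomogeneous D)
    (hY : ∀ μ ∈ G.support, ∃ i : Fin n, q < (i : ℕ) ∧ μ i ≠ 0)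
    (F : IntermediateField K A) (h : ∀ μ : IBt n D q, G.coeff μ.1 ∈ F) (ν : Fin n →₀ ℕ) :
    G.coeff ν ∈ F := by
  by_cases hν : ν ∈ G.support
  · have h1 : (∑ i, ν i) = D := by
      have := hG (MvPolynomial.mem_support_iff.1 hν)
      rw [← this, Finsupp.weight_apply, Finsupp.sum_fintype] <;> simp
    exact h ⟨ν, h1, hY ν hν⟩
  · rw [MvPolynomial.notMem_support_iff] at hν
    rw [hν]; exact F.zero_mem

theorem etaOf_mem {K A : Type*} [Field K] [Field A] [Algebra K A] (F : IntermediateField K A)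
    {n m : ℕ} (y : Fin m → A) (hy : ∀ k, y k ∈ F) (i : Fin n) : etaOf n m y i ∈ F := by
  unfold etaOf; split_ifs
  · exact F.one_mem
  · exact hy _
  · exact F.zero_mem

theorem xiOf_mem {K A : Type*} [Field K] [Field A] [Algebra K A] (F : IntermediateField K A)
    {r : ℕ} (x : Fin (r - 1) → A) (hx : ∀ k, x k ∈ F) (i : Fin (r + 1)) : xiOf r x i ∈ F := by
  unfold xiOf; split_ifs
  · exact F.zero_mem
  · exact F.one_mem
  · exact hx _

theorem step4 {K Ω : Type*} [Field K] [CharZero K] [Field Ω] [Algebra K Ω]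
    (E : IntermediateField K Ω)
    {m q r : ℕ} (hmq : m ≤ q)
    (G : MvPolynomial (Fin (r + 1)) Ω)
    (hY : ∀ μ ∈ G.support, ∃ i : Fin (r + 1), q < (i : ℕ) ∧ μ i ≠ 0)
    (η : Fin (r + 1) → Ω) (hη : ∀ i : Fin (r + 1), q < (i : ℕ) → η i = 0)
    (x : Fin (r - 1) → Ω)
    (δ' : ℕ → MvPolynomial (Fin (r - 1)) E)
    (hδ' : ∀ j, MvPolynomial.map (algebraMap E Ω) (δ' j)
      = MvPolynomial.aeval (sig Ω r) (polar G η j))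
    (J : Ideal (MvPolynomial (Fin (r - 1)) E))
    (hJ : J = Ideal.span {p | ∃ j : ℕ, 1 ≤ j ∧ j ≤ m ∧ p = δ' j})
    (hgen : ∀ p, MvPolynomial.aeval x p = 0 ↔ p ∈ J) :
    ∀ j ≤ m, (lineRes η (xiOf r x) G).coeff j = 0 := by
  have hcz : CharZero Ω := charZero_of_injective_algebraMap (algebraMap K Ω).injective
  intro j hj
  rcases Nat.eq_zero_or_pos j with rfl | hj0
  · rw [Polynomial.coeff_zero_eq_eval_zero, lineRes_eval]
    have := aeval_eq_zero_of_Y (B := Ω) (q := q) G hY (fun i => η i + 0 * xiOf r x i)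
      (fun i hi => by simp [hη i hi])
    rwa [MvPolynomial.aeval_eq_eval] at this
  · have h1 : MvPolynomial.aeval x (δ' j) = 0 := by
      rw [hgen, hJ]; exact Ideal.subset_span ⟨j, hj0, hj, rfl⟩
    have h2 : MvPolynomial.aeval x (δ' j) =
        MvPolynomial.aeval (R := Ω) x (MvPolynomial.map (algebraMap E Ω) (δ' j)) := by
      rw [MvPolynomial.aeval_map_algebraMap]
    have h3 : (fun i => MvPolynomial.aeval x (sig Ω r i)) = xiOf r x := by
      funext i
      unfold sig xiOf
      split_ifs <;> simp
    rw [h2, hδ', ← AlgHom.comp_apply, MvPolynomial.comp_aeval, h3, polar_eval] at h1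
    have h4 := (mul_eq_zero.1 h1).resolve_left (by exact_mod_cast j.factorial_ne_zero)
    simp only [Algebra.algebraMap_self, RingHom.id_apply, MvPolynomial.map_id] at h4
    exact h4

open Polynomial in
theorem core {K Ω : Type*} [Field K] [CharZero K] [Field Ω] [Algebra K Ω] {D m q r : ℕ}
    (hmD : m + 2 = D) (hm : 2 ≤ m) (hmq : m ≤ q) (hqr : q < r)
    (G : MvPolynomial (Fin (r + 1)) Ω) (hG : G.IsHomogeneous D)
    (hY : ∀ μ ∈ G.support, ∃ i : Fin (r + 1), q < (i : ℕ) ∧ μ i ≠ 0)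
    (hb : AlgebraicIndependent K (fun μ : IBt (r + 1) D q => G.coeff μ.1))
    (η ξ : Fin (r + 1) → Ω) (y : Fin m → Ω) (x : Fin (r - 1) → Ω)
    (hη : η = etaOf (r + 1) m y) (hξ : ξ = xiOf r x)
    (E1 E2 E3 : IntermediateField K Ω)
    (hE1 : E1 = IntermediateField.adjoin K (Set.range G.coeff))
    (hE2 : E2 = IntermediateField.adjoin K (Set.range G.coeff ∪ Set.range η))
    (hE3 : E3 = IntermediateField.adjoin K (Set.range G.coeff ∪ Set.range η ∪ Set.range ξ))
    (hyind : AlgebraicIndependent E1 y)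
    (δ' : ℕ → MvPolynomial (Fin (r - 1))
      E2)
    (hδ' : ∀ j, MvPolynomial.map (algebraMap
      E2 Ω) (δ' j)
      = MvPolynomial.aeval (sig Ω r) (polar G η j))
    (J : Ideal (MvPolynomial (Fin (r - 1))
      E2))
    (hJ : J = Ideal.span {p | ∃ j : ℕ, 1 ≤ j ∧ j ≤ m ∧ p = δ' j})
    (hgen : ∀ p, MvPolynomial.aeval x p = 0 ↔ p ∈ J)
    (htr : FieldTrdegEq E2 Ω
      (Set.range x) (r - 1 - m))
    (u : Ω)
    (hu : Transcendental E3 u) :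
    AlgebraicIndependent E1
      (fun i : Fin r => η ⟨(i : ℕ) + 1, by have := i.isLt; omega⟩
          + u * ξ ⟨(i : ℕ) + 1, by have := i.isLt; omega⟩) := by
  classical
  have hfin : Finite (IBt (r + 1) D q) := mons_finite _ _ _
  have : Fintype (IBt (r + 1) D q) := Fintype.ofFinite _
  set b : IBt (r + 1) D q → Ω := fun μ => G.coeff μ.1 with hbdef
  have hGsum : G = ∑ μ : IBt (r + 1) D q, MvPolynomial.monomial μ.1 (b μ) :=
    G_eq_sum (q := q) G hG hY
  have hcoeff := fun F : IntermediateField K Ω => coeff_mem_of (q := q) G hG hY F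
  have hηz : ∀ i : Fin (r + 1), q < (i : ℕ) → η i = 0 := by
    intro i hi
    rw [hη]; unfold etaOf; rw [if_neg (by omega), dif_neg (by omega)]
  have hby : AlgebraicIndependent K (Sum.elim y b) := by
    refine hb.sumElim_of_tower (S := E1) ?_ hyind
    rintro _ ⟨μ, rfl⟩
    exact ⟨⟨b μ, hE1 ▸ IntermediateField.subset_adjoin _ _ ⟨μ.1, rfl⟩⟩, rfl⟩
  have hyη : ∀ k : Fin m, y k = η ⟨k + 1, by omega⟩ := by
    intro k; rw [hη]; simp [etaOf]
  have hxξ : ∀ k : Fin (r - 1), x k = ξ ⟨k + 2, by omega⟩ := by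
    intro k; rw [hξ]; simp [xiOf]
  have hE12 : ∀ z ∈ E2, z ∈ E3 := by
    intro z hz
    rw [hE2] at hz; rw [hE3]
    exact IntermediateField.adjoin.mono _ _ _ Set.subset_union_left hz
  -- a nonvanishing coordinate
  obtain ⟨c, hc, hξc⟩ : ∃ c : Fin (r + 1), q < (c : ℕ) ∧ ξ c ≠ 0 := by
    by_contra hcon
    push Not at hcon
    obtain ⟨hr, heq⟩ := step3 E2 (by omega) hmq hqr G hY η hηz x
      (fun i hi => by rw [hxξ]; exact hcon _ hi) δ' hδ' J hJ hgen htr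
    have hby' : AlgebraicIndependent K (Sum.elim b y) := by
      have := hby.comp Sum.swap Sum.swap_leftInverse.injective
      convert this using 1
      funext i; cases i <;> rfl
    have := step2 hm hmD hmq hr (fun μ : IBt (r + 1) D q => μ.1) Subtype.val_injective
      (fun μ h1 h2 => ⟨⟨μ, h1, h2⟩, rfl⟩) b y hby'
    simp only at this
    rw [← hGsum, ← hη] at this
    exact this heq
  have hvan : ∀ j ≤ m, (lineRes η ξ G).coeff j = 0 := by
    rw [hξ]; exact step4 E2 hmq G hY η hηz x δ' hδ' J hJ hgen
  have hdiv : X ^ (m + 1) ∣ lineRes η ξ G := by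
    rw [X_pow_dvd_iff]; intro j hj; exact hvan j (by omega)
  obtain ⟨v, hvAI, hvmem, hvalg⟩ := htr
  have hη0 : η 0 = 1 := by rw [hη]; simp [etaOf]
  have hξ0 : ξ 0 = 0 := by rw [hξ]; simp [xiOf]
  have hc0 : (0 : Fin (r + 1)) ≠ c := by
    intro h; rw [← h] at hc; simp at hc
  -- big families
  have hvy : AlgebraicIndependent K (Sum.elim v (Sum.elim y b)) := by
    refine hby.sumElim_of_tower (S := E2) ?_ hvAI
    rintro _ ⟨k | μ, rfl⟩
    · exact ⟨⟨y k, hE2 ▸ IntermediateField.subset_adjoin _ _ (Or.inr ⟨_, (hyη k).symm⟩)⟩, rfl⟩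
    · exact ⟨⟨b μ, hE2 ▸ IntermediateField.subset_adjoin _ _ (Or.inl ⟨μ.1, rfl⟩)⟩, rfl⟩
  have hvE3 : ∀ F : IntermediateField K Ω, (∀ μ, b μ ∈ F) → (∀ k, y k ∈ F) → (∀ k, x k ∈ F) →
      ∀ k, v k ∈ F := by
    intro F h1 h2 h3 k
    refine adjoin_adjoin_mem E2 F ?_ (Set.range x) ?_ (hvmem k)
    · rw [hE2]
      refine IntermediateField.adjoin_le_iff.2 ?_
      rintro _ (⟨μ, rfl⟩ | ⟨i, rfl⟩)
      · exact hcoeff F h1 μ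
      · rw [hη]; exact etaOf_mem F y h2 i
    · rintro _ ⟨i, rfl⟩; exact h3 i
  have hbE3 : ∀ μ, b μ ∈ E3 := fun μ =>
    by rw [hE3]; exact IntermediateField.subset_adjoin K (Set.range G.coeff ∪ Set.range η ∪ Set.range ξ) (Or.inl (Or.inl ⟨μ.1, rfl⟩))
  have hyE3 : ∀ k, y k ∈ E3 := fun k =>
    by rw [hE3]; exact IntermediateField.subset_adjoin K (Set.range G.coeff ∪ Set.range η ∪ Set.range ξ) (Or.inl (Or.inr ⟨_, (hyη k).symm⟩))
  have hxE3 : ∀ k, x k ∈ E3 := fun k =>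
    by rw [hE3]; exact IntermediateField.subset_adjoin K (Set.range G.coeff ∪ Set.range η ∪ Set.range ξ) (Or.inr ⟨_, (hxξ k).symm⟩)
  have huy : AlgebraicIndependent K
      (Sum.elim (fun _ : Unit => u) (Sum.elim v (Sum.elim y b))) := by
    refine hvy.sumElim_of_tower (S := E3) ?_ (algebraicIndependent_unique_type_iff.2 hu)
    rintro _ ⟨k | k | μ, rfl⟩
    · exact ⟨⟨v k, hvE3 E3 hbE3 hyE3 hxE3 k⟩, rfl⟩
    · exact ⟨⟨y k, hyE3 k⟩, rfl⟩
    · exact ⟨⟨b μ, hbE3 μ⟩, rfl⟩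
  have hu0 : u ≠ 0 := by rintro rfl; exact hu isAlgebraic_zero
  -- step C
  let star : Fin m → IBt (r + 1) D q := fun k =>
    ⟨Finsupp.single (0 : Fin (r + 1)) (D - 1 - k) + Finsupp.single c ((k : ℕ) + 1), by
      have := k.2
      constructor
      · simp only [Finsupp.add_apply, Finset.sum_add_distrib, Finsupp.single_apply,
          Finset.sum_ite_eq, Finset.mem_univ, if_true]
        omega
      · exact ⟨c, hc, by simp⟩⟩
  have hstar : Function.Injective star := by
    intro k l h
    have := congrArg (fun μ : IBt (r + 1) D q => μ.1 c) h
    simp [star, Finsupp.single_apply, hc0] at this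
    exact Fin.ext this
  let eqv : Fin m ⊕ ((Set.range star)ᶜ : Set (IBt (r + 1) D q)) ≃ IBt (r + 1) D q :=
    ((Equiv.ofInjective star hstar).sumCongr (Equiv.refl _)).trans
      (Equiv.Set.sumCompl (Set.range star))
  have heqv1 : ∀ k, eqv (Sum.inl k) = star k := fun k => by simp [eqv]
  have heqv2 : ∀ k, eqv (Sum.inr k) = k.1 := fun k => by simp [eqv]
  let b' : ((Set.range star)ᶜ : Set (IBt (r + 1) D q)) → Ω := fun μ => b μ.1
  let G' : MvPolynomial (Fin (r + 1)) Ω := ∑ a, MvPolynomial.monomial a.1.1 (b' a)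
  have hGG' : G = G' + ∑ k : Fin m, MvPolynomial.monomial (Finsupp.single (0 : Fin (r + 1)) (D - 1 - k) +
      Finsupp.single c ((k : ℕ) + 1)) (b (star k)) := by
    conv_lhs => rw [hGsum, ← Equiv.sum_comp eqv, Fintype.sum_sum_type]
    rw [add_comm G']
    simp only [heqv1, heqv2]
    rfl
  have hcard : Nat.card (IBt (r + 1) D q) =
      m + Nat.card ((Set.range star)ᶜ : Set (IBt (r + 1) D q)) := by
    rw [← Nat.card_congr eqv, Nat.card_sum]; simp
  have hy1 : AlgebraicIndependent K (Sum.elim b' (Sum.elim y x)) := by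
    set L := IntermediateField.adjoin K (Set.range (Sum.elim b' (Sum.elim y x))) with hL
    have hb'L : ∀ a, b' a ∈ L := fun a => IntermediateField.subset_adjoin _ _ ⟨Sum.inl a, rfl⟩
    have hyL : ∀ a, y a ∈ L := fun a =>
      IntermediateField.subset_adjoin _ _ ⟨Sum.inr (Sum.inl a), rfl⟩
    have hxL : ∀ a, x a ∈ L := fun a =>
      IntermediateField.subset_adjoin _ _ ⟨Sum.inr (Sum.inr a), rfl⟩
    have hG'L : ∀ μ, G'.coeff μ ∈ L := by
      intro μ
      simp only [G', MvPolynomial.coeff_sum, MvPolynomial.coeff_monomial]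
      refine sum_mem fun a _ => ?_
      split_ifs
      · exact hb'L a
      · exact zero_mem _
    have hbs := stepC L η ξ (by rw [hη]; exact etaOf_mem L y hyL) (by rw [hξ]; exact xiOf_mem L x hxL)
      G' hG'L 0 c hη0 (hηz c hc) hξ0 hξc (fun k : Fin m => D - 1 - k) (fun k => b (star k))
      (by intro j; rw [← hGG']; exact hvan _ (by omega))
    have hbL : ∀ μ, b μ ∈ L := by
      intro μ
      by_cases h : μ ∈ Set.range star
      · obtain ⟨k, rfl⟩ := h; exact hbs k
      · exact hb'L ⟨μ, h⟩
    refine (exchange _ _ hvy ?_).2 ?_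
    · intro i
      rw [← hL, ← mem_clos]
      apply le_clos
      rcases i with k | k | μ
      · exact hvE3 L hbL hyL hxL k
      · exact hyL k
      · exact hbL μ
    · simp only [Nat.card_sum, hcard, Nat.card_fin]
      omega
  -- determinant
  have hdet : detM η ξ G (fun k : Fin m => (⟨k + 1, by omega⟩ : Fin (r + 1)))
      (fun j => (j : ℕ) + 1) ≠ 0 := by
    have h1 := step6 hmD hmq (by omega) hqr c hc
      (fun a : ((Set.range star)ᶜ : Set (IBt (r + 1) D q)) => a.1.1)
      (Subtype.val_injective.comp Subtype.val_injective) (by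
        intro k
        have hk := k.2
        refine ⟨⟨⟨Finsupp.single (⟨k + 1, by omega⟩ : Fin (r + 1)) 1 +
          (Finsupp.single (0 : Fin (r + 1)) (D - 2 - k) + Finsupp.single c ((k : ℕ) + 1)), ?_, ?_⟩, ?_⟩, rfl⟩
        · simp only [Finsupp.add_apply, Finset.sum_add_distrib, Finsupp.single_apply,
            Finset.sum_ite_eq, Finset.mem_univ, if_true]
          omega
        · exact ⟨c, hc, by simp⟩
        · rintro ⟨l, hl⟩
          have h3 := congrArg (fun μ : IBt (r + 1) D q => μ.1 ⟨k + 1, by omega⟩) hl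
          have h4 : c ≠ (⟨k + 1, by omega⟩ : Fin (r + 1)) := by
            intro h; rw [h] at hc; simp at hc; omega
          have h5 : (0 : Fin (r + 1)) ≠ (⟨k + 1, by omega⟩ : Fin (r + 1)) := by
            intro h; simp [Fin.ext_iff] at h
          simp [star, Finsupp.single_apply, h4, h5] at h3) b' y x hy1
    rw [← hη, ← hξ] at h1
    have h2 : ∀ i : Fin m, MvPolynomial.pderiv (⟨i + 1, by omega⟩ : Fin (r + 1)) G =
        MvPolynomial.pderiv (⟨i + 1, by omega⟩ : Fin (r + 1)) G' := by
      intro i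
      have hi := i.2
      rw [hGG', map_add, add_eq_left, map_sum]
      refine Finset.sum_eq_zero ?_
      intro k _
      have h4 : c ≠ (⟨i + 1, by omega⟩ : Fin (r + 1)) := by
        intro h; rw [h] at hc; simp at hc; omega
      have h5 : (0 : Fin (r + 1)) ≠ (⟨i + 1, by omega⟩ : Fin (r + 1)) := by
        intro h; simp [Fin.ext_iff] at h
      rw [MvPolynomial.pderiv_monomial]
      simp [Finsupp.single_apply, h4, h5]
    unfold detM at h1 ⊢
    simp only [h2]
    exact h1
  -- final
  set α : Fin r → Ω := fun i => η ⟨(i : ℕ) + 1, by have := i.isLt; omega⟩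
          + u * ξ ⟨(i : ℕ) + 1, by have := i.isLt; omega⟩ with hα
  have hfinal : AlgebraicIndependent K (Sum.elim α b) := by
    set F := IntermediateField.adjoin K (Set.range (Sum.elim α b)) with hF
    have hbF : ∀ a, b a ∈ F := fun a => IntermediateField.subset_adjoin _ _ ⟨Sum.inr a, rfl⟩
    have hαF : ∀ a, α a ∈ F := fun a => IntermediateField.subset_adjoin _ _ ⟨Sum.inl a, rfl⟩
    have hαF' : ∀ i, η i + u * ξ i ∈ F := by
      intro i
      by_cases hi : (i : ℕ) = 0
      · have : i = 0 := Fin.ext hi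
        rw [this, hη0, hξ0, mul_zero, add_zero]; exact F.one_mem
      · have := hαF ⟨i - 1, by omega⟩
        simp only [hα] at this
        convert this using 3 <;> (try congr 1) <;> (apply Fin.ext; simp; omega)
    have hyC : ∀ k, y k ∈ clos F := by
      intro k
      rw [mem_clos, hyη]
      refine step7 F G (hcoeff F hbF) η ξ u hu0 hαF'
        (fun k : Fin m => (⟨k + 1, by omega⟩ : Fin (r + 1))) ?_ ?_ hdiv hdet k
      · intro a b h; simp at h; exact Fin.ext h
      · intro i hi
        rw [hη]; unfold etaOf
        split_ifs with h1 h2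
        · exact F.one_mem
        · exact absurd ⟨⟨i - 1, h2⟩, by apply Fin.ext; simp; omega⟩ hi
        · exact F.zero_mem
    have hηC : ∀ i, η i ∈ clos F := by rw [hη]; exact etaOf_mem _ y hyC
    have huξ : ∀ i, u * ξ i ∈ clos F := by
      intro i
      have := (clos F).sub_mem (le_clos F (hαF' i)) (hηC i)
      simpa using this
    have huC : u ∈ clos F := by
      have := huξ ⟨1, by omega⟩
      have h1 : ξ ⟨1, by omega⟩ = 1 := by rw [hξ]; simp [xiOf]
      rwa [h1, mul_one] at this
    have hxC : ∀ k, x k ∈ clos F := by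
      intro k
      have := (clos F).div_mem (huξ ⟨k + 2, by omega⟩) huC
      rwa [← hxξ, mul_div_cancel_left₀ _ hu0] at this
    have hbC : ∀ a, b a ∈ clos F := fun a => le_clos F (hbF a)
    refine (exchange _ _ huy ?_).2 ?_
    · intro i
      rw [← hF, ← mem_clos]
      rcases i with k | k | k | μ
      · exact huC
      · exact hvE3 _ hbC hyC hxC k
      · exact hyC k
      · exact hbC μ
    · simp only [Nat.card_sum, Nat.card_fin, Nat.card_unique]
      omega
  have h2 := (AlgebraicIndependent.sumElim_iff.1 hfinal).2
  rw [← IntermediateField.algebraicIndependent_adjoin_iff] at h2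
  have hEq : E1 = IntermediateField.adjoin K (Set.range b) := by
    rw [hE1]
    apply le_antisymm
    · refine IntermediateField.adjoin_le_iff.2 ?_
      rintro _ ⟨μ, rfl⟩
      exact hcoeff (IntermediateField.adjoin K (Set.range b))
        (fun μ => IntermediateField.subset_adjoin _ _ (Set.mem_range_self μ)) μ
    · refine IntermediateField.adjoin_le_iff.2 ?_
      rintro _ ⟨μ, rfl⟩
      exact IntermediateField.subset_adjoin _ _ ⟨μ.1, rfl⟩
  rw [hEq]
  exact h2


/-- **Corollary 8 of the paper.** In the situation of the residual-point lemma — `K'` of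
characteristic zero, `d ≥ 3`, `2d - 2 ≤ q < r`, `G = Σ_{|I|<2d} b_{I,J} Z^I Y^J`
homogeneous of degree `2d` with every monomial involving a `Y`-variable and all
coefficients algebraically independent over `K'`, `η = (1, η_1, …, η_{2d-2}, 0, …, 0)`
with the `η_i` algebraically independent over `K'(b)`, and `ξ = (0, 1, ξ_2, …, ξ_r)` a
generic point over `K'(b,η)` of the (assumed irreducible, of dimension `r - 2d + 1`)
variety `F*_η` cut out by `Z_0 = 0` and the polars `Δ^j_η(G) = 0`, `j = 1, …, 2d-2` —
let `u` be transcendental over `K'(b, η, ξ)` and set `α := η + uξ = (1, α_1, …, α_r)`.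
Then `trdeg_{K'(b)} K'(b)(α_1, …, α_r) = r`; that is, `α` is a generic point of `ℙ^r`
over `K'_1 = K'(b)`. -/
theorem stmt_9 (K' : Type u) [Field K'] [CharZero K'] (d q r : ℕ)
    (hd : 3 ≤ d) (hdq : 2 * d - 2 ≤ q) (hqr : q < r)
    (Ω : Type u) [Field Ω] [Algebra K' Ω]
    (G : MvPolynomial (Fin (r + 1)) Ω) (hG : G.IsHomogeneous (2 * d))
    (hY : ∀ μ ∈ G.support, ∃ i : Fin (r + 1), q < (i : ℕ) ∧ μ i ≠ 0)
    (hb : AlgebraicIndependent K'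
      (fun μ : {μ : Fin (r + 1) →₀ ℕ //
        (∑ i, μ i) = 2 * d ∧ ∃ i : Fin (r + 1), q < (i : ℕ) ∧ μ i ≠ 0} => G.coeff μ.1))
    (η : Fin (r + 1) → Ω) (hη0 : η 0 = 1)
    (hηz : ∀ i : Fin (r + 1), 2 * d - 2 < (i : ℕ) → η i = 0)
    (hηind : AlgebraicIndependent
      (↥(IntermediateField.adjoin K' (Set.range G.coeff)))
      (fun j : Fin (2 * d - 2) => η ⟨(j : ℕ) + 1, by have := j.isLt; omega⟩))
    (ξ : Fin (r + 1) → Ω) (hξ0 : ξ 0 = 0) (hξ1 : ξ ⟨1, by omega⟩ = 1)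
    (δ' : ℕ → MvPolynomial (Fin (r - 1))
      (↥(IntermediateField.adjoin K' (Set.range G.coeff ∪ Set.range η))))
    (hδ' : ∀ j, MvPolynomial.map
        (algebraMap (↥(IntermediateField.adjoin K'
          (Set.range G.coeff ∪ Set.range η))) Ω) (δ' j)
      = MvPolynomial.aeval (fun i : Fin (r + 1) =>
          if _h1 : (i : ℕ) = 0 then 0
          else if _h2 : (i : ℕ) = 1 then 1
          else MvPolynomial.X (⟨(i : ℕ) - 2, by have := i.isLt; omega⟩ : Fin (r - 1)))
        (polar G η j))
    (J : Ideal (MvPolynomial (Fin (r - 1))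
      (↥(IntermediateField.adjoin K' (Set.range G.coeff ∪ Set.range η)))))
    (hJ : J = Ideal.span {p | ∃ j : ℕ, 1 ≤ j ∧ j ≤ 2 * d - 2 ∧ p = δ' j})
    (hJprime : J.IsPrime)
    (hξgen : ∀ p, MvPolynomial.aeval
        (fun i : Fin (r - 1) => ξ ⟨(i : ℕ) + 2, by have := i.isLt; omega⟩) p = 0
      ↔ p ∈ J)
    (hξtrdeg : FieldTrdegEq
      (↥(IntermediateField.adjoin K' (Set.range G.coeff ∪ Set.range η))) Ω
      (Set.range fun i : Fin (r - 1) => ξ ⟨(i : ℕ) + 2, by have := i.isLt; omega⟩)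
      (r + 1 - 2 * d))
    (u : Ω)
    (hu : Transcendental
      (↥(IntermediateField.adjoin K'
        (Set.range G.coeff ∪ Set.range η ∪ Set.range ξ))) u) :
    FieldTrdegEq (↥(IntermediateField.adjoin K' (Set.range G.coeff))) Ω
      (Set.range fun i : Fin r =>
        η ⟨(i : ℕ) + 1, by have := i.isLt; omega⟩
          + u * ξ ⟨(i : ℕ) + 1, by have := i.isLt; omega⟩)
      r := by
  have hE : (fun i : Fin (r + 1) =>
          if _h1 : (i : ℕ) = 0 then 0
          else if _h2 : (i : ℕ) = 1 then 1
          else MvPolynomial.X (⟨(i : ℕ) - 2, by have := i.isLt; omega⟩ : Fin (r - 1))) = sig Ω r :=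
    rfl
  have hn : r + 1 - 2 * d = r - 1 - (2 * d - 2) := by omega
  rw [hn] at hξtrdeg
  have hηeq : η = etaOf (r + 1) (2 * d - 2)
      (fun j : Fin (2 * d - 2) => η ⟨(j : ℕ) + 1, by have := j.isLt; omega⟩) := by
    funext i
    unfold etaOf
    split_ifs with h1 h2
    · have : i = 0 := Fin.ext h1
      rw [this, hη0]
    · congr 1
      apply Fin.ext
      simp
      omega
    · exact hηz i (by omega)
  have hξeq : ξ = xiOf r
      (fun i : Fin (r - 1) => ξ ⟨(i : ℕ) + 2, by have := i.isLt; omega⟩) := by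
    funext i
    unfold xiOf
    split_ifs with h1 h2
    · have : i = 0 := Fin.ext h1
      rw [this, hξ0]
    · have : i = ⟨1, by omega⟩ := Fin.ext h2
      rw [this, hξ1]
    · congr 1
      apply Fin.ext
      simp
      omega
  have key := core (K := K') (D := 2 * d) (m := 2 * d - 2) (q := q) (r := r) (by omega) (by omega)
    hdq hqr G hG hY hb η ξ _ _ hηeq hξeq _ _ _ rfl rfl rfl hηind δ' hδ' J hJ hξgen hξtrdeg u hu
  refine ⟨_, key, fun i => IntermediateField.subset_adjoin _ _ ⟨i, rfl⟩, ?_⟩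
  intro z hz
  exact isAlgebraic_algebraMap (⟨z, IntermediateField.subset_adjoin _ _ hz⟩ :
    IntermediateField.adjoin (IntermediateField.adjoin K' (Set.range G.coeff)) _)
end

section
/- In the situation of the residual-point lemma — K' a field of characteristic zero, d ≥ 3, 2d−2 ≤ q < r, G = Σ_{|I|<2d} b_{I,J} Z^I Y^J homogeneous of degree 2d with every monomial involving a Y-variable and all coefficients algebraically independent over K', η = (1,η_1,…,η_{2d−2},0,…,0) with η_1,…,η_{2d−2} algebraically independent over K'(b), and ξ = (0,1,ξ_2,…,ξ_r) a generic point over K'(b,η) of the (assumed irreducible, (r−2d+1)-dimensional) variety F*_η cut out by Z_0 = 0 and Δ^j_η(G) = 0 for j = 1,…,2d−2 — assume further that K'(b)(η,ξ) admits a K'(b)(η)-algebra embedding into the rational function field K'(b)(η)(t_1,…,t_{r−2d+1}) (unirationality of F*_η). Let t be transcendental over K'(b,η,ξ), set f(t) = G(η + tξ), and let M := K'(b,η,ξ)(t)[w]/(w² − f(t)), the function field of the curve C_{ηξ} = π^{−1}(⟨η,ξ⟩) on the double cover W of P^r branched over B = {G = 0}. Then: (i) M admits a K'(b)-algebra embedding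 into a rational function field K'(b)(u_1,…,u_r) in r variables; and (ii) writing α = η + tξ = (1, α_1,…,α_r), the subfield K'(b)(α_1,…,α_r, w) of M has transcendence degree r over K'(b), so that (α, w) is a generic point of W over K'_1 = K'(b) and the projection p_3 from the family W' of the curves C_{ηξ} to W is dominant. -/
set_option synthInstance.maxHeartbeats 1000000
set_option maxHeartbeats 1000000

universe u

section acl

open AlgebraicIndependent

/-- relative algebraic closure of the field generated by `S` -/
noncomputable def acl (k : Type*) {F : Type*} [Field k] [Field F] [Algebra k F] (S : Set F) :
    IntermediateField k F :=
  (algebraicClosure (IntermediateField.adjoin k S) F).restrictScalars k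

variable {k F : Type*} [Field k] [Field F] [Algebra k F]

theorem mem_acl {S : Set F} {a : F} :
    a ∈ acl k S ↔ IsAlgebraic (IntermediateField.adjoin k S) a := by
  unfold acl
  rw [IntermediateField.mem_restrictScalars, mem_algebraicClosure_iff]

theorem mem_acl_iff {S : Set F} {a : F} :
    a ∈ acl k S ↔ IsAlgebraic (Algebra.adjoin k S) a := by
  rw [mem_acl, IntermediateField.isAlgebraic_adjoin_iff]

theorem mem_acl_iff_closure {S : Set F} {a : F} :
    a ∈ acl k S ↔ a ∈ (matroid k F).closure S := by
  rw [mem_acl_iff, matroid_closure_eq, SetLike.mem_coe, Subalgebra.mem_algebraicClosure]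

theorem coe_acl (S : Set F) : (acl k S : Set F) = (matroid k F).closure S := by
  ext a; exact mem_acl_iff_closure

theorem subset_acl (S : Set F) : S ⊆ acl k S := by
  rw [coe_acl]; exact (matroid k F).subset_closure S (by simp)

theorem acl_le {S T : Set F} (h : S ⊆ acl k T) : acl k S ≤ acl k T := by
  rw [← SetLike.coe_subset_coe, coe_acl, coe_acl]
  rw [coe_acl] at h
  exact (matroid k F).closure_subset_closure_of_subset_closure h

theorem acl_mono {S T : Set F} (h : S ⊆ T) : acl k S ≤ acl k T :=
  acl_le (h.trans (subset_acl T))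

theorem acl_exchange {T : Set F} {x y : F} (h : y ∈ acl k (insert x T)) (h' : y ∉ acl k T) :
    x ∈ acl k (insert y T) := by
  rw [mem_acl_iff_closure] at *
  exact ((matroid k F).closure_exchange ⟨h, h'⟩).1

theorem not_mem_acl {ι : Type*} {x : ι → F} (hx : AlgebraicIndependent k x) {s : Set ι} {i : ι}
    (hi : i ∉ s) : x i ∉ acl k (x '' s) := by
  rw [mem_acl_iff]
  exact hx.transcendental_adjoin hi

theorem mem_acl_of_isAlgebraic {T : Set F} {a : F} (h : IsAlgebraic (acl k T) a) :
    a ∈ acl k T := by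
  have h1 : IsAlgebraic (algebraicClosure (IntermediateField.adjoin k T) F) a := h
  rw [mem_acl]
  exact h1.restrictScalars (IntermediateField.adjoin k T)

theorem indep_of_acl {ι : Type*} [Finite ι] {x : ι → F} (h : ∀ a, a ∈ acl k (Set.range x))
    {κ : Type*} [Finite κ] {y : κ → F} (hy : AlgebraicIndependent k y)
    (hc : Nat.card ι ≤ Nat.card κ) : AlgebraicIndependent k x := by
  have : Algebra.IsAlgebraic (Algebra.adjoin k (Set.range x)) F :=
    ⟨fun a => mem_acl_iff.1 (h a)⟩
  refine (Algebra.IsAlgebraic.isTranscendenceBasis_of_lift_le_trdeg_of_finite k x ?_).1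
  have h1 := hy.lift_cardinalMk_le_trdeg
  obtain ⟨m, hm⟩ : ∃ m, m = Algebra.trdeg k F := ⟨_, rfl⟩
  rw [← hm] at h1 ⊢
  have := Fintype.ofFinite ι
  have := Fintype.ofFinite κ
  rw [Nat.card_eq_fintype_card, Nat.card_eq_fintype_card] at hc
  rw [Cardinal.mk_fintype, Cardinal.lift_natCast] at h1 ⊢
  rw [Cardinal.nat_le_lift_iff] at h1 ⊢
  exact le_trans (by exact_mod_cast hc) h1

theorem card_le_of_acl {ι : Type*} [Finite ι] {x : ι → F} (h : ∀ a, a ∈ acl k (Set.range x))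
    {κ : Type*} [Finite κ] {y : κ → F} (hy : AlgebraicIndependent k y) :
    Nat.card κ ≤ Nat.card ι := by
  by_contra hc
  push Not at hc
  have hx := indep_of_acl h hy hc.le
  have : Algebra.IsAlgebraic (Algebra.adjoin k (Set.range x)) F :=
    ⟨fun a => mem_acl_iff.1 (h a)⟩
  have hb := hx.isTranscendenceBasis_iff_isAlgebraic.2 this
  have h2 := hb.lift_cardinalMk_eq_trdeg
  have h1 := hy.lift_cardinalMk_le_trdeg
  obtain ⟨m, hm⟩ : ∃ m, m = Algebra.trdeg k F := ⟨_, rfl⟩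
  rw [← hm] at h1 h2
  have := Fintype.ofFinite ι
  have := Fintype.ofFinite κ
  rw [Nat.card_eq_fintype_card, Nat.card_eq_fintype_card] at hc
  rw [Cardinal.mk_fintype, Cardinal.lift_natCast] at h1 h2
  rw [Cardinal.nat_le_lift_iff] at h1
  rw [eq_comm, Cardinal.lift_eq_nat_iff] at h2
  rw [h2] at h1
  exact absurd (by exact_mod_cast h1) (not_le.2 hc)

theorem exists_poly₂ {C y : F} (h : IsAlgebraic (Algebra.adjoin k {C}) y) :
    ∃ P : Polynomial (Polynomial k), P ≠ 0 ∧
      P.eval₂ (Polynomial.aeval C : Polynomial k →ₐ[k] F).toRingHom y = 0 := by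
  obtain ⟨p, hp0, hp⟩ := h
  let f : Polynomial k →ₐ[k] Algebra.adjoin k {C} :=
    Polynomial.aeval ⟨C, Algebra.subset_adjoin rfl⟩
  have hf : Function.Surjective f := by
    rintro ⟨a, ha⟩
    have ha' := ha
    rw [Algebra.adjoin_singleton_eq_range_aeval] at ha'
    obtain ⟨q, hq⟩ := ha'
    refine ⟨q, Subtype.ext ?_⟩
    refine Eq.trans ?_ hq
    have := Polynomial.aeval_algHom_apply (Algebra.adjoin k {C}).val
      ⟨C, Algebra.subset_adjoin rfl⟩ q
    exact this.symm
  obtain ⟨P, hP⟩ := Polynomial.map_surjective f.toRingHom hf p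
  refine ⟨P, ?_, ?_⟩
  · rintro rfl
    simp at hP; exact hp0 hP.symm
  · rw [← hP, Polynomial.aeval_def, Polynomial.eval₂_map] at hp
    rw [← hp]
    congr 1
    ext a
    · simp [f]
    · simp [f]

theorem key_aux [CharZero k] (k1 L : IntermediateField k F) {x C R : F}
    (hC : Transcendental L C) (hx : x ∈ L) (hR : R ∈ L) (hx1 : Transcendental k1 x)
    (hkL : k1 ≤ L) : ¬ IsAlgebraic (Algebra.adjoin k1 {C}) (C * x + R) := by
  intro h
  obtain ⟨P, hP0, hP⟩ := exists_poly₂ h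
  -- specialization
  have hinj : Function.Injective (IntermediateField.inclusion hkL) :=
    (IntermediateField.inclusion hkL).injective
  let g : Polynomial k1 →+* Polynomial L :=
    Polynomial.mapRingHom (IntermediateField.inclusion hkL).toRingHom
  let Q : Polynomial L := P.eval₂ g (Polynomial.X * Polynomial.C ⟨x, hx⟩ + Polynomial.C ⟨R, hR⟩)
  have hQ : Q = 0 := by
    rw [transcendental_iff] at hC
    apply hC
    simp only [Q]
    rw [← hP]
    have := Polynomial.hom_eval₂ P g (Polynomial.aeval C : Polynomial L →ₐ[L] F).toRingHom
      (Polynomial.X * Polynomial.C ⟨x, hx⟩ + Polynomial.C ⟨R, hR⟩)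
    refine this.trans ?_
    congr 1
    · ext a
      · simp [g]
      · simp [g]
    · simp only [AlgHom.toRingHom_eq_coe, RingHom.coe_coe, map_add, map_mul, Polynomial.aeval_X,
        Polynomial.aeval_C]; rfl
  have hsp : ∀ c : k1, P.map (Polynomial.evalRingHom c) ≠ 0 →
      IsAlgebraic k1 ((c : F) * x + R) := by
    intro c hc
    refine ⟨_, hc, ?_⟩
    have h1 : Polynomial.eval (IntermediateField.inclusion hkL c) Q = 0 := by rw [hQ]; simp
    have h2 := congrArg (algebraMap L F) h1
    simp only [Q] at h2
    rw [map_zero, ← Polynomial.coe_evalRingHom, Polynomial.hom_eval₂, Polynomial.hom_eval₂] at h2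
    rw [Polynomial.aeval_def, Polynomial.eval₂_map, ← h2]
    congr 1
    · ext a
      · simp [g]
      · simp [g]
    · simp only [Polynomial.coe_evalRingHom, map_add, map_mul, Polynomial.eval_add,
        Polynomial.eval_mul, Polynomial.eval_X, Polynomial.eval_C]; rfl
  obtain ⟨i, hi⟩ : ∃ i, P.coeff i ≠ 0 := by
    by_contra hcon; push Not at hcon
    exact hP0 (Polynomial.ext (by simpa using hcon))
  have : Infinite k1 := by
    have : CharZero k1 := charZero_of_injective_algebraMap (algebraMap k k1).injective
    infer_instance
  have hfin : {c : k1 | P.map (Polynomial.evalRingHom c) = 0}.Finite := by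
    refine (Polynomial.finite_setOfPred_isRoot hi).subset ?_
    intro c hc
    have := congrArg (fun q => Polynomial.coeff q i) (show _ = _ from hc)
    simpa using this
  obtain ⟨c0, h0⟩ := hfin.infinite_compl.nonempty
  obtain ⟨c1, h1, hne⟩ := (hfin.union (Set.finite_singleton c0)).infinite_compl.nonempty.imp
    (fun c hc => (⟨fun h => hc (Or.inl h), fun h => hc (Or.inr h)⟩ :
      c ∉ {c : k1 | P.map (Polynomial.evalRingHom c) = 0} ∧ c ∉ ({c0} : Set k1)))
  have e0 := hsp c0 h0
  have e1 := hsp c1 h1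
  have e := (e1.sub e0)
  have hne' : (c1 - c0 : k1) ≠ 0 := sub_ne_zero.2 hne
  have e2 := (isAlgebraic_algebraMap (A := F) (c1 - c0 : k1)⁻¹).mul e
  apply hx1
  have hne2 : (c1 : F) - c0 ≠ 0 := by
    have : ((c1 - c0 : k1) : F) ≠ 0 := by exact_mod_cast hne'
    simpa using this
  have h3 : (algebraMap k1 F) (c1 - c0)⁻¹ = ((c1 : F) - c0)⁻¹ := by
    rw [map_inv₀, map_sub]; rfl
  have h4 : x = (algebraMap k1 F) (c1 - c0)⁻¹ * (c1 * x + R - (c0 * x + R)) := by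
    rw [h3]
    field_simp
    ring
  rw [h4]
  exact e2

theorem isAlgebraic_of_subset {k k' F : Type*} [Field k] [Field k'] [Field F] [Algebra k F]
    [Algebra k' F] {K1 : IntermediateField k F} {K2 : IntermediateField k' F}
    (h : (K1 : Set F) ⊆ K2) {a : F} (ha : IsAlgebraic K1 a) : IsAlgebraic K2 a := by
  let f : K1 →+* K2 := (algebraMap K1 F).codRestrict K2.toSubring (fun x => h x.2)
  obtain ⟨p, hp0, hp⟩ := ha
  refine ⟨p.map f, (Polynomial.map_ne_zero_iff f.injective).2 hp0, ?_⟩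
  rw [Polynomial.aeval_def, Polynomial.eval₂_map]
  exact hp

theorem key_exchange [CharZero k] {T : Set F} {x C R y : F} (hx : x ∉ acl k T)
    (hC : C ∉ acl k (insert x T)) (hR : R ∈ acl k (insert x T)) (hy : y = C * x + R) :
    x ∈ acl k (insert y (insert C T)) := by
  apply acl_exchange
  · have h1 : R ∈ acl k (insert x (insert C T)) :=
      acl_mono (Set.insert_subset_insert (Set.subset_insert _ _)) hR
    have h2 : x ∈ acl k (insert x (insert C T)) := subset_acl _ (Set.mem_insert _ _)
    have h3 : C ∈ acl k (insert x (insert C T)) :=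
      subset_acl _ (Set.mem_insert_of_mem _ (Set.mem_insert _ _))
    rw [hy]
    exact add_mem (mul_mem h3 h2) h1
  · intro h
    refine key_aux (acl k T) (acl k (insert x T)) (x := x) (C := C) (R := R) ?_ ?_ hR ?_ ?_ ?_
    · exact fun h => hC (mem_acl_of_isAlgebraic h)
    · exact subset_acl _ (Set.mem_insert _ _)
    · exact fun h => hx (mem_acl_of_isAlgebraic h)
    · exact acl_mono (Set.subset_insert _ _)
    · rw [← hy]
      rw [mem_acl] at h
      rw [← IntermediateField.isAlgebraic_adjoin_iff]
      have hle : IntermediateField.adjoin k (insert C T) ≤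
          (IntermediateField.adjoin (acl k T) {C}).restrictScalars k := by
        rw [IntermediateField.adjoin_le_iff]
        rintro a (rfl | ha)
        · exact IntermediateField.subset_adjoin (acl k T) {a} rfl
        · exact (IntermediateField.adjoin (acl k T) {C}).algebraMap_mem
            ⟨a, subset_acl T ha⟩
      exact isAlgebraic_of_subset hle h

end acl

section polarlem
open MvPolynomial

theorem derivative_aeval_polarD {R S : Type*} [CommRing R] [CommRing S] [Algebra R S] {n : ℕ}
    (y x : Fin n → S) (p : MvPolynomial (Fin n ⊕ Fin n) R) :
    Polynomial.derivative (aeval (Sum.elim (fun i => Polynomial.C (y i) + Polynomial.X *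
      Polynomial.C (x i)) (fun i => Polynomial.C (x i))) p) =
    aeval (Sum.elim (fun i => Polynomial.C (y i) + Polynomial.X *
      Polynomial.C (x i)) (fun i => Polynomial.C (x i)))
      (∑ i : Fin n, X (Sum.inr i) * pderiv (Sum.inl i) p) := by
  induction p using MvPolynomial.induction_on with
  | C a =>
    simp [Polynomial.algebraMap_apply]
  | add p q hp hq =>
    simp only [map_add, hp, hq, mul_add, Finset.sum_add_distrib]
  | mul_X p s hp =>
    rw [map_mul, Polynomial.derivative_mul, hp]
    simp only [map_sum, map_mul, Derivation.leibniz, smul_eq_mul, map_add, mul_add,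
      Finset.sum_add_distrib, aeval_X]
    rw [add_comm]
    congr 1
    · rcases s with i | i
      · simp only [Sum.elim_inl, Sum.elim_inr, pderiv_X, Pi.single_apply]
        rw [Finset.sum_eq_single i]
        · simp only [if_true, map_one, Polynomial.derivative_add, Polynomial.derivative_C,
            Polynomial.derivative_mul, Polynomial.derivative_X]
          simp
          ring
        · intro b _ hb
          rw [if_neg (by simpa using Ne.symm hb)]
          simp
        · simp
      · simp only [Sum.elim_inr, Polynomial.derivative_C, mul_zero]
        symm
        apply Finset.sum_eq_zero
        intro b _
        rw [pderiv_X_of_ne (by simp)]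
        simp
    · rw [Finset.sum_mul]
      refine Finset.sum_congr rfl fun i _ => ?_
      ring

theorem aeval_polar {R S : Type*} [CommRing R] [CommRing S] [Algebra R S] {n : ℕ}
    (G : MvPolynomial (Fin n) R) (η : Fin n → R) (j : ℕ) (x : Fin n → S) :
    aeval x (polar G η j) = (j.factorial : S) *
      (aeval (fun i => Polynomial.C (algebraMap R S (η i)) + Polynomial.X * Polynomial.C (x i))
        G : Polynomial S).coeff j := by
  set Ψ : MvPolynomial (Fin n ⊕ Fin n) R →ₐ[R] Polynomial S :=
    aeval (Sum.elim (fun i => Polynomial.C (algebraMap R S (η i)) + Polynomial.X *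
      Polynomial.C (x i)) (fun i => Polynomial.C (x i))) with hΨ
  have h1 : ∀ (j : ℕ) (p : MvPolynomial (Fin n ⊕ Fin n) R),
      Ψ ((fun p => ∑ i : Fin n, X (Sum.inr i) * pderiv (Sum.inl i) p)^[j] p) =
      Polynomial.derivative^[j] (Ψ p) := by
    intro j
    induction j with
    | zero => intro p; rfl
    | succ j ih =>
      intro p
      rw [Function.iterate_succ_apply, Function.iterate_succ_apply, ih,
        hΨ, derivative_aeval_polarD]
  have h2 : ∀ p : MvPolynomial (Fin n ⊕ Fin n) R,
      aeval x (aeval (Sum.elim (fun i => C (η i)) X) p : MvPolynomial (Fin n) R)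
        = (Ψ p).coeff 0 := by
    intro p
    rw [Polynomial.coeff_zero_eq_aeval_zero, ← AlgHom.comp_apply]
    have : (aeval x).comp (aeval (Sum.elim (fun i => C (η i)) X)) =
      (((Polynomial.aeval (0:S)).restrictScalars R).comp Ψ : MvPolynomial (Fin n ⊕ Fin n) R →ₐ[R] S) := by
      apply MvPolynomial.algHom_ext
      rintro (i | i)
      · simp [hΨ]
      · simp [hΨ]
    rw [this]
    rfl
  unfold polar
  rw [h2, h1, Polynomial.coeff_iterate_derivative]
  simp only [zero_add, Nat.descFactorial_self, nsmul_eq_mul]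
  congr 2
  rw [hΨ, aeval_rename]
  rfl

end polarlem

section exch

theorem exchange_family {k F : Type*} [Field k] [Field F] [Algebra k F] [CharZero k]
    {I : Type*} [Finite I] (n : ℕ) (e γ : Fin n → I) (he : Function.Injective e)
    (hdisj : ∀ i j, e i ≠ γ j) (hγ : Function.Injective γ)
    (η : Fin n → F) (b b0 : I → F)
    (hb0e : ∀ m, b0 (e m) = η m) (hb0 : ∀ i, (∀ m, i ≠ e m) → b0 i = b i)
    (hind : AlgebraicIndependent k b0) (hspan : ∀ a, a ∈ acl k (Set.range b0))
    (R : Fin n → F)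
    (hR : ∀ j, R j ∈ acl k (Set.range η ∪ b '' {i | (∀ m, i ≠ e m) ∧ ∀ m, j ≤ m → i ≠ γ m}))
    (hb : ∀ j, b (e j) = -(b (γ j) * η j) + R j) :
    AlgebraicIndependent k b := by
  classical
  let S : ℕ → I → F := fun j i => if ∃ m : Fin n, j ≤ m ∧ i = e m then b0 i else b i
  have hSe : ∀ (j : ℕ) (m : Fin n), j ≤ m → S j (e m) = η m := by
    intro j m h
    simp only [S]
    rw [if_pos ⟨m, h, rfl⟩, hb0e]
  have hSe' : ∀ (j : ℕ) (m : Fin n), (m : ℕ) < j → S j (e m) = b (e m) := by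
    intro j m h
    simp only [S]
    rw [if_neg]
    rintro ⟨m', h1, h2⟩
    rw [he h2] at h; omega
  have hSb : ∀ (j : ℕ) i, (∀ m, i ≠ e m) → S j i = b i := by
    intro j i h
    simp only [S]
    rw [if_neg]
    rintro ⟨m', h1, h2⟩
    exact h _ h2
  have hsp : ∀ j, (∀ m, η m ∈ acl k (S j '' {i | ∀ m : Fin n, j ≤ m → i ≠ γ m})) →
      AlgebraicIndependent k (S j) := by
    intro j hj
    refine indep_of_acl ?_ hind le_rfl
    intro a
    refine acl_le ?_ (hspan a)
    rintro _ ⟨i, rfl⟩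
    by_cases hi : ∃ m, i = e m
    · obtain ⟨m, rfl⟩ := hi
      rw [hb0e]
      exact acl_mono (Set.image_subset_range _ _) (hj m)
    · push Not at hi
      rw [hb0 i hi, ← hSb j i hi]
      exact subset_acl _ ⟨i, rfl⟩
  have main : ∀ j, j ≤ n → ∀ m, η m ∈ acl k (S j '' {i | ∀ m : Fin n, j ≤ m → i ≠ γ m}) := by
    intro j
    induction j with
    | zero =>
      intro _ m
      apply subset_acl
      exact ⟨e m, fun m' _ => hdisj _ _, hSe 0 m (Nat.zero_le _)⟩
    | succ j ih =>
      intro hj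
      have ih := ih (by omega)
      have hSj := hsp j ih
      let J : Fin n := ⟨j, by omega⟩
      let U : Set I := {i | (∀ m : Fin n, j ≤ m → i ≠ γ m) ∧ i ≠ e J}
      let V : Set I := {i | ∀ m : Fin n, j ≤ m → i ≠ γ m}
      let W : Set I := {i | ∀ m : Fin n, j + 1 ≤ m → i ≠ γ m}
      have hUV : S j '' V = insert (η J) (S j '' U) := by
        rw [← hSe j J le_rfl, ← Set.image_insert_eq]
        congr 1
        ext i
        simp only [V, U, Set.mem_ofPred, Set.mem_insert_iff]
        constructor
        · intro h
          by_cases hi : i = e J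
          · exact Or.inl hi
          · exact Or.inr ⟨h, hi⟩
        · rintro (rfl | h)
          · exact fun m _ => hdisj _ _
          · exact h.1
      have hUU : ∀ i ∈ U, S (j + 1) i = S j i := by
        rintro i ⟨-, hi⟩
        by_cases h : ∃ m, i = e m
        · obtain ⟨m, rfl⟩ := h
          rcases lt_or_ge (m : ℕ) j with h1 | h1
          · rw [hSe' _ _ h1, hSe' _ _ (by omega)]
          · have : (m : ℕ) ≠ j := fun h => hi (by congr 1; exact Fin.ext h)
            rw [hSe _ _ h1, hSe _ _ (by omega)]
        · push Not at h
          rw [hSb _ _ h, hSb _ _ h]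
      have hγV : γ J ∉ V := fun h => h J le_rfl rfl
      have hγe : ∀ m, γ J ≠ e m := fun m => (hdisj m J).symm
      have hx : η J ∉ acl k (S j '' U) := by
        rw [← hSe j J le_rfl]
        exact not_mem_acl hSj (fun h => h.2 rfl)
      have hC : b (γ J) ∉ acl k (insert (η J) (S j '' U)) := by
        rw [← hUV, ← hSb j _ hγe]
        exact not_mem_acl hSj hγV
      have hRJ : -R J ∈ acl k (insert (η J) (S j '' U)) := by
        rw [← hUV]
        apply neg_mem
        refine acl_le ?_ (hR J)
        rintro a (⟨m, rfl⟩ | ⟨i, ⟨h1, h2⟩, rfl⟩)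
        · exact ih m
        · apply subset_acl
          exact ⟨i, fun m hm => h2 m hm, hSb j i h1⟩
      have hk := key_exchange (y := -b (e J)) hx hC hRJ (by rw [hb]; ring)
      have hk2 : η J ∈ acl k (S (j + 1) '' W) := by
        refine acl_le ?_ hk
        have hWU : U ⊆ W := fun i hi m hm => hi.1 m (by omega)
        rintro a (rfl | rfl | ⟨i, hi, rfl⟩)
        · apply neg_mem
          apply subset_acl
          exact ⟨e J, fun m _ => hdisj _ _, hSe' _ _ (by simp [J])⟩
        · apply subset_acl
          refine ⟨γ J, fun m hm h => ?_, hSb _ _ hγe⟩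
          have := hγ h
          rw [← this] at hm
          simp [J] at hm
        · apply subset_acl
          exact ⟨i, hWU hi, hUU i hi⟩
      intro m
      have h3 := ih m
      change η m ∈ acl k (S j '' V) at h3
      rw [hUV] at h3
      refine acl_le ?_ h3
      rintro a (rfl | ⟨i, hi, rfl⟩)
      · exact hk2
      · apply subset_acl
        exact ⟨i, fun m hm => hi.1 m (by omega), hUU i hi⟩
  have hSn : S n = b := by
    funext i
    simp only [S]
    rw [if_neg]
    rintro ⟨m, hm, -⟩
    have := m.2; omega
  rw [← hSn]
  exact hsp n (main n le_rfl)

end exch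

section detpart
open MvPolynomial

/-- index set of the admissible monomials -/
abbrev idx (D q r : ℕ) : Type :=
  {μ : Fin (r + 1) →₀ ℕ // (∑ i, μ i) = D ∧ ∃ i : Fin (r + 1), q < (i : ℕ) ∧ μ i ≠ 0}

instance idx_finite (D q r : ℕ) : Finite (idx D q r) := by
  refine Finite.of_injective (β := Fin (r + 1) → Fin (D + 1))
    (fun μ i => ⟨μ.1 i, ?_⟩) ?_
  · have := Finset.single_le_sum (f := fun i => μ.1 i) (fun _ _ => Nat.zero_le _)
      (Finset.mem_univ i)
    have h := μ.2.1
    omega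
  · intro μ ν h
    ext i
    have := congrFun h i
    simpa using this

theorem sum_idx {R : Type*} [CommRing R] {D q r : ℕ} [Fintype (idx D q r)]
    (G : MvPolynomial (Fin (r + 1)) R)
    (hG : G.IsHomogeneous D)
    (hY : ∀ μ ∈ G.support, ∃ i : Fin (r + 1), q < (i : ℕ) ∧ μ i ≠ 0) :
    G = ∑ μ : idx D q r, monomial μ.1 (G.coeff μ.1) := by
  classical
  ext ν
  rw [coeff_sum]
  simp only [coeff_monomial]
  by_cases hν : coeff ν G = 0
  · rw [hν]
    symm
    apply Finset.sum_eq_zero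
    intro μ _
    split_ifs with h
    · rw [h, hν]
    · rfl
  · have hdeg := hG hν
    have hY' := hY ν (by simpa using hν)
    rw [Finset.sum_eq_single (⟨ν, by
      rw [← hdeg, Finsupp.weight_apply, Finsupp.sum_fintype] <;> simp, hY'⟩ : idx D q r)]
    · simp
    · intro μ _ h
      rw [if_neg]
      intro h'
      exact h (Subtype.ext h')
    · simp

/-- the test point -/
noncomputable def tpt {R : Type*} [CommRing R] (q r : ℕ) (x : R) (l : ℕ) (i : Fin (r + 1)) :
    Polynomial R :=
  if (i : ℕ) = 1 then 1 else if (i : ℕ) = 2 then Polynomial.C x else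
    if (i : ℕ) = q + 1 + l then Polynomial.X else 0

/-- linear coefficient of the expansion of `G` -/
noncomputable def Emat {R : Type*} [CommRing R] {r : ℕ} (q : ℕ) (G : MvPolynomial (Fin (r + 1)) R)
    (η : Fin (r + 1) → R) (x : R) (j l : ℕ) : R :=
  ((aeval (fun i => Polynomial.C (Polynomial.C (η i)) + Polynomial.X * Polynomial.C (tpt q r x l i))
    G : Polynomial (Polynomial R)).coeff j).coeff 1

theorem Emat_map {R R' : Type*} [CommRing R] [CommRing R'] (φ : R →+* R') {r : ℕ} (q : ℕ)
    (G : MvPolynomial (Fin (r + 1)) R) (η : Fin (r + 1) → R) (x : R) (j l : ℕ) :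
    Emat q (map φ G) (fun i => φ (η i)) (φ x) j l = φ (Emat q G η x j l) := by
  unfold Emat
  rw [← Polynomial.coeff_map, ← Polynomial.coe_mapRingHom, ← Polynomial.coeff_map]
  congr 2
  rw [aeval_def, aeval_def, eval₂_map, ← Polynomial.coe_mapRingHom, ← coe_eval₂Hom, ← coe_eval₂Hom]
  rw [← RingHom.comp_apply]
  congr 1
  apply MvPolynomial.ringHom_ext
  · intro a
    simp [Polynomial.algebraMap_apply]
  · intro i
    simp only [RingHom.comp_apply, coe_eval₂Hom, eval₂_X]
    simp only [Polynomial.coe_mapRingHom, Polynomial.map_add, Polynomial.map_mul, Polynomial.map_C,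
      Polynomial.map_X]
    congr 3
    unfold tpt
    split_ifs <;> simp

/-- special form -/
noncomputable def G0 (K : Type*) [Field K] (n q r : ℕ) (hq : q + n ≤ r) (hnq : n ≤ q) :
    MvPolynomial (Fin (r + 1)) K :=
  ∑ l : Fin n, X 0 ^ (n + 1 - (l : ℕ)) * (X (⟨min 2 r, by omega⟩ : Fin (r + 1)) ^ (l : ℕ)) *
    X (⟨q + 1 + l, by have := l.isLt; omega⟩ : Fin (r + 1))

theorem G0_hom (K : Type*) [Field K] (n q r : ℕ) (hq : q + n ≤ r) (hnq : n ≤ q) :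
    (G0 K n q r hq hnq).IsHomogeneous (n + 2) := by
  unfold G0
  apply IsHomogeneous.sum
  intro l _
  have := l.isLt
  have h := (((isHomogeneous_X K (0 : Fin (r + 1))).pow (n + 1 - (l : ℕ))).mul
    ((isHomogeneous_X K (⟨min 2 r, by omega⟩ : Fin (r + 1))).pow (l : ℕ))).mul
    (isHomogeneous_X K (⟨q + 1 + l, by omega⟩ : Fin (r + 1)))
  convert h using 1
  omega

theorem G0_Y (K : Type*) [Field K] (n q r : ℕ) (hq : q + n ≤ r) (hnq : n ≤ q) :
    ∀ μ ∈ (G0 K n q r hq hnq).support, ∃ i : Fin (r + 1), q < (i : ℕ) ∧ μ i ≠ 0 := by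
  classical
  intro μ hμ
  unfold G0 at hμ
  have h1 := support_sum hμ
  simp only [Finset.mem_biUnion] at h1
  obtain ⟨l, _, hl⟩ := h1
  rw [support_mul_X] at hl
  simp only [Finset.mem_map] at hl
  obtain ⟨ν, _, rfl⟩ := hl
  exact ⟨⟨q + 1 + l, by have := l.isLt; omega⟩, by simp; omega, by simp⟩

theorem G0_Emat (K : Type*) [Field K] (n q r : ℕ) (hq : q + n ≤ r) (hnq : n ≤ q) (hn : 2 ≤ n)
    (x : K) (j l : Fin n) :
    Emat q (G0 K n q r hq hnq) (fun i => if (i : ℕ) = 0 then 1 else 0) x (j + 1) l =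
      if j = l then x ^ (l : ℕ) else 0 := by
  unfold Emat G0
  rw [map_sum, Polynomial.finsetSum_coeff, Polynomial.finsetSum_coeff]
  rw [Finset.sum_eq_single l]
  · simp only [map_mul, map_pow, aeval_X, tpt]
    have h2 : min 2 r = 2 := by omega
    simp only [h2]
    have h3 : ¬ (q + 1 + (l : ℕ) = 1) := by omega
    have h4 : ¬ (q + 1 + (l : ℕ) = 2) := by omega
    have h5 : ¬ (q + 1 + (l : ℕ) = 0) := by omega
    have h6 : ¬ (0 = q + 1 + (l : ℕ)) := by omega
    simp only [Fin.val_zero, h3, h4, h5, h6, if_true, if_false]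
    simp only [show ¬ (0 = 1) by omega, show ¬ (0 = 2) by omega, show ¬ (2 = 0) by omega,
      show ¬ (2 = 1) by omega, if_false, map_one, map_zero, mul_zero, add_zero, zero_add, one_pow,
      one_mul, if_true]
    have : (Polynomial.X * Polynomial.C (Polynomial.C x)) ^ (l : ℕ) *
        (Polynomial.X * Polynomial.C Polynomial.X) =
        Polynomial.C (Polynomial.C (x ^ (l : ℕ)) * Polynomial.X) *
          (Polynomial.X ^ ((l : ℕ) + 1) : Polynomial (Polynomial K)) := by
      simp only [map_mul, map_pow]
      ring
    rw [this, Polynomial.coeff_C_mul, Polynomial.coeff_X_pow]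
    have h7 : ((j : ℕ) + 1 = l + 1) ↔ j = l := by
      rw [Fin.ext_iff]; omega
    simp only [h7]
    split_ifs
    · rw [mul_one, Polynomial.coeff_C_mul, Polynomial.coeff_X_one, mul_one]
    · simp
  · intro b _ hb
    have hb' : (b : ℕ) ≠ l := fun h => hb (Fin.ext h)
    simp only [map_mul, map_pow, aeval_X, tpt]
    have h3 : ¬ (q + 1 + (b : ℕ) = 1) := by omega
    have h4 : ¬ (q + 1 + (b : ℕ) = 2) := by omega
    have h5 : ¬ (q + 1 + (b : ℕ) = 0) := by omega
    have h6 : ¬ (q + 1 + (b : ℕ) = q + 1 + (l : ℕ)) := by omega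
    simp [h3, h4, h5, h6, hb']
  · simp

theorem det_nonconst {K' K3 : Type u} [Field K'] [Field K3] [Algebra K' K3] {n q r : ℕ}
    (hq : q + n ≤ r) (hnq : n ≤ q) (hn : 2 ≤ n)
    (G : MvPolynomial (Fin (r + 1)) K3) (hG : G.IsHomogeneous (n + 2))
    (hY : ∀ μ ∈ G.support, ∃ i : Fin (r + 1), q < (i : ℕ) ∧ μ i ≠ 0)
    (η : Fin (r + 1) → K3) (hη0 : η 0 = 1)
    (hηz : ∀ i : Fin (r + 1), n < (i : ℕ) → η i = 0)
    (hind : AlgebraicIndependent K' (Sum.elim (fun μ : idx (n + 2) q r => G.coeff μ.1)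
      (fun j : Fin n => η ⟨(j : ℕ) + 1, by have := j.isLt; omega⟩))) :
    (Matrix.of fun j l : Fin n => Emat q G η 0 (j + 1) l).det ≠
      (Matrix.of fun j l : Fin n => Emat q G η 1 (j + 1) l).det := by
  classical
  have := Fintype.ofFinite (idx (n + 2) q r)
  let A := MvPolynomial (idx (n + 2) q r ⊕ Fin n) K'
  let GA : MvPolynomial (Fin (r + 1)) A :=
    ∑ μ : idx (n + 2) q r, monomial μ.1 (X (Sum.inl μ) : A)
  let ηA : Fin (r + 1) → A := fun i => if (i : ℕ) = 0 then 1 else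
    if h : (i : ℕ) ≤ n then (if h0 : (i : ℕ) = 0 then 1 else X (Sum.inr ⟨(i : ℕ) - 1, by omega⟩))
      else 0
  have hmain : ∀ (L : Type u) (_ : CommRing L) (φ : A →+* L) (x : ℕ),
      φ (Matrix.of fun j l : Fin n => Emat q GA ηA (x : A) (j + 1) l).det =
      (Matrix.of fun j l : Fin n => Emat q (map φ GA) (fun i => φ (ηA i)) (x : L) (j + 1) l).det := by
    intro L _ φ x
    rw [RingHom.map_det]
    congr 1
    ext j l
    simp only [RingHom.mapMatrix_apply, Matrix.map_apply, Matrix.of_apply]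
    rw [← Emat_map, map_natCast]
  intro heq
  let φ : A →+* K3 := (aeval (Sum.elim (fun μ : idx (n + 2) q r => G.coeff μ.1)
      (fun j : Fin n => η ⟨(j : ℕ) + 1, by have := j.isLt; omega⟩)) : A →ₐ[K'] K3).toRingHom
  have hφ : Function.Injective φ := hind
  have hφG : map φ GA = G := by
    conv_rhs => rw [sum_idx G hG hY]
    simp only [GA, map_sum, map_monomial]
    refine Finset.sum_congr rfl fun μ _ => ?_
    congr 1
    change aeval _ (X _) = _
    simp
  have hφη : (fun i => φ (ηA i)) = η := by
    funext i
    simp only [ηA]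
    split_ifs with h h'
    · rw [map_one, ← hη0]
      congr 1
      exact Fin.ext h.symm
    · change aeval _ (X _) = _
      simp only [aeval_X, Sum.elim_inr]
      congr 1
      apply Fin.ext
      simp only
      omega
    · rw [map_zero, hηz]
      omega
  have e0 := hmain K3 _ φ 0
  have e1 := hmain K3 _ φ 1
  rw [hφG, hφη] at e0 e1
  rw [Nat.cast_zero, Nat.cast_zero] at e0
  rw [Nat.cast_one, Nat.cast_one] at e1
  rw [← e0, ← e1] at heq
  have hA := hφ heq
  let ψ : A →+* K' := (aeval (Sum.elim (fun μ : idx (n + 2) q r => (G0 K' n q r hq hnq).coeff μ.1)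
      (fun j : Fin n => (0 : K'))) : A →ₐ[K'] K').toRingHom
  have hψG : map ψ GA = G0 K' n q r hq hnq := by
    conv_rhs => rw [sum_idx _ (G0_hom K' n q r hq hnq) (G0_Y K' n q r hq hnq)]
    simp only [GA, map_sum, map_monomial]
    refine Finset.sum_congr rfl fun μ _ => ?_
    congr 1
    change aeval _ (X _) = _
    simp
  have hψη : (fun i => ψ (ηA i)) = fun i : Fin (r + 1) => if (i : ℕ) = 0 then (1 : K') else 0 := by
    funext i
    simp only [ηA]
    split_ifs with h h'
    · rw [map_one]
    · change aeval _ (X _) = _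
      simp only [aeval_X, Sum.elim_inr]
    · rw [map_zero]
  have f0 := hmain K' _ ψ 0
  have f1 := hmain K' _ ψ 1
  rw [hψG, hψη] at f0 f1
  rw [Nat.cast_zero, Nat.cast_zero, hA] at f0
  rw [Nat.cast_one, Nat.cast_one, f0] at f1
  have hdiag : ∀ x : K', (Matrix.of fun j l : Fin n => Emat q (G0 K' n q r hq hnq)
      (fun i : Fin (r + 1) => if (i : ℕ) = 0 then (1 : K') else 0) x (j + 1) l) = Matrix.diagonal (fun l : Fin n => x ^ (l : ℕ)) := by
    intro x
    ext j l
    rw [Matrix.of_apply, G0_Emat K' n q r hq hnq hn, Matrix.diagonal_apply]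
    split_ifs with h
    · rw [h]
    · rfl
  rw [hdiag, hdiag, Matrix.det_diagonal, Matrix.det_diagonal] at f1
  rw [Finset.prod_eq_zero (Finset.mem_univ (⟨1, by omega⟩ : Fin n)) (by simp)] at f1
  simp at f1

end detpart

section i0part
open MvPolynomial

theorem eval₂Hom_zero_of_Y {R S : Type*} [CommRing R] [CommRing S] {q r : ℕ}
    (G : MvPolynomial (Fin (r + 1)) R)
    (hY : ∀ μ ∈ G.support, ∃ i : Fin (r + 1), q < (i : ℕ) ∧ μ i ≠ 0)
    (f : R →+* S) (g : Fin (r + 1) → S) (hg : ∀ i : Fin (r + 1), q < (i : ℕ) → g i = 0) :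
    eval₂Hom f g G = 0 := by
  rw [coe_eval₂Hom, eval₂_eq']
  apply Finset.sum_eq_zero
  intro μ hμ
  obtain ⟨i, hi, hi'⟩ := hY μ hμ
  rw [Finset.prod_eq_zero (Finset.mem_univ i), mul_zero]
  rw [hg i hi, zero_pow hi']

theorem aeval_zero_of_Y {R S : Type*} [CommRing R] [CommRing S] [Algebra R S] {q r : ℕ}
    (G : MvPolynomial (Fin (r + 1)) R)
    (hY : ∀ μ ∈ G.support, ∃ i : Fin (r + 1), q < (i : ℕ) ∧ μ i ≠ 0)
    (g : Fin (r + 1) → S) (hg : ∀ i : Fin (r + 1), q < (i : ℕ) → g i = 0) :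
    aeval g G = 0 :=
  eval₂Hom_zero_of_Y G hY _ g hg

theorem hom_aeval_zero {R S T : Type*} [CommRing R] [CommRing S] [Algebra R S] [CommRing T]
    {q r : ℕ} (G : MvPolynomial (Fin (r + 1)) R)
    (hY : ∀ μ ∈ G.support, ∃ i : Fin (r + 1), q < (i : ℕ) ∧ μ i ≠ 0) (φ : S →+* T)
    (g : Fin (r + 1) → S) (hg : ∀ i : Fin (r + 1), q < (i : ℕ) → φ (g i) = 0) :
    φ (aeval g G) = 0 := by
  rw [map_aeval]
  exact eval₂Hom_zero_of_Y G hY _ _ hg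

theorem coeff0_zero {R A : Type*} [CommRing R] [CommRing A] [Algebra R A]
    {q r : ℕ} (G : MvPolynomial (Fin (r + 1)) R)
    (hY : ∀ μ ∈ G.support, ∃ i : Fin (r + 1), q < (i : ℕ) ∧ μ i ≠ 0)
    (g : Fin (r + 1) → Polynomial (Polynomial A))
    (hg : ∀ i : Fin (r + 1), q < (i : ℕ) → (g i).map Polynomial.constantCoeff = 0) (j : ℕ) :
    ((aeval g G).coeff j).coeff 0 = 0 := by
  have := hom_aeval_zero G hY (Polynomial.mapRingHom (Polynomial.constantCoeff (R := A))) g hg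
  have h2 := congrArg (fun p => p.coeff j) this
  simp only [Polynomial.coe_mapRingHom, Polynomial.coeff_map, Polynomial.coeff_zero] at h2
  exact h2

theorem aeval_delta {K2 K3 S : Type*} [Field K2] [Field K3] [Algebra K2 K3] [CommRing S]
    [Algebra K3 S] [Algebra K2 S] [IsScalarTower K2 K3 S] {r : ℕ} (hr : 1 ≤ r)
    (P : MvPolynomial (Fin (r + 1)) K3) (δ : MvPolynomial (Fin (r - 1)) K2)
    (hδ' : MvPolynomial.map (algebraMap K2 K3) δ
      = MvPolynomial.aeval (fun i : Fin (r + 1) =>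
          if _h1 : (i : ℕ) = 0 then 0
          else if _h2 : (i : ℕ) = 1 then 1
          else MvPolynomial.X (⟨(i : ℕ) - 2, by have := i.isLt; omega⟩ : Fin (r - 1))) P)
    (x : Fin (r + 1) → S) (hx0 : x 0 = 0) (hx1 : x ⟨1, by omega⟩ = 1) :
    aeval (fun i : Fin (r - 1) => x ⟨(i : ℕ) + 2, Nat.succ_lt_succ (Nat.add_lt_of_lt_sub i.isLt)⟩) δ = aeval x P := by
  rw [← aeval_map_algebraMap K3, hδ', ← AlgHom.comp_apply]
  congr 1
  apply MvPolynomial.algHom_ext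
  intro i
  rw [AlgHom.comp_apply, aeval_X, aeval_X]
  split_ifs with h1 h2
  · rw [map_zero, ← hx0]; congr 1; exact Fin.ext h1.symm
  · rw [map_one, ← hx1]; congr 1; exact Fin.ext h2.symm
  · rw [aeval_X]; congr 1; apply Fin.ext; simp only; omega

theorem exists_i0 {K' K2 K3 : Type u} [Field K'] [Field K2] [Field K3] [Algebra K' K3]
    [Algebra K2 K3] {n q r : ℕ}
    (hnq : n ≤ q) (hqr : q < r) (hn : 2 ≤ n)
    (G : MvPolynomial (Fin (r + 1)) K3) (hG : G.IsHomogeneous (n + 2))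
    (hY : ∀ μ ∈ G.support, ∃ i : Fin (r + 1), q < (i : ℕ) ∧ μ i ≠ 0)
    (η : Fin (r + 1) → K3) (hη0 : η 0 = 1)
    (hηz : ∀ i : Fin (r + 1), n < (i : ℕ) → η i = 0)
    (hind : AlgebraicIndependent K' (Sum.elim (fun μ : idx (n + 2) q r => G.coeff μ.1)
      (fun j : Fin n => η ⟨(j : ℕ) + 1, by have := j.isLt; omega⟩)))
    (ξ : Fin (r + 1) → K3)
    (δ' : ℕ → MvPolynomial (Fin (r - 1)) K2)
    (hδ' : ∀ j, MvPolynomial.map (algebraMap K2 K3) (δ' j)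
      = MvPolynomial.aeval (fun i : Fin (r + 1) =>
          if _h1 : (i : ℕ) = 0 then 0
          else if _h2 : (i : ℕ) = 1 then 1
          else MvPolynomial.X (⟨(i : ℕ) - 2, by have := i.isLt; omega⟩ : Fin (r - 1)))
        (polar G η j))
    (J : Ideal (MvPolynomial (Fin (r - 1)) K2))
    (hJ : J = Ideal.span {p | ∃ j : ℕ, 1 ≤ j ∧ j ≤ n ∧ p = δ' j})
    (hξgen : ∀ p, MvPolynomial.aeval
        (fun i : Fin (r - 1) => ξ ⟨(i : ℕ) + 2, Nat.succ_lt_succ (Nat.add_lt_of_lt_sub i.isLt)⟩) p = 0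
      ↔ p ∈ J)
    (v : Fin (r + 1 - (n + 2)) → K3) (hv : ∀ a, a ∈ acl K2 (Set.range v)) :
    ∃ i : Fin (r + 1), q < (i : ℕ) ∧ ξ i ≠ 0 := by
  by_contra hcon
  push Not at hcon
  have hXJ : ∀ i : Fin (r - 1), q < (i : ℕ) + 2 → X i ∈ J := by
    intro i hi
    rw [← hξgen, aeval_X]
    exact hcon _ hi
  -- J vanishes on Y = 0
  have hJ0 : ∀ (S : Type u) [CommRing S] [Algebra K3 S] [Algebra K2 S] [IsScalarTower K2 K3 S]
      (x : Fin (r + 1) → S) (_ : x 0 = 0) (_ : x ⟨1, by omega⟩ = 1)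
      (_ : ∀ i : Fin (r + 1), q < (i : ℕ) → x i = 0) (p) (_ : p ∈ J),
      aeval (fun i : Fin (r - 1) => x ⟨(i : ℕ) + 2, Nat.succ_lt_succ (Nat.add_lt_of_lt_sub i.isLt)⟩) p = 0 := by
    intro S _ _ _ _ x hx0 hx1 hxq p hp
    have : J ≤ RingHom.ker (aeval (R := K2) (fun i : Fin (r - 1) =>
        x ⟨(i : ℕ) + 2, Nat.succ_lt_succ (Nat.add_lt_of_lt_sub i.isLt)⟩)).toRingHom := by
      rw [hJ, Ideal.span_le]
      rintro _ ⟨j, hj1, hj2, rfl⟩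
      change aeval _ _ = 0
      rw [aeval_delta (by omega) _ _ (hδ' j) x hx0 hx1, aeval_polar,
        aeval_zero_of_Y (q := q) G hY]
      · simp
      · intro i hi
        rw [hηz i (by omega), hxq i hi]
        simp
    exact this hp
  have hcard : q + n ≤ r := by
    have hi : AlgebraicIndependent K2 (fun i : Fin (q - 1) => ξ ⟨(i : ℕ) + 2, by
        have := i.isLt; omega⟩) := by
      rw [algebraicIndependent_iff]
      intro p hp
      let ι : Fin (q - 1) → Fin (r - 1) := fun i => ⟨i, by have := i.isLt; omega⟩
      have h1 : rename ι p ∈ J := by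
        rw [← hξgen, aeval_rename]
        exact hp
      let x : Fin (r + 1) → MvPolynomial (Fin (q - 1)) K3 := fun i =>
        if (i : ℕ) = 0 then 0 else if h1 : (i : ℕ) = 1 then 1 else
        if h : (i : ℕ) ≤ q then X ⟨(i : ℕ) - 2, by omega⟩ else 0
      have h2 := hJ0 _ x (by simp [x]) (by simp [x]) (by
        intro i hi
        simp only [x]
        rw [if_neg (by omega), dif_neg (by omega), dif_neg (by omega)]) _ h1
      rw [aeval_rename] at h2
      have h3 : ((fun i : Fin (r - 1) => x ⟨(i : ℕ) + 2, Nat.succ_lt_succ (Nat.add_lt_of_lt_sub i.isLt)⟩) ∘ ι) = X := by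
        funext i
        have := i.isLt
        simp only [Function.comp, x, ι]
        rw [if_neg (by omega), dif_neg (by omega), dif_pos (by omega)]
        rfl
      rw [h3, ← aeval_map_algebraMap K3, aeval_X_left_apply] at h2
      exact (map_injective _ (algebraMap K2 K3).injective) (by rw [h2, map_zero])
    have := card_le_of_acl hv hi
    simp only [Nat.card_eq_fintype_card, Fintype.card_fin] at this
    omega
  -- the determinant
  have hh : ∀ l : Fin n, ∃ h : Fin n → MvPolynomial (Fin (r - 1)) K2,
      ∑ j : Fin n, h j * δ' ((j : ℕ) + 1) =
        X (⟨q + 1 + l - 2, by have := l.isLt; omega⟩ : Fin (r - 1)) := by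
    intro l
    have h1 := hXJ (⟨q + 1 + l - 2, by have := l.isLt; omega⟩ : Fin (r - 1)) (by simp only; omega)
    have h2 : {p | ∃ j : ℕ, 1 ≤ j ∧ j ≤ n ∧ p = δ' j} =
        Set.range (fun j : Fin n => δ' ((j : ℕ) + 1)) := by
      ext p
      constructor
      · rintro ⟨j, hj1, hj2, rfl⟩
        exact ⟨⟨j - 1, by omega⟩, by simp only; congr 1; omega⟩
      · rintro ⟨j, rfl⟩
        exact ⟨j + 1, by omega, by have := j.isLt; omega, rfl⟩
    rw [hJ, h2, Ideal.mem_span_range_iff_exists_fun] at h1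
    exact h1
  choose h hh using hh
  let P := Polynomial K3
  let pt : Fin n → Fin (r + 1) → Polynomial P := fun l => tpt q r (Polynomial.X : P) l
  let ev : Fin n → MvPolynomial (Fin (r - 1)) K2 →ₐ[K2] Polynomial P := fun l =>
    aeval (fun i : Fin (r - 1) => pt l ⟨(i : ℕ) + 2, Nat.succ_lt_succ (Nat.add_lt_of_lt_sub i.isLt)⟩)
  let M : Matrix (Fin n) (Fin n) P := Matrix.of fun j l =>
    Emat q (map Polynomial.C G) (fun i => Polynomial.C (η i)) (Polynomial.X : P) (j + 1) l
  have hq2 : 2 ≤ q := by omega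
  have hδev : ∀ (j l : Fin n), ev l (δ' (j + 1)) = (((j : ℕ) + 1).factorial : Polynomial P) *
      (aeval (fun i => Polynomial.C (algebraMap K3 (Polynomial P) (η i)) +
        Polynomial.X * Polynomial.C (pt l i)) G : Polynomial (Polynomial P)).coeff (j + 1) := by
    intro j l
    simp only [ev]
    rw [aeval_delta (by omega) _ _ (hδ' _) (pt l) _ _, aeval_polar]
    · have h0 : ¬ (((0 : Fin (r + 1)) : ℕ) = q + 1 + l) := by rw [Fin.val_zero]; omega
      simp only [pt, tpt]
      rw [if_neg (by simp), if_neg (by simp), if_neg h0]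
    · simp [pt, tpt]
  have hδ1 : ∀ (j l : Fin n), ((aeval (fun i => Polynomial.C (algebraMap K3 (Polynomial P) (η i)) +
        Polynomial.X * Polynomial.C (pt l i)) G : Polynomial (Polynomial P)).coeff (j + 1)).coeff 1
        = M j l := by
    intro j l
    simp only [M, Matrix.of_apply, Emat, pt]
    congr 2
    have := aeval_map_algebraMap (R := K3) P (fun i => Polynomial.C (algebraMap K3 (Polynomial P) (η i)) +
        Polynomial.X * Polynomial.C (pt l i)) G
    rw [← this]
    rfl
  have hδ0 : ∀ (j l : Fin n), ((aeval (fun i => Polynomial.C (algebraMap K3 (Polynomial P) (η i)) +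
        Polynomial.X * Polynomial.C (pt l i)) G : Polynomial (Polynomial P)).coeff (j + 1)).coeff 0
        = 0 := by
    intro j l
    apply coeff0_zero (q := q) G hY
    · intro i hi
      rw [hηz i (by omega)]
      simp only [map_zero, zero_add, Polynomial.map_mul, Polynomial.map_X, Polynomial.map_C]
      simp only [pt, tpt]
      rw [if_neg (by omega), if_neg (by omega)]
      split_ifs <;> simp
  let H : Matrix (Fin n) (Fin n) P := Matrix.of fun l j =>
    (ev j (h l j)).coeff 0
  let H' : Fin n → Matrix (Fin n) (Fin n) P := fun l0 => Matrix.of fun l j =>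
    (ev l0 (h l j) * (((j : ℕ) + 1).factorial : Polynomial P)).coeff 0
  have hH0 : ∀ l l0 l1 j, H' l0 l j = H' l1 l j := by
    intro l l0 l1 j
    simp only [H', Matrix.of_apply, Polynomial.mul_coeff_zero]
    congr 1
    simp only [ev]
    rw [← Polynomial.constantCoeff_apply, ← Polynomial.constantCoeff_apply, map_aeval, map_aeval]
    congr 2
    funext i
    simp only [pt, tpt]
    split_ifs <;> simp
  have hHM : ∀ l l0, ∑ j, H' l0 l j * M j l0 = if l = l0 then 1 else 0 := by
    intro l l0
    have h1 := congrArg (fun p => (ev l0 p).coeff 1) (hh l)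
    simp only [map_sum, map_mul, hδev, Polynomial.finsetSum_coeff, ← mul_assoc,
      Polynomial.mul_coeff_one, hδ0, hδ1] at h1
    have h2 : (ev l0 (X (⟨q + 1 + l - 2, by have := l.isLt; omega⟩ : Fin (r - 1)))).coeff 1 =
        if l = l0 then 1 else 0 := by
      simp only [ev, aeval_X, pt, tpt]
      have h7 : (q + 1 + (l : ℕ) - 2 + 2 = q + 1 + l0) ↔ l = l0 := by
        rw [Fin.ext_iff]; omega
      rw [if_neg (by omega), if_neg (by omega)]
      simp only [h7]
      split_ifs <;> simp
    rw [h2] at h1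
    rw [← h1]
    refine Finset.sum_congr rfl fun j _ => ?_
    simp only [H', Matrix.of_apply, Polynomial.mul_coeff_zero]
    ring
  let l1 : Fin n := ⟨0, by omega⟩
  have hmul : H' l1 * M = 1 := by
    refine Matrix.ext fun l l0 => ?_
    rw [Matrix.mul_apply, Matrix.one_apply, ← hHM l l0]
    refine Finset.sum_congr rfl fun j _ => ?_
    rw [hH0 l l1 l0 j]
  have hunit : IsUnit M.det := by
    have := congrArg Matrix.det hmul
    rw [Matrix.det_mul, Matrix.det_one] at this
    exact IsUnit.of_mul_eq_one _ (by rw [mul_comm]; exact this)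
  obtain ⟨c, -, hc⟩ := Polynomial.isUnit_iff.1 hunit
  have hev : ∀ a : K3, (Matrix.of fun j l : Fin n => Emat q G η a (j + 1) l).det = c := by
    intro a
    have h1 : Polynomial.evalRingHom a M.det = c := by
      rw [← hc]; simp
    rw [← h1, RingHom.map_det]
    congr 1
    ext j l
    simp only [RingHom.mapMatrix_apply, Matrix.map_apply, M, Matrix.of_apply]
    rw [← Emat_map]
    congr 1
    · rw [map_map]
      have : (Polynomial.evalRingHom a).comp Polynomial.C = RingHom.id K3 := by
        ext; simp
      rw [this, map_id]
    · funext i; simp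
    · simp
  exact det_nonconst hcard hnq hn G hG hY η hη0 hηz hind ((hev 0).trans (hev 1).symm)

end i0part

section fampart
open MvPolynomial

theorem coeff_prod_mem {k F : Type*} [Field k] [Field F] [Algebra k F] {r : ℕ}
    (L : IntermediateField k F) (η ζ : Fin (r + 1) → F) (hη : ∀ i, η i ∈ L) (hζ : ∀ i, ζ i ∈ L)
    (μ : Fin (r + 1) →₀ ℕ) (j : ℕ) :
    (μ.prod fun i e => (Polynomial.C (η i) + Polynomial.X * Polynomial.C (ζ i)) ^ e).coeff j ∈ L := by
  have h : (μ.prod fun i e => (Polynomial.C (η i) + Polynomial.X * Polynomial.C (ζ i)) ^ e) =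
      (μ.prod fun i e => (Polynomial.C (⟨η i, hη i⟩ : L) + Polynomial.X *
        Polynomial.C (⟨ζ i, hζ i⟩ : L)) ^ e).map (algebraMap L F) := by
    simp only [Finsupp.prod, Polynomial.map_prod, Polynomial.map_pow, Polynomial.map_add,
      Polynomial.map_mul, Polynomial.map_X, Polynomial.map_C]
    rfl
  rw [h, Polynomial.coeff_map]
  exact (Subtype.mem _ : _)

/-- the monomials `e_j` -/
noncomputable def eM {n q r : ℕ} (i0 : Fin (r + 1)) (hi0 : q < (i0 : ℕ)) (j : ℕ) (hj1 : 1 ≤ j)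
    (hj : j ≤ n + 2) : idx (n + 2) q r :=
  ⟨Finsupp.single 0 (n + 2 - j) + Finsupp.single i0 j, by
    simp only [Finsupp.add_apply, Finset.sum_add_distrib, Finsupp.single_apply]
    simp
    omega, i0, hi0, by simp; omega⟩

/-- the monomials `γ_m` -/
noncomputable def cM {n q r : ℕ} (i0 : Fin (r + 1)) (hi0 : q < (i0 : ℕ)) (j : ℕ) (hj1 : 1 ≤ j)
    (hj : j ≤ n) (hjr : j < r + 1) : idx (n + 2) q r :=
  ⟨Finsupp.single 0 (n + 1 - j) + Finsupp.single ⟨j, hjr⟩ 1 + Finsupp.single i0 j, by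
    simp only [Finsupp.add_apply, Finset.sum_add_distrib, Finsupp.single_apply]
    simp
    omega, i0, hi0, by simp; omega⟩

variable {F : Type*} [Field F] {n q r : ℕ}

/-- expansion of a monomial along the line -/
noncomputable def lin (η ζ : Fin (r + 1) → F) (μ : Fin (r + 1) →₀ ℕ) : Polynomial F :=
  μ.prod fun i e => (Polynomial.C (η i) + Polynomial.X * Polynomial.C (ζ i)) ^ e

theorem lin_add (η ζ : Fin (r + 1) → F) (μ ν : Fin (r + 1) →₀ ℕ) :
    lin η ζ (μ + ν) = lin η ζ μ * lin η ζ ν := by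
  unfold lin
  exact Finsupp.prod_add_index' (by simp) (by intros; rw [pow_add])

theorem lin_single (η ζ : Fin (r + 1) → F) (i : Fin (r + 1)) (e : ℕ) :
    lin η ζ (Finsupp.single i e) =
      (Polynomial.C (η i) + Polynomial.X * Polynomial.C (ζ i)) ^ e := by
  unfold lin
  exact Finsupp.prod_single_index (by simp)

theorem lin_eM (η ζ : Fin (r + 1) → F) (hη0 : η 0 = 1) (hζ0 : ζ 0 = 0) (i0 : Fin (r + 1))
    (hi0 : q < (i0 : ℕ)) (hηi : η i0 = 0) (j : ℕ) (hj1 : 1 ≤ j) (hj : j ≤ n + 2) (i : ℕ) :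
    (lin η ζ (eM i0 hi0 j hj1 hj : idx (n + 2) q r).1).coeff i = if i = j then ζ i0 ^ j else 0 := by
  unfold eM
  simp only
  rw [lin_add, lin_single, lin_single, hη0, hζ0, hηi]
  simp only [map_one, map_zero, mul_zero, add_zero, one_pow, one_mul, zero_add, mul_pow]
  rw [← map_pow, mul_comm, Polynomial.coeff_C_mul, Polynomial.coeff_X_pow]
  split_ifs <;> simp

theorem lin_cM (η ζ : Fin (r + 1) → F) (hη0 : η 0 = 1) (hζ0 : ζ 0 = 0) (i0 : Fin (r + 1))
    (hi0 : q < (i0 : ℕ)) (hηi : η i0 = 0) (j : ℕ) (hj1 : 1 ≤ j) (hj : j ≤ n) (hjr : j < r + 1)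
    (i : ℕ) (hi : i ≤ j) :
    (lin η ζ (cM i0 hi0 j hj1 hj hjr : idx (n + 2) q r).1).coeff i =
      if i = j then η ⟨j, hjr⟩ * ζ i0 ^ j else 0 := by
  unfold cM
  simp only
  rw [lin_add, lin_add, lin_single, lin_single, lin_single, hη0, hζ0, hηi]
  simp only [map_one, map_zero, mul_zero, add_zero, one_pow, one_mul, zero_add, mul_pow, pow_one]
  rw [← map_pow]
  have : (Polynomial.C (η ⟨j, hjr⟩) + Polynomial.X * Polynomial.C (ζ ⟨j, hjr⟩)) *
      (Polynomial.X ^ j * Polynomial.C (ζ i0 ^ j)) =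
      (Polynomial.C (η ⟨j, hjr⟩ * ζ i0 ^ j) + Polynomial.X * Polynomial.C (ζ ⟨j, hjr⟩ * ζ i0 ^ j)) *
        Polynomial.X ^ j := by
    simp only [map_mul]; ring
  rw [this, Polynomial.coeff_mul_X_pow']
  rcases hi.lt_or_eq with h | h
  · rw [if_neg (by omega), if_neg (by omega)]
  · subst h
    rw [if_pos le_rfl, if_pos rfl, Nat.sub_self, Polynomial.coeff_add, Polynomial.coeff_C_zero,
      Polynomial.mul_coeff_zero, Polynomial.coeff_X_zero, zero_mul, add_zero]

theorem solve {k : Type*} [Field k] [Algebra k F] [Fintype (idx (n + 2) q r)]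
    (b : idx (n + 2) q r → F)
    (η ζ : Fin (r + 1) → F) (hη0 : η 0 = 1) (hζ0 : ζ 0 = 0) (i0 : Fin (r + 1))
    (hi0 : q < (i0 : ℕ)) (hηi : η i0 = 0) (hζi : ζ i0 ≠ 0)
    (L : IntermediateField k F) (hη : ∀ i, η i ∈ L) (hζ : ∀ i, ζ i ∈ L)
    (hb : ∀ μ, (∀ j hj1 hj, j ≤ n + 1 → μ ≠ eM i0 hi0 j hj1 hj) → b μ ∈ L)
    (j : ℕ) (hj1 : 1 ≤ j) (hj : j ≤ n + 2)
    (hrel : ∑ μ, b μ * (lin η ζ μ.1).coeff j = 0) : j ≤ n + 1 → b (eM i0 hi0 j hj1 hj) ∈ L := by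
  classical
  intro hjn
  rw [← Finset.add_sum_erase _ _ (Finset.mem_univ (eM i0 hi0 j hj1 hj)),
    lin_eM η ζ hη0 hζ0 i0 hi0 hηi, if_pos rfl] at hrel
  have h1 : b (eM i0 hi0 j hj1 hj) = -(∑ μ ∈ Finset.univ.erase (eM i0 hi0 j hj1 hj),
      b μ * (lin η ζ μ.1).coeff j) * (ζ i0 ^ j)⁻¹ := by
    field_simp
    linear_combination hrel
  rw [h1]
  refine mul_mem (neg_mem (sum_mem fun μ hμ => ?_)) (inv_mem (pow_mem (hζ _) _))
  by_cases h : ∀ j hj1 hj, j ≤ n + 1 → μ ≠ eM i0 hi0 j hj1 hj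
  · exact mul_mem (hb μ h) (coeff_prod_mem L η ζ hη hζ _ _)
  · push Not at h
    obtain ⟨i, hi1, hi, _, rfl⟩ := h
    rw [lin_eM η ζ hη0 hζ0 i0 hi0 hηi, if_neg]
    · simp
    · rintro rfl
      simp at hμ

theorem family {k : Type*} [Field k] [CharZero k] [Algebra k F] [Fintype (idx (n + 2) q r)]
    (hnq : n ≤ q) (hqr : q < r)
    (b : idx (n + 2) q r → F)
    (η α : Fin (r + 1) → F) (hη0 : η 0 = 1) (hα0 : α 0 = 1) (i0 : Fin (r + 1))
    (hi0 : q < (i0 : ℕ)) (hηz : ∀ i : Fin (r + 1), n < (i : ℕ) → η i = 0) (hαi : α i0 ≠ 0)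
    (hspan : ∀ a, a ∈ acl k (Set.range b ∪ Set.range η ∪ Set.range α))
    {κ : Type*} [Finite κ] {y : κ → F} (hy : AlgebraicIndependent k y)
    (hc : Nat.card (idx (n + 2) q r) + r ≤ Nat.card κ)
    (hrel : ∀ j, 1 ≤ j → j ≤ n → ∑ μ, b μ * (lin η (fun i => α i - η i) μ.1).coeff j = 0) :
    AlgebraicIndependent k (Sum.elim b (fun i : Fin r => α ⟨(i : ℕ) + 1, Nat.succ_lt_succ i.isLt⟩))
    ∧ ∑ μ, b μ * (lin η (fun i => α i - η i) μ.1).coeff (n + 1) ≠ 0 := by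
  classical
  set ζ : Fin (r + 1) → F := fun i => α i - η i with hζdef
  have hζ0 : ζ 0 = 0 := by simp [ζ, hα0, hη0]
  have hηi : η i0 = 0 := hηz i0 (by omega)
  have hζi : ζ i0 = α i0 := by simp [ζ, hηi]
  let α' : Fin r → F := fun i => α ⟨(i : ℕ) + 1, Nat.succ_lt_succ i.isLt⟩
  let ηv : Fin n → F := fun i => η ⟨(i : ℕ) + 1, by have := i.isLt; omega⟩
  let bb : idx (n + 2) q r ⊕ Fin r → F := Sum.elim b α'
  let E : Fin n → idx (n + 2) q r := fun m =>
    eM i0 hi0 (m + 1) (by omega) (by have := m.isLt; omega)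
  let Γ : Fin n → idx (n + 2) q r := fun m =>
    cM i0 hi0 (m + 1) (by omega) (by have := m.isLt; omega) (by have := m.isLt; omega)
  let e : Fin n → idx (n + 2) q r ⊕ Fin r := fun m => Sum.inl (E m)
  let γ : Fin n → idx (n + 2) q r ⊕ Fin r := fun m => Sum.inl (Γ m)
  have hi00 : i0 ≠ 0 := by
    intro h
    rw [h] at hi0; simp at hi0
  have eMi0 : ∀ j hj1 hj, (eM i0 hi0 j hj1 hj : idx (n + 2) q r).1 i0 = j := by
    intro j hj1 hj
    simp [eM, Finsupp.single_apply, hi00.symm]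
  have cMi0 : ∀ j hj1 hj hjr, (cM i0 hi0 j hj1 hj hjr : idx (n + 2) q r).1 i0 = j := by
    intro j hj1 hj hjr
    have : (⟨j, hjr⟩ : Fin (r + 1)) ≠ i0 := by
      intro h
      rw [← h] at hi0
      simp only at hi0
      omega
    simp [cM, Finsupp.single_apply, hi00.symm, this]
  have hEinj : Function.Injective E := by
    intro m m' h
    have := congrArg (fun μ => μ.1 i0) h
    simp only [E, eMi0] at this
    exact Fin.ext (by omega)
  have he : Function.Injective e := fun m m' h => hEinj (Sum.inl_injective h)
  have hγ : Function.Injective γ := by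
    intro m m' h
    have := congrArg (fun μ => μ.1 i0) (Sum.inl_injective h)
    simp only [Γ, cMi0] at this
    exact Fin.ext (by omega)
  have hEΓ : ∀ j hj1 hj m, (eM i0 hi0 j hj1 hj : idx (n + 2) q r) ≠ Γ m := by
    intro j hj1 hj m h
    have hm := m.isLt
    have := congrArg (fun μ => μ.1 (⟨m + 1, by omega⟩ : Fin (r + 1))) h
    have h1 : i0 ≠ (⟨m + 1, by omega⟩ : Fin (r + 1)) := by
      intro h; rw [h] at hi0; simp only at hi0; omega
    have h2 : (0 : Fin (r + 1)) ≠ (⟨m + 1, by omega⟩ : Fin (r + 1)) := by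
      intro h; have := congrArg Fin.val h; simp at this
    simp [eM, Γ, cM, Finsupp.single_apply, h1, h2] at this
  have hdisj : ∀ i j, e i ≠ γ j := fun i j h => hEΓ _ _ _ _ (Sum.inl_injective h)
  let b0 : idx (n + 2) q r ⊕ Fin r → F := fun i =>
    if h : ∃ m, i = e m then ηv h.choose else bb i
  have hb0e : ∀ m, b0 (e m) = ηv m := by
    intro m
    have h : ∃ m', e m = e m' := ⟨m, rfl⟩
    simp only [b0]
    rw [dif_pos h]
    congr 1
    exact (he h.choose_spec).symm
  have hb0 : ∀ i, (∀ m, i ≠ e m) → b0 i = bb i := by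
    intro i h
    simp only [b0]
    rw [dif_neg (by push Not; exact h)]
  have hb0α : ∀ i, b0 (Sum.inr i) = α' i := fun i => hb0 _ (by intro m h; cases h)
  -- membership tools
  have hηL : ∀ (L : IntermediateField k F), (∀ m, ηv m ∈ L) → ∀ i, η i ∈ L := by
    intro L hL i
    by_cases h0 : (i : ℕ) = 0
    · rw [show i = 0 from Fin.ext h0, hη0]; exact one_mem _
    by_cases h1 : (i : ℕ) ≤ n
    · have := hL ⟨i - 1, by omega⟩
      convert this using 1
      simp only [ηv]
      congr 1
      apply Fin.ext
      simp only
      omega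
    · rw [hηz i (by omega)]; exact zero_mem _
  have hαL : ∀ (L : IntermediateField k F), (∀ m, α' m ∈ L) → ∀ i, α i ∈ L := by
    intro L hL i
    by_cases h0 : (i : ℕ) = 0
    · rw [show i = 0 from Fin.ext h0, hα0]; exact one_mem _
    · have := hL ⟨i - 1, by omega⟩
      convert this using 1
      simp only [α']
      congr 1
      apply Fin.ext
      simp only
      omega
  have hb0μ : ∀ μ : idx (n + 2) q r, (∀ j hj1 hj, j ≤ n + 1 → μ ≠ eM i0 hi0 j hj1 hj) →
      b0 (Sum.inl μ) = b μ := by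
    intro μ hμ
    rw [hb0]
    · rfl
    · intro m h
      exact hμ _ _ _ (by have := m.isLt; omega) (Sum.inl_injective h)
  let E1 : idx (n + 2) q r := eM i0 hi0 (n + 1) (by omega) (by omega)
  have hE1 : ∀ m, Sum.inl E1 ≠ e m := by
    intro m h
    have := congrArg (fun μ => μ.1 i0) (Sum.inl_injective h)
    simp only [E, E1, eMi0] at this
    have := m.isLt
    omega
  -- the key: everything but `E1` gives all except `b E1`
  let T : Set F := b0 '' {i | i ≠ Sum.inl E1}
  have hTη : ∀ i, η i ∈ acl k T := hηL _ fun m => by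
    rw [← hb0e]
    exact subset_acl _ ⟨e m, fun h => hE1 m h.symm, rfl⟩
  have hTα : ∀ i, α i ∈ acl k T := hαL _ fun m => by
    rw [← hb0α]
    exact subset_acl _ ⟨Sum.inr m, by simp, rfl⟩
  have hTζ : ∀ i, ζ i ∈ acl k T := fun i => sub_mem (hTα i) (hTη i)
  have hTb : ∀ μ : idx (n + 2) q r, (∀ j hj1 hj, j ≤ n + 1 → μ ≠ eM i0 hi0 j hj1 hj) →
      b μ ∈ acl k T := by
    intro μ hμ
    rw [← hb0μ μ hμ]
    refine subset_acl _ ⟨Sum.inl μ, ?_, rfl⟩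
    intro h
    exact hμ _ _ _ le_rfl (Sum.inl_injective h)
  have hTs := solve b η ζ hη0 hζ0 i0 hi0 hηi (by rw [hζi]; exact hαi) (acl k T) hTη hTζ hTb
  have hTE : ∀ μ, μ ≠ E1 → b μ ∈ acl k T := by
    intro μ hμ
    by_cases h : ∀ j hj1 hj, j ≤ n + 1 → μ ≠ eM i0 hi0 j hj1 hj
    · exact hTb μ h
    · push Not at h
      obtain ⟨j, hj1, hj, hjn, rfl⟩ := h
      have hjn' : j ≤ n := by
        by_contra h'
        have : j = n + 1 := by omega
        subst this
        exact hμ rfl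
      exact hTs j hj1 hj (hrel j hj1 hjn') hjn
  have hTle : acl k T ≤ acl k (Set.range b0) := acl_mono (Set.image_subset_range _ _)
  have hspan0 : ∀ a, a ∈ acl k (Set.range b0) := by
    intro a
    refine acl_le ?_ (hspan a)
    rintro _ ((⟨μ, rfl⟩ | ⟨i, rfl⟩) | ⟨i, rfl⟩)
    · by_cases h : μ = E1
      · have : b μ = b0 (Sum.inl E1) := by
          rw [h, hb0 _ hE1]
          rfl
        rw [this]
        exact subset_acl _ ⟨_, rfl⟩
      · exact hTle (hTE μ h)
    · exact hTle (hTη i)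
    · exact hTle (hTα i)
  have hind0 : AlgebraicIndependent k b0 := by
    refine indep_of_acl hspan0 hy ?_
    rw [Nat.card_sum, Nat.card_eq_fintype_card (α := Fin r), Fintype.card_fin]
    exact hc
  refine ⟨?_, ?_⟩
  · let R : Fin n → F := fun j => b (E j) + b (Γ j) * ηv j
    refine exchange_family n e γ he hdisj hγ ηv bb b0 hb0e hb0 hind0 hspan0 R ?_ ?_
    · intro j
      set L := acl k (Set.range ηv ∪ bb '' {i | (∀ m, i ≠ e m) ∧ ∀ m, j ≤ m → i ≠ γ m}) with hL
      have hLη : ∀ i, η i ∈ L := hηL _ fun m => subset_acl _ (Or.inl ⟨m, rfl⟩)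
      have hLα : ∀ i, α i ∈ L := hαL _ fun m => subset_acl _ (Or.inr ⟨Sum.inr m,
        ⟨fun m h => by simp [e] at h, fun m _ h => by simp [γ] at h⟩, rfl⟩)
      have hLζ : ∀ i, ζ i ∈ L := fun i => sub_mem (hLα i) (hLη i)
      have hjn := j.isLt
      have hr := hrel (j + 1) (by omega) (by omega)
      rw [← Finset.add_sum_erase _ _ (Finset.mem_univ (E j)),
        ← Finset.add_sum_erase _ _ (Finset.mem_erase.2 ⟨(hEΓ _ _ _ j).symm, Finset.mem_univ (Γ j)⟩)] at hr
      have h1 : (lin η ζ (E j).1).coeff (j + 1) = α i0 ^ ((j : ℕ) + 1) := by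
        simp only [E]
        rw [lin_eM η ζ hη0 hζ0 i0 hi0 hηi, if_pos rfl, hζi]
      have h2 : (lin η ζ (Γ j).1).coeff (j + 1) = ηv j * α i0 ^ ((j : ℕ) + 1) := by
        simp only [Γ]
        rw [lin_cM η ζ hη0 hζ0 i0 hi0 hηi _ _ _ _ _ le_rfl, if_pos rfl, hζi]
      rw [h1, h2] at hr
      have h3 : R j = -(∑ μ ∈ (Finset.univ.erase (E j)).erase (Γ j),
          b μ * (lin η ζ μ.1).coeff (j + 1)) * (α i0 ^ ((j : ℕ) + 1))⁻¹ := by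
        simp only [R]
        field_simp
        linear_combination hr
      rw [h3]
      refine mul_mem (neg_mem (sum_mem fun μ hμ => ?_)) (inv_mem (pow_mem (hLα _) _))
      rw [Finset.mem_erase, Finset.mem_erase] at hμ
      by_cases hE : ∃ m, μ = E m
      · obtain ⟨m, rfl⟩ := hE
        simp only [E]
        rw [lin_eM η ζ hη0 hζ0 i0 hi0 hηi, if_neg]
        · simp
        · intro h
          apply hμ.2.1
          congr 1
          exact Fin.ext (by omega)
      by_cases hΓ : ∃ m, j ≤ m ∧ μ = Γ m
      · obtain ⟨m, hm, rfl⟩ := hΓ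
        have hm' : (j : ℕ) ≤ m := hm
        simp only [Γ]
        rw [lin_cM η ζ hη0 hζ0 i0 hi0 hηi _ _ _ _ _ (by omega), if_neg]
        · simp
        · intro h
          apply hμ.1
          congr 1
          exact Fin.ext (by omega)
      push Not at hE hΓ
      refine mul_mem (subset_acl _ (Or.inr ⟨Sum.inl μ, ⟨?_, ?_⟩, rfl⟩)) (coeff_prod_mem L η ζ hLη hLζ _ _)
      · intro m h
        exact hE m (Sum.inl_injective h)
      · intro m hm h
        exact hΓ m hm (Sum.inl_injective h)
    · intro j
      change b (E j) = -(b (Γ j) * ηv j) + (b (E j) + b (Γ j) * ηv j)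
      ring
  · intro h
    have h1 := hTs (n + 1) (by omega) (by omega) h le_rfl
    have h2 : b0 (Sum.inl E1) ∈ acl k T := by
      rw [hb0 _ hE1]
      exact h1
    exact not_mem_acl hind0 (by simp) h2

end fampart

section corepart
open MvPolynomial

theorem indep_over {k K F : Type*} [Field k] [Field K] [Field F] [Algebra k K] [Algebra k F]
    [Algebra K F] [IsScalarTower k K F] {I ι : Type*} (b : I → K) (T : Set K)
    (hT : ∀ t ∈ T, t ∈ Set.range b ∨ t = 0) (y : ι → F)
    (h : AlgebraicIndependent k (Sum.elim (fun i => algebraMap K F (b i)) y)) :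
    AlgebraicIndependent (↥(IntermediateField.adjoin k T)) y := by
  have h1 : AlgebraicIndependent k (Sum.elim y (fun i => algebraMap K F (b i))) := by
    have := h.comp Sum.swap (Sum.swap_leftInverse.injective)
    convert this using 1
    funext i
    cases i <;> rfl
  have h2 := (AlgebraicIndependent.sumElim_iff.1 h1).2
  rw [← IntermediateField.algebraicIndependent_adjoin_iff] at h2
  set L := IntermediateField.adjoin k (Set.range fun i => algebraMap K F (b i)) with hL
  have hle : (IntermediateField.adjoin k T) ≤ L.comap (IsScalarTower.toAlgHom k K F) := by
    rw [IntermediateField.adjoin_le_iff]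
    intro t ht
    change algebraMap K F t ∈ L
    rcases hT t ht with ⟨i, rfl⟩ | rfl
    · exact IntermediateField.subset_adjoin _ _ ⟨i, rfl⟩
    · rw [map_zero]; exact zero_mem _
  let f : ↥(IntermediateField.adjoin k T) →+* L :=
    ((algebraMap K F).comp (algebraMap _ K)).codRestrict L (fun a => hle a.2)
  exact h2.of_ringHom_of_comp_eq f (RingHom.id F) f.injective (by ext; rfl)

theorem lin_scale {K F : Type*} [Field K] [Field F] (φ : K →+* F) {r : ℕ} (η ξ : Fin (r + 1) → K)
    (t : F) (μ : Fin (r + 1) →₀ ℕ) :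
    lin (fun i => φ (η i)) (fun i => t * φ (ξ i)) μ =
      ((lin η ξ μ).map φ).comp (Polynomial.C t * Polynomial.X) := by
  unfold lin
  simp only [Finsupp.prod, Polynomial.map_prod, Polynomial.map_pow, Polynomial.map_add,
      Polynomial.map_mul, Polynomial.map_X, Polynomial.map_C, Polynomial.prod_comp,
      Polynomial.pow_comp, Polynomial.add_comp, Polynomial.mul_comp, Polynomial.X_comp,
      Polynomial.C_comp, map_mul]
  refine Finset.prod_congr rfl fun i _ => ?_
  ring

theorem aeval_eq_sum_lin {K : Type*} [Field K] {D q r : ℕ} [Fintype (idx D q r)]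
    (G : MvPolynomial (Fin (r + 1)) K)
    (hG : G.IsHomogeneous D)
    (hY : ∀ μ ∈ G.support, ∃ i : Fin (r + 1), q < (i : ℕ) ∧ μ i ≠ 0) (η ξ : Fin (r + 1) → K) :
    aeval (fun i => Polynomial.C (η i) + Polynomial.X * Polynomial.C (ξ i)) G =
      ∑ μ : idx D q r, Polynomial.C (G.coeff μ.1) * lin η ξ μ.1 := by
  conv_lhs => rw [sum_idx G hG hY]
  rw [map_sum]
  refine Finset.sum_congr rfl fun μ _ => ?_
  rw [aeval_monomial]
  rfl

theorem lin_natDegree {K : Type*} [Field K] {D q r : ℕ} (η ξ : Fin (r + 1) → K) (μ : idx D q r) :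
    (lin η ξ μ.1).natDegree ≤ D := by
  unfold lin
  rw [Finsupp.prod_fintype _ _ (by simp)]
  refine (Polynomial.natDegree_prod_le _ _).trans ?_
  refine le_trans (Finset.sum_le_sum (g := fun i => μ.1 i) fun i _ => ?_) μ.2.1.le
  refine Polynomial.natDegree_pow_le.trans ?_
  have : (Polynomial.C (η i) + Polynomial.X * Polynomial.C (ξ i)).natDegree ≤ 1 := by
    compute_degree
  calc _ ≤ μ.1 i * 1 := Nat.mul_le_mul_left _ this
    _ = _ := mul_one _

theorem ratFunc_mem {k K : Type*} [Field k] [Field K] [Algebra k K]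
    (L : IntermediateField k (RatFunc K)) (hX : RatFunc.X ∈ L)
    (hK : ∀ a : K, algebraMap K (RatFunc K) a ∈ L) (x : RatFunc K) : x ∈ L := by
  have hp : ∀ p : Polynomial K, algebraMap (Polynomial K) (RatFunc K) p ∈ L := by
    intro p
    induction p using Polynomial.induction_on with
    | C a =>
      have := hK a
      rw [IsScalarTower.algebraMap_apply K (Polynomial K) (RatFunc K)] at this
      exact this
    | add p q hp hq => rw [map_add]; exact add_mem hp hq
    | monomial m a h =>
      rw [pow_succ, ← mul_assoc, map_mul]
      refine mul_mem h ?_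
      rw [RatFunc.algebraMap_X]
      exact hX
  rw [← RatFunc.num_div_denom x]
  exact div_mem (hp _) (hp _)

theorem core_s11 {K' K3 : Type u} [Field K'] [CharZero K'] {n q r : ℕ}
    (hn : 2 ≤ n) (hnq : n ≤ q) (hqr : q < r)
    [Field K3] [Algebra K' K3]
    (G : MvPolynomial (Fin (r + 1)) K3) (hG : G.IsHomogeneous (n + 2))
    (hY : ∀ μ ∈ G.support, ∃ i : Fin (r + 1), q < (i : ℕ) ∧ μ i ≠ 0)
    (hb : AlgebraicIndependent K' (fun μ : idx (n + 2) q r => G.coeff μ.1))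
    (η : Fin (r + 1) → K3) (hη0 : η 0 = 1)
    (hηz : ∀ i : Fin (r + 1), n < (i : ℕ) → η i = 0)
    (hηind : AlgebraicIndependent
      (↥(IntermediateField.adjoin K' (Set.range G.coeff)))
      (fun j : Fin n => η ⟨(j : ℕ) + 1, by have := j.isLt; omega⟩))
    (ξ : Fin (r + 1) → K3) (hξ0 : ξ 0 = 0) (hξ1 : ξ ⟨1, by omega⟩ = 1)
    (δ' : ℕ → MvPolynomial (Fin (r - 1))
      (↥(IntermediateField.adjoin K' (Set.range G.coeff ∪ Set.range η))))
    (hδ' : ∀ j, MvPolynomial.map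
        (algebraMap (↥(IntermediateField.adjoin K'
          (Set.range G.coeff ∪ Set.range η))) K3) (δ' j)
      = MvPolynomial.aeval (fun i : Fin (r + 1) =>
          if _h1 : (i : ℕ) = 0 then 0
          else if _h2 : (i : ℕ) = 1 then 1
          else MvPolynomial.X (⟨(i : ℕ) - 2, by have := i.isLt; omega⟩ : Fin (r - 1)))
        (polar G η j))
    (J : Ideal (MvPolynomial (Fin (r - 1))
      (↥(IntermediateField.adjoin K' (Set.range G.coeff ∪ Set.range η)))))
    (hJ : J = Ideal.span {p | ∃ j : ℕ, 1 ≤ j ∧ j ≤ n ∧ p = δ' j})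
    (hξgen : ∀ p, MvPolynomial.aeval
        (fun i : Fin (r - 1) => ξ ⟨(i : ℕ) + 2, Nat.succ_lt_succ (Nat.add_lt_of_lt_sub i.isLt)⟩) p = 0
      ↔ p ∈ J)
    (v : Fin (r + 1 - (n + 2)) → K3)
    (hv : AlgebraicIndependent
        (↥(IntermediateField.adjoin K' (Set.range G.coeff ∪ Set.range η))) v)
    (hv2 : ∀ i : Fin (r - 1), IsAlgebraic
        (↥(IntermediateField.adjoin
          (↥(IntermediateField.adjoin K' (Set.range G.coeff ∪ Set.range η)))
          (Set.range v)))
        (ξ ⟨(i : ℕ) + 2, Nat.succ_lt_succ (Nat.add_lt_of_lt_sub i.isLt)⟩))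
    (hgen : IntermediateField.adjoin K'
      (Set.range G.coeff ∪ Set.range η ∪ Set.range ξ) = ⊤) :
    (∃ a b : K3, a ≠ 0 ∧ (aeval (fun i : Fin (r + 1) =>
          Polynomial.C (η i) + Polynomial.X * Polynomial.C (ξ i)) G : Polynomial K3) =
      Polynomial.C a * Polynomial.X ^ (n + 1) + Polynomial.C b * Polynomial.X ^ (n + 2)) ∧
    AlgebraicIndependent (↥(IntermediateField.adjoin K' (Set.range G.coeff)))
      (fun i : Fin r => 
        (algebraMap K3 (RatFunc K3) (η ⟨(i : ℕ) + 1, Nat.succ_lt_succ i.isLt⟩)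
          + RatFunc.X * algebraMap K3 (RatFunc K3)
              (ξ ⟨(i : ℕ) + 1, Nat.succ_lt_succ i.isLt⟩))) := by
  classical
  have := Fintype.ofFinite (idx (n + 2) q r)
  have hcz : CharZero K3 := charZero_of_injective_algebraMap (algebraMap K' K3).injective
  let K1 := IntermediateField.adjoin K' (Set.range G.coeff)
  let K2 := IntermediateField.adjoin K' (Set.range G.coeff ∪ Set.range η)
  have hbη := hb.sumElim_of_tower (S := K1) (by
    rintro _ ⟨μ, rfl⟩
    exact ⟨⟨G.coeff μ.1, IntermediateField.subset_adjoin _ _ ⟨_, rfl⟩⟩, rfl⟩) hηind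
  have hind : AlgebraicIndependent K' (Sum.elim (fun μ : idx (n + 2) q r => G.coeff μ.1)
      (fun j : Fin n => η ⟨(j : ℕ) + 1, by have := j.isLt; omega⟩)) := by
    have := hbη.comp Sum.swap (Sum.swap_leftInverse.injective)
    convert this using 1
    funext i
    cases i <;> rfl
  have hvspan : ∀ a, a ∈ acl K2 (Set.range v) := by
    intro a
    have h1 : IntermediateField.adjoin K' (Set.range G.coeff ∪ Set.range η ∪ Set.range ξ) ≤
        (acl K2 (Set.range v)).restrictScalars K' := by
      rw [IntermediateField.adjoin_le_iff]
      rintro x (hx | ⟨i, rfl⟩)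
      · exact (acl K2 (Set.range v)).algebraMap_mem
          (⟨x, IntermediateField.subset_adjoin _ _ hx⟩ : K2)
      · change ξ i ∈ acl K2 (Set.range v)
        by_cases h0 : (i : ℕ) = 0
        · rw [show i = 0 from Fin.ext h0, hξ0]; exact zero_mem _
        by_cases h1 : (i : ℕ) = 1
        · rw [show i = ⟨1, by omega⟩ from Fin.ext h1, hξ1]; exact one_mem _
        · rw [mem_acl]
          have := hv2 ⟨i - 2, by omega⟩
          convert this using 2
          apply Fin.ext
          simp only
          omega
    rw [hgen] at h1
    exact h1 (IntermediateField.mem_top)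
  obtain ⟨i0, hi0, hξi0⟩ := exists_i0 hnq hqr hn G hG hY η hη0 hηz hind ξ δ' hδ' J hJ hξgen v hvspan
  set f : Polynomial K3 := aeval (fun i : Fin (r + 1) =>
          Polynomial.C (η i) + Polynomial.X * Polynomial.C (ξ i)) G with hf
  have hfc : ∀ j, 1 ≤ j → j ≤ n → f.coeff j = 0 := by
    intro j hj1 hj
    have h1 := (hξgen (δ' j)).2 (by rw [hJ]; exact Ideal.subset_span ⟨j, hj1, hj, rfl⟩)
    rw [aeval_delta (by omega) _ _ (hδ' j) ξ hξ0 hξ1, aeval_polar] at h1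
    exact (mul_eq_zero.1 h1).resolve_left (by exact_mod_cast j.factorial_ne_zero)
  have hf0 : f.coeff 0 = 0 := by
    rw [Polynomial.coeff_zero_eq_eval_zero, ← Polynomial.coe_evalRingHom, hf]
    apply hom_aeval_zero (q := q) G hY
    intro i hi
    rw [hηz i (by omega)]
    simp
  have hfsum := aeval_eq_sum_lin G hG hY η ξ
  have hfdeg : f.natDegree ≤ n + 2 := by
    rw [hf, hfsum]
    refine Polynomial.natDegree_sum_le_of_forall_le _ _ fun μ _ => ?_
    exact (Polynomial.natDegree_C_mul_le _ _).trans (lin_natDegree η ξ μ)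
  -- the family in `RatFunc K3`
  let φ : K3 →+* RatFunc K3 := algebraMap K3 (RatFunc K3)
  let bF : idx (n + 2) q r → RatFunc K3 := fun μ => φ (G.coeff μ.1)
  let ηF : Fin (r + 1) → RatFunc K3 := fun i => φ (η i)
  let αF : Fin (r + 1) → RatFunc K3 := fun i => φ (η i) + RatFunc.X * φ (ξ i)
  have hsum : ∀ j, ∑ μ, bF μ * (lin ηF (fun i => αF i - ηF i) μ.1).coeff j =
      φ (f.coeff j) * RatFunc.X ^ j := by
    intro j
    have h1 : (fun i => αF i - ηF i) = fun i => RatFunc.X * φ (ξ i) := by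
      funext i; simp [αF, ηF]
    rw [h1, hf, hfsum, Polynomial.finsetSum_coeff, map_sum, Finset.sum_mul]
    refine Finset.sum_congr rfl fun μ _ => ?_
    simp only [ηF]
    rw [lin_scale, Polynomial.comp_C_mul_X_coeff, Polynomial.coeff_C_mul, Polynomial.coeff_map,
      map_mul, mul_assoc]
  have hX0 : (RatFunc.X : RatFunc K3) ≠ 0 := RatFunc.X_ne_zero
  have hspanF : ∀ a, a ∈ acl K' (Set.range bF ∪ Set.range ηF ∪ Set.range αF) := by
    set L := acl K' (Set.range bF ∪ Set.range ηF ∪ Set.range αF) with hL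
    have hηL : ∀ i, φ (η i) ∈ L := fun i => subset_acl _ (Or.inl (Or.inr ⟨i, rfl⟩))
    have hαL : ∀ i, αF i ∈ L := fun i => subset_acl _ (Or.inr ⟨i, rfl⟩)
    have hXL : RatFunc.X ∈ L := by
      have : RatFunc.X = αF ⟨1, by omega⟩ - φ (η ⟨1, by omega⟩) := by
        simp [αF, hξ1]
      rw [this]
      exact sub_mem (hαL _) (hηL _)
    have hξL : ∀ i, φ (ξ i) ∈ L := by
      intro i
      have : φ (ξ i) = (αF i - φ (η i)) / RatFunc.X := by
        simp only [αF]
        field_simp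
        ring
      rw [this]
      exact div_mem (sub_mem (hαL _) (hηL _)) hXL
    apply ratFunc_mem L hXL
    have h1 : IntermediateField.adjoin K' (Set.range G.coeff ∪ Set.range η ∪ Set.range ξ) ≤
        L.comap (IsScalarTower.toAlgHom K' K3 (RatFunc K3)) := by
      rw [IntermediateField.adjoin_le_iff]
      rintro x ((⟨μ, rfl⟩ | ⟨i, rfl⟩) | ⟨i, rfl⟩)
      · change φ (G.coeff μ) ∈ L
        by_cases h0 : G.coeff μ = 0
        · rw [h0, map_zero]; exact zero_mem _
        · have hμ := hY μ (by simpa using h0)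
          have hdeg := hG h0
          refine subset_acl _ (Or.inl (Or.inl ⟨⟨μ, ?_, hμ⟩, rfl⟩))
          rw [← hdeg, Finsupp.weight_apply, Finsupp.sum_fintype] <;> simp
      · exact hηL i
      · exact hξL i
    rw [hgen] at h1
    exact fun a => h1 (IntermediateField.mem_top (x := a))
  have hy1 := hbη.sumElim_of_tower (S := K2) (by
    rintro _ ⟨μ | j, rfl⟩
    · exact ⟨⟨η _, IntermediateField.subset_adjoin _ _ (Or.inr ⟨_, rfl⟩)⟩, rfl⟩
    · exact ⟨⟨G.coeff _, IntermediateField.subset_adjoin _ _ (Or.inl ⟨_, rfl⟩)⟩, rfl⟩) hv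
  have hXi : AlgebraicIndependent K3 (fun _ : Unit => (RatFunc.X : RatFunc K3)) := by
    rw [algebraicIndependent_unique_type_iff]
    exact RatFunc.transcendental_X
  have hy := hy1.sumElim_comp hXi
  have hfam := family (k := K') hnq hqr bF ηF αF (by simp [ηF, hη0]) (by simp [αF, hη0, hξ0]) i0 hi0
    (by intro i hi; simp [ηF, hηz i hi])
    (by
      simp only [αF, hηz i0 (by omega), map_zero, zero_add]
      exact mul_ne_zero hX0 (by simpa [φ] using hξi0))
    hspanF hy (by
      simp only [Nat.card_sum, Nat.card_eq_fintype_card, Fintype.card_sum, Fintype.card_fin, Fintype.card_unit]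
      omega) (by
      intro j hj1 hj
      rw [hsum, hfc j hj1 hj, map_zero, zero_mul])
  refine ⟨⟨f.coeff (n + 1), f.coeff (n + 2), ?_, ?_⟩, ?_⟩
  · intro h
    apply hfam.2
    rw [hsum, h, map_zero, zero_mul]
  · ext j
    simp only [Polynomial.coeff_add, Polynomial.coeff_C_mul, Polynomial.coeff_X_pow]
    rcases Nat.lt_trichotomy j (n + 1) with h | h | h
    · rw [if_neg (by omega), if_neg (by omega)]
      rcases Nat.eq_zero_or_pos j with h0 | h0
      · rw [h0, hf0]; simp
      · rw [hfc j h0 (by omega)]; simp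
    · subst h
      simp
    · by_cases h2 : j = n + 2
      · subst h2; simp
      · rw [if_neg (by omega), if_neg h2, Polynomial.coeff_eq_zero_of_natDegree_lt (by omega)]
        simp
  · refine indep_over (fun μ : idx (n + 2) q r => G.coeff μ.1) _ ?_ _ hfam.1
    rintro _ ⟨μ, rfl⟩
    by_cases h0 : G.coeff μ = 0
    · exact Or.inr h0
    · have hμ := hY μ (by simpa using h0)
      have hdeg := hG h0
      refine Or.inl ⟨⟨μ, ?_, hμ⟩, rfl⟩
      rw [← hdeg, Finsupp.weight_apply, Finsupp.sum_fintype] <;> simp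

end corepart

section ratpart
open MvPolynomial

theorem odd_not_square {K : Type*} [Field K] (a b : K) (ha : a ≠ 0) (m : ℕ) (g : RatFunc K) :
    g ^ 2 ≠ algebraMap (Polynomial K) (RatFunc K)
      (Polynomial.C a * Polynomial.X ^ (2 * m + 1) + Polynomial.C b * Polynomial.X ^ (2 * m + 2)) := by
  intro h
  set f := Polynomial.C a * Polynomial.X ^ (2 * m + 1) + Polynomial.C b * Polynomial.X ^ (2 * m + 2)
    with hf
  have hc : (Polynomial.C a + Polynomial.C b * Polynomial.X).coeff 0 = a := by simp
  have hf2 : f = (Polynomial.C a + Polynomial.C b * Polynomial.X) * Polynomial.X ^ (2 * m + 1) := by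
    rw [hf]; ring
  have hne : (Polynomial.C a + Polynomial.C b * Polynomial.X) ≠ 0 := by
    intro h0; rw [h0] at hc; exact ha (by simpa using hc.symm)
  have hf0 : f ≠ 0 := by
    rw [hf2]; exact mul_ne_zero hne (pow_ne_zero _ Polynomial.X_ne_zero)
  have hft : f.natTrailingDegree = 2 * m + 1 := by
    rw [hf2, Polynomial.natTrailingDegree_mul_X_pow hne]
    have : (Polynomial.C a + Polynomial.C b * Polynomial.X).natTrailingDegree = 0 :=
      Nat.le_zero.1 (Polynomial.natTrailingDegree_le_of_ne_zero (by rw [hc]; exact ha))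
    omega
  have hq : g.denom ≠ 0 := g.denom_ne_zero
  have heq : g.num ^ 2 = f * g.denom ^ 2 := by
    apply RatFunc.algebraMap_injective K
    have h2 := RatFunc.num_div_denom g
    have hq' : algebraMap (Polynomial K) (RatFunc K) g.denom ≠ 0 := by
      simpa using hq
    rw [map_mul, map_pow, map_pow, ← h]
    rw [← mul_pow]
    congr 1
    rw [div_eq_iff hq'] at h2
    exact h2
  have hp : g.num ≠ 0 := by
    intro h0
    rw [h0] at heq
    exact mul_ne_zero hf0 (pow_ne_zero 2 hq) (by rw [← heq]; simp)
  have := congrArg Polynomial.natTrailingDegree heq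
  rw [pow_two, pow_two, Polynomial.natTrailingDegree_mul hp hp,
    Polynomial.natTrailingDegree_mul hf0 (mul_ne_zero hq hq),
    Polynomial.natTrailingDegree_mul hq hq, hft] at this
  omega

theorem fracRing_mem {k K σ : Type*} [Field k] [Field K] [Algebra k K]
    (L : IntermediateField k (FractionRing (MvPolynomial σ K)))
    (hX : ∀ i, algebraMap (MvPolynomial σ K) (FractionRing (MvPolynomial σ K)) (X i) ∈ L)
    (hK : ∀ a : K, algebraMap K (FractionRing (MvPolynomial σ K)) a ∈ L)
    (x : FractionRing (MvPolynomial σ K)) : x ∈ L := by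
  have hp : ∀ p : MvPolynomial σ K, algebraMap _ (FractionRing (MvPolynomial σ K)) p ∈ L := by
    intro p
    induction p using MvPolynomial.induction_on with
    | C a =>
      have := hK a
      rw [IsScalarTower.algebraMap_apply K (MvPolynomial σ K)
        (FractionRing (MvPolynomial σ K))] at this
      exact this
    | add p q hp hq => rw [map_add]; exact add_mem hp hq
    | mul_X p i h => rw [map_mul]; exact mul_mem h (hX i)
  obtain ⟨p, q, hq, rfl⟩ := IsFractionRing.div_surjective (A := MvPolynomial σ K) x
  exact div_mem (hp _) (hp _)

theorem exists_hom_of_gen {k Ω κ : Type*} [Field k] [Field Ω] [Algebra k Ω] {r : ℕ} (z : κ → Ω)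
    (hz : AlgebraicIndependent k z) (htop : IntermediateField.adjoin k (Set.range z) = ⊤)
    (e : Fin r ≃ κ) : Nonempty (Ω →ₐ[k] FractionRing (MvPolynomial (Fin r) k)) := by
  have hz' := hz.comp e e.injective
  have htop' : IntermediateField.adjoin k (Set.range (z ∘ e)) = ⊤ := by
    rw [e.surjective.range_comp, htop]
  exact ⟨((((IntermediateField.equivOfEq htop').trans IntermediateField.topEquiv).symm).trans
    hz'.aevalEquivField.symm).toAlgHom⟩

theorem rat_big {k1 k2 : Type*} [Field k1] [Field k2] [Algebra k1 k2] {ι σ : Type*} {r : ℕ}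
    (x : ι → k2) (hx : AlgebraicIndependent k1 x)
    (hxt : IntermediateField.adjoin k1 (Set.range x) = ⊤)
    (e : Fin r ≃ Unit ⊕ (σ ⊕ ι)) :
    Nonempty (RatFunc (FractionRing (MvPolynomial σ k2)) →ₐ[k1]
      FractionRing (MvPolynomial (Fin r) k1)) := by
  let Φ := FractionRing (MvPolynomial σ k2)
  let Ω := RatFunc Φ
  have hσ : AlgebraicIndependent k2
      (fun i : σ => algebraMap (MvPolynomial σ k2) Φ (X i)) := by
    have h1 : AlgebraicIndependent k2 (X : σ → MvPolynomial σ k2) :=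
      MvPolynomial.algebraicIndependent_X σ k2
    exact h1.map' (f := IsScalarTower.toAlgHom k2 (MvPolynomial σ k2) Φ)
      (IsFractionRing.injective (MvPolynomial σ k2) Φ)
  have hXi : AlgebraicIndependent Φ (fun _ : Unit => (RatFunc.X : Ω)) := by
    rw [algebraicIndependent_unique_type_iff]
    exact RatFunc.transcendental_X
  have hz1 := hx.sumElim_comp hσ
  have hz2 := hz1.sumElim_comp hXi
  have key : ∀ S : Set Ω, RatFunc.X ∈ S →
      (∀ i, algebraMap Φ Ω (algebraMap (MvPolynomial σ k2) Φ (X i)) ∈ S) →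
      (∀ i, algebraMap Φ Ω (algebraMap k2 Φ (x i)) ∈ S) →
      IntermediateField.adjoin k1 S = ⊤ := by
    intro S hS1 hS2 hS3
    rw [eq_top_iff]
    intro y _
    refine ratFunc_mem _ (IntermediateField.subset_adjoin _ _ hS1) ?_ y
    intro a
    refine fracRing_mem ((IntermediateField.adjoin k1 S).comap
      (IsScalarTower.toAlgHom k1 Φ Ω)) ?_ ?_ a
    · intro i
      exact IntermediateField.subset_adjoin _ _ (hS2 i)
    · intro c
      have : IntermediateField.adjoin k1 (Set.range x) ≤
          ((IntermediateField.adjoin k1 S).comap (IsScalarTower.toAlgHom k1 Φ Ω)).comap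
            (IsScalarTower.toAlgHom k1 k2 Φ) := by
        rw [IntermediateField.adjoin_le_iff]
        rintro _ ⟨i, rfl⟩
        exact IntermediateField.subset_adjoin _ _ (hS3 i)
      rw [hxt] at this
      exact this (IntermediateField.mem_top (x := c))
  exact exists_hom_of_gen _ hz2 (key _ ⟨Sum.inl (), rfl⟩ (fun i => ⟨Sum.inr (Sum.inl i), rfl⟩)
    (fun i => ⟨Sum.inr (Sum.inr i), rfl⟩)) e

theorem rat_curve {k1 K3 Φ : Type*} [Field k1] [Field K3] [Field Φ]
    [Algebra k1 K3] [Algebra k1 Φ]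
    (θ : K3 →ₐ[k1] Φ) (a b : K3) (ha : a ≠ 0) (m : ℕ)
    (f : Polynomial K3)
    (hf : f = Polynomial.C a * Polynomial.X ^ (2 * m + 1) +
      Polynomial.C b * Polynomial.X ^ (2 * m + 2))
    (IM : Ideal (Polynomial (RatFunc K3)))
    (hIM : IM = Ideal.span {Polynomial.X ^ 2 -
      Polynomial.C (algebraMap (Polynomial K3) (RatFunc K3) f)}) :
    ∃ φM : (Polynomial (RatFunc K3) ⧸ IM) →ₐ[k1] RatFunc Φ, Function.Injective φM := by
  have hmax : IM.IsMaximal := by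
    rw [hIM]
    apply PrincipalIdealRing.isMaximal_of_irreducible
    rw [X_pow_sub_C_irreducible_iff_of_prime Nat.prime_two]
    intro g
    rw [hf]
    exact odd_not_square a b ha m g
  let θ' : K3 →ₐ[k1] RatFunc Φ := (IsScalarTower.toAlgHom k1 Φ (RatFunc Φ)).comp θ
  let s : RatFunc Φ := RatFunc.X
  have hs : s ∉ algebraicClosure Φ (RatFunc Φ) := by
    intro h
    exact RatFunc.transcendental_X (mem_algebraicClosure_iff.1 h)
  have hmem : ∀ c, θ' c ∈ algebraicClosure Φ (RatFunc Φ) := fun c =>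
    (algebraicClosure Φ (RatFunc Φ)).algebraMap_mem (θ c)
  have hs2 : s ^ 2 - θ' b ∉ algebraicClosure Φ (RatFunc Φ) := by
    intro h
    have h2 : s ^ 2 ∈ algebraicClosure Φ (RatFunc Φ) := by
      have := add_mem h (hmem b)
      simpa using this
    rw [mem_algebraicClosure_iff] at h2
    exact hs (mem_algebraicClosure_iff.2 (h2.of_pow (by norm_num)))
  have hs0 : s ^ 2 - θ' b ≠ 0 := fun h => hs2 (by rw [h]; exact zero_mem _)
  have ha0 : θ' a ≠ 0 := by simpa using ha
  let t : RatFunc Φ := θ' a / (s ^ 2 - θ' b)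
  have ht0 : t ≠ 0 := div_ne_zero ha0 hs0
  have ht : Transcendental Φ t := by
    intro h
    apply hs2
    have : s ^ 2 - θ' b = θ' a / t := by
      simp only [t]; field_simp
    rw [this]
    exact div_mem (hmem a) (mem_algebraicClosure_iff.2 h)
  let ψ : Polynomial K3 →ₐ[k1] RatFunc Φ :=
    Polynomial.eval₂AlgHom θ' t (fun _ => mul_comm _ _)
  have hψ : Function.Injective ψ := by
    rw [injective_iff_map_eq_zero]
    intro p hp
    have h1 : Polynomial.aeval t (p.map (θ : K3 →+* Φ)) = 0 := by
      rw [Polynomial.aeval_def, Polynomial.eval₂_map]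
      exact hp
    have h2 := (transcendental_iff.1 ht) _ h1
    exact (Polynomial.map_eq_zero_iff (RingHom.injective _)).1 h2
  let χ : RatFunc K3 →ₐ[k1] RatFunc Φ := RatFunc.liftAlgHom ψ (by
    intro p hp
    rw [Submonoid.mem_comap]
    exact mem_nonZeroDivisors_of_ne_zero (by
      rw [Ne, map_eq_zero_iff _ hψ]
      exact nonZeroDivisors.ne_zero hp))
  let Ψ : Polynomial (RatFunc K3) →ₐ[k1] RatFunc Φ :=
    Polynomial.eval₂AlgHom χ (s * t ^ (m + 1)) (fun _ => mul_comm _ _)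
  have hΨ : ∀ p ∈ IM, Ψ p = 0 := by
    intro p hp
    have : IM ≤ RingHom.ker Ψ := by
      rw [hIM, Ideal.span_singleton_le_iff_mem, RingHom.mem_ker, map_sub, map_pow]
      have h1 : Ψ Polynomial.X = s * t ^ (m + 1) := Polynomial.eval₂_X _ _
      have h2 : ∀ g, Ψ (Polynomial.C g) = χ g := fun g => Polynomial.eval₂_C _ _
      have h3 : ∀ g, χ (algebraMap _ _ g) = ψ g := by
        intro g
        have := RatFunc.liftAlgHom_apply_div ψ (by
          intro p hp
          rw [Submonoid.mem_comap]
          exact mem_nonZeroDivisors_of_ne_zero (by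
            rw [Ne, map_eq_zero_iff _ hψ]
            exact nonZeroDivisors.ne_zero hp)) g 1
        rw [map_one, map_one, div_one, div_one] at this
        exact this
      have h4 : ψ f = θ' a * t ^ (2 * m + 1) + θ' b * t ^ (2 * m + 2) := by
        have h6 : ψ Polynomial.X = t := Polynomial.eval₂_X _ _
        have h7 : ∀ c, ψ (Polynomial.C c) = θ' c := fun c => Polynomial.eval₂_C _ _
        rw [hf, map_add, map_mul, map_mul, map_pow, map_pow, h6, h7, h7]
      have h5 : t * s ^ 2 = θ' a + t * θ' b := by
        have : t * (s ^ 2 - θ' b) = θ' a := div_mul_cancel₀ _ hs0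
        rw [← this]; ring
      rw [h1, h2, h3, h4, sub_eq_zero]
      calc (s * t ^ (m + 1)) ^ 2 = (t * s ^ 2) * t ^ (2 * m + 1) := by ring
        _ = _ := by rw [h5]; ring
    exact this hp
  refine ⟨Ideal.Quotient.liftₐ IM Ψ hΨ, ?_⟩
  have hker : RingHom.ker (Ψ : Polynomial (RatFunc K3) →+* RatFunc Φ) ≤ IM := by
    have h1 := hmax.eq_of_le (RingHom.ker_ne_top (Ψ : Polynomial (RatFunc K3) →+* RatFunc Φ))
      (fun p hp => hΨ p hp)
    exact h1.ge
  exact RingHom.lift_injective_of_ker_le_ideal IM hΨ hker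

theorem rat_embed {k1 k2 K3 : Type*} [Field k1] [Field k2] [Field K3] [Algebra k1 k2]
    [Algebra k1 K3] [Algebra k2 K3] [IsScalarTower k1 k2 K3] {ι σ : Type*} {r : ℕ}
    (x : ι → k2) (hx : AlgebraicIndependent k1 x)
    (hxt : IntermediateField.adjoin k1 (Set.range x) = ⊤)
    (e : Fin r ≃ Unit ⊕ (σ ⊕ ι))
    (θ : K3 →ₐ[k2] FractionRing (MvPolynomial σ k2)) (a b : K3) (ha : a ≠ 0) (m : ℕ)
    (f : Polynomial K3)
    (hf : f = Polynomial.C a * Polynomial.X ^ (2 * m + 1) + Polynomial.C b * Polynomial.X ^ (2 * m + 2))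
    (IM : Ideal (Polynomial (RatFunc K3)))
    (hIM : IM = Ideal.span {Polynomial.X ^ 2 - Polynomial.C (algebraMap (Polynomial K3) (RatFunc K3) f)}) :
    ∃ φM : (Polynomial (RatFunc K3) ⧸ IM) →+* FractionRing (MvPolynomial (Fin r) k1),
      (∀ c : k1, φM (Ideal.Quotient.mk IM (Polynomial.C (algebraMap K3 (RatFunc K3)
        (algebraMap k1 K3 c)))) = algebraMap k1 _ c) ∧ Function.Injective φM := by
  obtain ⟨φ, hφ⟩ := rat_curve (θ.restrictScalars k1) a b ha m f hf IM hIM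
  obtain ⟨E⟩ := rat_big (σ := σ) x hx hxt e
  refine ⟨(E.comp φ).toRingHom, fun c => ?_, E.toRingHom.injective.comp hφ⟩
  rw [← (E.comp φ).commutes c, IsScalarTower.algebraMap_apply k1 (RatFunc K3)
    (Polynomial (RatFunc K3) ⧸ IM), IsScalarTower.algebraMap_apply k1 K3 (RatFunc K3)]
  rfl

end ratpart

section finalpart
open MvPolynomial

theorem snoc_dep {k K3 : Type*} [Field k] [Field K3] [Algebra k K3] {r : ℕ}
    (G : MvPolynomial (Fin (r + 1)) K3) (G' : MvPolynomial (Fin (r + 1)) k)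
    (hG' : MvPolynomial.map (algebraMap k K3) G' = G)
    (η ξ : Fin (r + 1) → K3) (hη0 : η 0 = 1) (hξ0 : ξ 0 = 0)
    (IM : Ideal (Polynomial (RatFunc K3)))
    (hIM : IM = Ideal.span {Polynomial.X ^ 2 - Polynomial.C
      (algebraMap (Polynomial K3) (RatFunc K3)
        (MvPolynomial.aeval (fun i : Fin (r + 1) =>
          Polynomial.C (η i) + Polynomial.X * Polynomial.C (ξ i)) G))}) :
    ¬ AlgebraicIndependent k
      (Fin.snoc (fun i : Fin r => Ideal.Quotient.mk IM (Polynomial.C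
          (algebraMap K3 (RatFunc K3) (η i.succ)
            + RatFunc.X * algebraMap K3 (RatFunc K3) (ξ i.succ))))
        (Ideal.Quotient.mk IM Polynomial.X) : Fin (r + 1) → Polynomial (RatFunc K3) ⧸ IM) := by
  intro hind
  let β : Fin (r + 1) → RatFunc K3 := fun i =>
    algebraMap K3 (RatFunc K3) (η i) + RatFunc.X * algebraMap K3 (RatFunc K3) (ξ i)
  have hβ0 : β 0 = 1 := by simp [β, hη0, hξ0]
  let P : MvPolynomial (Fin (r + 1)) k := X (Fin.last r) ^ 2 -
    aeval (Fin.cons 1 (fun i : Fin r => X i.castSucc) : Fin (r + 1) → MvPolynomial (Fin (r + 1)) k) G'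
  have hP : ∀ {A : Type _} [CommRing A] [Algebra k A] (y : Fin r → A) (w : A),
      aeval (Fin.snoc y w : Fin (r + 1) → A) P =
        w ^ 2 - aeval (Fin.cons 1 y : Fin (r + 1) → A) G' := by
    intro A _ _ y w
    simp only [P, map_sub, map_pow, aeval_X, Fin.snoc_last]
    congr 1
    rw [← AlgHom.comp_apply, comp_aeval]
    congr 2
    funext i
    refine Fin.cases ?_ (fun i => ?_) i
    · simp
    · simp
  have hF : aeval β G' = algebraMap (Polynomial K3) (RatFunc K3)
        (MvPolynomial.aeval (fun i : Fin (r + 1) =>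
          Polynomial.C (η i) + Polynomial.X * Polynomial.C (ξ i)) G) := by
    rw [← hG', aeval_map_algebraMap]
    have := (IsScalarTower.toAlgHom k (Polynomial K3) (RatFunc K3)).comp_apply
      (aeval (fun i : Fin (r + 1) =>
          Polynomial.C (η i) + Polynomial.X * Polynomial.C (ξ i))) G'
    rw [comp_aeval] at this
    refine Eq.trans ?_ this
    congr 2
    funext i
    simp only [β, map_add, map_mul, IsScalarTower.coe_toAlgHom', RatFunc.algebraMap_X]
    rfl
  have hcons : (Fin.cons 1 (fun i : Fin r => β i.succ) : Fin (r + 1) → RatFunc K3) = β := by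
    funext i
    refine Fin.cases ?_ (fun i => ?_) i
    · simp [hβ0]
    · simp
  have hPz : P = 0 := by
    apply (injective_iff_map_eq_zero _).1 hind
    rw [hP]
    let c : RatFunc K3 →ₐ[k] Polynomial (RatFunc K3) ⧸ IM :=
      (Ideal.Quotient.mkₐ k IM).comp (IsScalarTower.toAlgHom k (RatFunc K3) (Polynomial (RatFunc K3)))
    have h1 : (Fin.cons 1 (fun i : Fin r => Ideal.Quotient.mk IM (Polynomial.C
          (algebraMap K3 (RatFunc K3) (η i.succ)
            + RatFunc.X * algebraMap K3 (RatFunc K3) (ξ i.succ)))) :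
          Fin (r + 1) → Polynomial (RatFunc K3) ⧸ IM) = fun i => c (β i) := by
      funext i
      refine Fin.cases ?_ (fun i => ?_) i
      · simp [hβ0]
      · rfl
    have h2 : aeval (fun i => c (β i)) G' = c (aeval β G') := by
      rw [← comp_aeval]; rfl
    rw [h1, h2, hF, ← map_pow]
    change _ - Ideal.Quotient.mk IM (Polynomial.C _) = 0
    rw [← map_sub, Ideal.Quotient.eq_zero_iff_mem, hIM]
    exact Ideal.mem_span_singleton_self _
  have e0 := hP (fun i : Fin r => β i.succ) 0
  have e1 := hP (fun i : Fin r => β i.succ) 1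
  rw [hPz, map_zero, hcons] at e0 e1
  have : (1 : RatFunc K3) = 0 := by linear_combination e0 - e1
  exact one_ne_zero this

theorem final {K' K3 : Type u} [Field K'] [CharZero K'] {m q r : ℕ}
    (hm : 1 ≤ m) (hnq : 2 * m ≤ q) (hqr : q < r)
    [Field K3] [Algebra K' K3]
    (G : MvPolynomial (Fin (r + 1)) K3) (hG : G.IsHomogeneous (2 * m + 2))
    (hY : ∀ μ ∈ G.support, ∃ i : Fin (r + 1), q < (i : ℕ) ∧ μ i ≠ 0)
    (hb : AlgebraicIndependent K' (fun μ : idx (2 * m + 2) q r => G.coeff μ.1))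
    (η : Fin (r + 1) → K3) (hη0 : η 0 = 1)
    (hηz : ∀ i : Fin (r + 1), 2 * m < (i : ℕ) → η i = 0)
    (hηind : AlgebraicIndependent
      (↥(IntermediateField.adjoin K' (Set.range G.coeff)))
      (fun j : Fin (2 * m) => η ⟨(j : ℕ) + 1, by have := j.isLt; omega⟩))
    (ξ : Fin (r + 1) → K3) (hξ0 : ξ 0 = 0) (hξ1 : ξ ⟨1, by omega⟩ = 1)
    (δ' : ℕ → MvPolynomial (Fin (r - 1))
      (↥(IntermediateField.adjoin K' (Set.range G.coeff ∪ Set.range η))))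
    (hδ' : ∀ j, MvPolynomial.map
        (algebraMap (↥(IntermediateField.adjoin K'
          (Set.range G.coeff ∪ Set.range η))) K3) (δ' j)
      = MvPolynomial.aeval (fun i : Fin (r + 1) =>
          if _h1 : (i : ℕ) = 0 then 0
          else if _h2 : (i : ℕ) = 1 then 1
          else MvPolynomial.X (⟨(i : ℕ) - 2, by have := i.isLt; omega⟩ : Fin (r - 1)))
        (polar G η j))
    (J : Ideal (MvPolynomial (Fin (r - 1))
      (↥(IntermediateField.adjoin K' (Set.range G.coeff ∪ Set.range η)))))
    (hJ : J = Ideal.span {p | ∃ j : ℕ, 1 ≤ j ∧ j ≤ 2 * m ∧ p = δ' j})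
    (hξgen : ∀ p, MvPolynomial.aeval
        (fun i : Fin (r - 1) => ξ ⟨(i : ℕ) + 2, Nat.succ_lt_succ (Nat.add_lt_of_lt_sub i.isLt)⟩) p = 0
      ↔ p ∈ J)
    (v : Fin (r + 1 - (2 * m + 2)) → K3)
    (hv : AlgebraicIndependent
        (↥(IntermediateField.adjoin K' (Set.range G.coeff ∪ Set.range η))) v)
    (hv2 : ∀ i : Fin (r - 1), IsAlgebraic
        (↥(IntermediateField.adjoin
          (↥(IntermediateField.adjoin K' (Set.range G.coeff ∪ Set.range η)))
          (Set.range v)))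
        (ξ ⟨(i : ℕ) + 2, Nat.succ_lt_succ (Nat.add_lt_of_lt_sub i.isLt)⟩))
    (hgen : IntermediateField.adjoin K'
      (Set.range G.coeff ∪ Set.range η ∪ Set.range ξ) = ⊤)
    (hFη : Nonempty (K3 →ₐ[↥(IntermediateField.adjoin K'
        (Set.range G.coeff ∪ Set.range η))]
      FractionRing (MvPolynomial (Fin (r + 1 - (2 * m + 2)))
        (↥(IntermediateField.adjoin K' (Set.range G.coeff ∪ Set.range η))))))
    (IM : Ideal (Polynomial (RatFunc K3)))
    (hIM : IM = Ideal.span {Polynomial.X ^ 2 - Polynomial.C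
      (algebraMap (Polynomial K3) (RatFunc K3)
        (MvPolynomial.aeval (fun i : Fin (r + 1) =>
          Polynomial.C (η i) + Polynomial.X * Polynomial.C (ξ i)) G))}) :
    (∃ φM : (Polynomial (RatFunc K3) ⧸ IM) →ₐ[↥(IntermediateField.adjoin K'
          (Set.range G.coeff))]
        FractionRing (MvPolynomial (Fin r)
          (↥(IntermediateField.adjoin K' (Set.range G.coeff)))),
      Function.Injective φM) ∧
    AlgebraicIndependent (↥(IntermediateField.adjoin K' (Set.range G.coeff)))
      (fun i : Fin r => Ideal.Quotient.mk IM (Polynomial.C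
        (algebraMap K3 (RatFunc K3) (η ⟨(i : ℕ) + 1, Nat.succ_lt_succ i.isLt⟩)
          + RatFunc.X * algebraMap K3 (RatFunc K3)
              (ξ ⟨(i : ℕ) + 1, Nat.succ_lt_succ i.isLt⟩)))) ∧
    ¬ AlgebraicIndependent (↥(IntermediateField.adjoin K' (Set.range G.coeff)))
      (Fin.snoc (fun i : Fin r => Ideal.Quotient.mk IM (Polynomial.C
          (algebraMap K3 (RatFunc K3) (η ⟨(i : ℕ) + 1, Nat.succ_lt_succ i.isLt⟩)
            + RatFunc.X * algebraMap K3 (RatFunc K3)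
                (ξ ⟨(i : ℕ) + 1, Nat.succ_lt_succ i.isLt⟩))))
        (Ideal.Quotient.mk IM Polynomial.X)) := by
  obtain ⟨⟨a, b, ha, hf⟩, hα⟩ := core_s11 (by omega) hnq hqr G hG hY hb η hη0 hηz hηind ξ hξ0 hξ1
    δ' hδ' J hJ hξgen v hv hv2 hgen
  have hφ : ∃ φM : (Polynomial (RatFunc K3) ⧸ IM) →ₐ[↥(IntermediateField.adjoin K'
          (Set.range G.coeff))]
        FractionRing (MvPolynomial (Fin r)
          (↥(IntermediateField.adjoin K' (Set.range G.coeff)))),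
      Function.Injective φM := by
    let K1 := IntermediateField.adjoin K' (Set.range G.coeff)
    let K2 := IntermediateField.adjoin K' (Set.range G.coeff ∪ Set.range η)
    have h12 : K1 ≤ K2 := IntermediateField.adjoin.mono _ _ _ Set.subset_union_left
    letI : Algebra K1 K2 := (IntermediateField.inclusion h12).toRingHom.toAlgebra
    haveI : IsScalarTower K1 K2 K3 := IsScalarTower.of_algebraMap_eq fun _ => rfl
    let x : Fin (2 * m) → K2 := fun j => ⟨η ⟨(j : ℕ) + 1, by have := j.isLt; omega⟩,
      IntermediateField.subset_adjoin _ _ (Or.inr ⟨_, rfl⟩)⟩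
    have hx : AlgebraicIndependent K1 x :=
      AlgebraicIndependent.of_comp (IsScalarTower.toAlgHom K1 K2 K3) hηind
    have hxt : IntermediateField.adjoin K1 (Set.range x) = ⊤ := by
      rw [eq_top_iff]
      intro c _
      let L := IntermediateField.adjoin K1 (Set.range x)
      have hle : K2 ≤ (L.map (IsScalarTower.toAlgHom K1 K2 K3)).restrictScalars K' := by
        rw [IntermediateField.adjoin_le_iff]
        rintro y (hy | ⟨i, rfl⟩)
        · exact (L.map (IsScalarTower.toAlgHom K1 K2 K3)).algebraMap_mem
            (⟨y, IntermediateField.subset_adjoin _ _ hy⟩ : K1)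
        · change η i ∈ L.map (IsScalarTower.toAlgHom K1 K2 K3)
          by_cases h0 : (i : ℕ) = 0
          · rw [show i = 0 from Fin.ext h0, hη0]; exact one_mem _
          by_cases h1 : 2 * m < (i : ℕ)
          · rw [hηz i h1]; exact zero_mem _
          · refine ⟨x ⟨i - 1, by omega⟩, IntermediateField.subset_adjoin _ _ ⟨_, rfl⟩, ?_⟩
            change η _ = η i
            congr 1
            apply Fin.ext
            simp only
            omega
      obtain ⟨y, hy, hyc⟩ := hle c.2
      have : y = c := Subtype.ext hyc
      rw [← this]
      exact hy
    obtain ⟨θ⟩ := hFη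
    have e : Fin r ≃ Unit ⊕ (Fin (r + 1 - (2 * m + 2)) ⊕ Fin (2 * m)) :=
      Fintype.equivOfCardEq (by simp; omega)
    obtain ⟨φ0, hc, hφ0⟩ := rat_embed (k1 := K1) (k2 := K2) x hx hxt e θ a b ha m _ hf IM hIM
    refine ⟨{ φ0 with commutes' := ?_ }, hφ0⟩
    intro c
    exact hc c
  obtain ⟨φM, hφM⟩ := hφ
  have hnt : Nontrivial (Polynomial (RatFunc K3) ⧸ IM) :=
    φM.toRingHom.domain_nontrivial
  refine ⟨⟨φM, hφM⟩, ?_, ?_⟩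
  · let c : RatFunc K3 →ₐ[↥(IntermediateField.adjoin K' (Set.range G.coeff))]
        Polynomial (RatFunc K3) ⧸ IM :=
      (Ideal.Quotient.mkₐ _ IM).comp
        (IsScalarTower.toAlgHom _ (RatFunc K3) (Polynomial (RatFunc K3)))
    exact hα.map' (f := c) c.toRingHom.injective
  · have hGm : ∃ G' : MvPolynomial (Fin (r + 1)) (↥(IntermediateField.adjoin K' (Set.range G.coeff))),
        MvPolynomial.map (algebraMap _ K3) G' = G := by
      have : G ∈ Set.range (MvPolynomial.map (σ := Fin (r + 1))
          (algebraMap (↥(IntermediateField.adjoin K' (Set.range G.coeff))) K3)) := by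
        rw [MvPolynomial.mem_range_map_iff_coeffs_subset]
        intro c hc
        obtain ⟨μ, _, rfl⟩ := MvPolynomial.mem_coeffs_iff.1 hc
        exact ⟨⟨_, IntermediateField.subset_adjoin _ _ ⟨μ, rfl⟩⟩, rfl⟩
      exact this
    obtain ⟨G', hG'⟩ := hGm
    exact snoc_dep G G' hG' η ξ hη0 hξ0 IM hIM

end finalpart

/-- **Rationality of the curves `C_{ηξ}` on the double cover and dominance of the family
(Lemmas 9 and 10 of the paper).** In the situation of the residual-point lemma — `K'` of
characteristic zero, `d ≥ 3`, `2d - 2 ≤ q < r`, `G = Σ_{|I|<2d} b_{I,J} Z^I Y^J`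
homogeneous of degree `2d` with every monomial involving a `Y`-variable and all
coefficients algebraically independent over `K'`, `η = (1, η_1, …, η_{2d-2}, 0, …, 0)`
with the `η_i` algebraically independent over `K'(b)`, `ξ = (0, 1, ξ_2, …, ξ_r)` a
generic point over `K'(b,η)` of the (assumed irreducible, `(r - 2d + 1)`-dimensional)
variety `F*_η` cut out by `Z_0 = 0` and the polars `Δ^j_η(G) = 0`, `j = 1, …, 2d-2`,
the whole situation taking place inside the field `K3 = K'(b, η, ξ)` — assume further
that `K'(b)(η, ξ) = K3` admits a `K'(b)(η)`-algebra embedding into the rational function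
field `K'(b)(η)(t_1, …, t_{r-2d+1})` (unirationality of `F*_η`). Let `t` be a new
variable, `f(t) = G(η + tξ)`, and let `M = K'(b,η,ξ)(t)[w]/(w² - f(t))` be the function
field of the curve `C_{ηξ} = π⁻¹(⟨η, ξ⟩)` on the double cover `W` of `ℙ^r` branched
over `B = {G = 0}`. Then: (i) `M` admits a `K'(b)`-algebra embedding into a rational
function field `K'(b)(u_1, …, u_r)` in `r` variables; and (ii) writing
`α = η + tξ = (1, α_1, …, α_r)`, the images of `α_1, …, α_r` in `M` are algebraically
independent over `K'(b)` while `α_1, …, α_r, w` are not, i.e. the subfield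
`K'(b)(α_1, …, α_r, w)` of `M` has transcendence degree `r` over `K'(b)`: `(α, w)` is a
generic point of `W` over `K'_1 = K'(b)` and the projection from the family of the
curves `C_{ηξ}` to `W` is dominant. -/
theorem stmt_11 (K' : Type u) [Field K'] [CharZero K'] (d q r : ℕ)
    (hd : 3 ≤ d) (hdq : 2 * d - 2 ≤ q) (hqr : q < r)
    (K3 : Type u) [Field K3] [Algebra K' K3]
    (G : MvPolynomial (Fin (r + 1)) K3) (hG : G.IsHomogeneous (2 * d))
    (hY : ∀ μ ∈ G.support, ∃ i : Fin (r + 1), q < (i : ℕ) ∧ μ i ≠ 0)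
    (hb : AlgebraicIndependent K'
      (fun μ : {μ : Fin (r + 1) →₀ ℕ //
        (∑ i, μ i) = 2 * d ∧ ∃ i : Fin (r + 1), q < (i : ℕ) ∧ μ i ≠ 0} => G.coeff μ.1))
    (η : Fin (r + 1) → K3) (hη0 : η 0 = 1)
    (hηz : ∀ i : Fin (r + 1), 2 * d - 2 < (i : ℕ) → η i = 0)
    (hηind : AlgebraicIndependent
      (↥(IntermediateField.adjoin K' (Set.range G.coeff)))
      (fun j : Fin (2 * d - 2) => η ⟨(j : ℕ) + 1, by have := j.isLt; omega⟩))
    (ξ : Fin (r + 1) → K3) (hξ0 : ξ 0 = 0) (hξ1 : ξ ⟨1, by omega⟩ = 1)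
    (δ' : ℕ → MvPolynomial (Fin (r - 1))
      (↥(IntermediateField.adjoin K' (Set.range G.coeff ∪ Set.range η))))
    (hδ' : ∀ j, MvPolynomial.map
        (algebraMap (↥(IntermediateField.adjoin K'
          (Set.range G.coeff ∪ Set.range η))) K3) (δ' j)
      = MvPolynomial.aeval (fun i : Fin (r + 1) =>
          if _h1 : (i : ℕ) = 0 then 0
          else if _h2 : (i : ℕ) = 1 then 1
          else MvPolynomial.X (⟨(i : ℕ) - 2, by have := i.isLt; omega⟩ : Fin (r - 1)))
        (polar G η j))
    (J : Ideal (MvPolynomial (Fin (r - 1))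
      (↥(IntermediateField.adjoin K' (Set.range G.coeff ∪ Set.range η)))))
    (hJ : J = Ideal.span {p | ∃ j : ℕ, 1 ≤ j ∧ j ≤ 2 * d - 2 ∧ p = δ' j})
    (hJprime : J.IsPrime)
    (hξgen : ∀ p, MvPolynomial.aeval
        (fun i : Fin (r - 1) => ξ ⟨(i : ℕ) + 2, by have := i.isLt; omega⟩) p = 0
      ↔ p ∈ J)
    (hξtrdeg : ∃ v : Fin (r + 1 - 2 * d) → K3,
      AlgebraicIndependent
        (↥(IntermediateField.adjoin K' (Set.range G.coeff ∪ Set.range η))) v ∧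
      (∀ i, v i ∈ IntermediateField.adjoin
        (↥(IntermediateField.adjoin K' (Set.range G.coeff ∪ Set.range η)))
        (Set.range fun i : Fin (r - 1) => ξ ⟨(i : ℕ) + 2, by have := i.isLt; omega⟩)) ∧
      ∀ i : Fin (r - 1), IsAlgebraic
        (↥(IntermediateField.adjoin
          (↥(IntermediateField.adjoin K' (Set.range G.coeff ∪ Set.range η)))
          (Set.range v)))
        (ξ ⟨(i : ℕ) + 2, by have := i.isLt; omega⟩))
    (hgen : IntermediateField.adjoin K'
      (Set.range G.coeff ∪ Set.range η ∪ Set.range ξ) = ⊤)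
    (hFη : Nonempty (K3 →ₐ[↥(IntermediateField.adjoin K'
        (Set.range G.coeff ∪ Set.range η))]
      FractionRing (MvPolynomial (Fin (r + 1 - 2 * d))
        (↥(IntermediateField.adjoin K' (Set.range G.coeff ∪ Set.range η))))))
    (IM : Ideal (Polynomial (RatFunc K3)))
    (hIM : IM = Ideal.span {Polynomial.X ^ 2 - Polynomial.C
      (algebraMap (Polynomial K3) (RatFunc K3)
        (MvPolynomial.aeval (fun i : Fin (r + 1) =>
          Polynomial.C (η i) + Polynomial.X * Polynomial.C (ξ i)) G))}) :
    (∃ φM : (Polynomial (RatFunc K3) ⧸ IM) →ₐ[↥(IntermediateField.adjoin K'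
          (Set.range G.coeff))]
        FractionRing (MvPolynomial (Fin r)
          (↥(IntermediateField.adjoin K' (Set.range G.coeff)))),
      Function.Injective φM) ∧
    AlgebraicIndependent (↥(IntermediateField.adjoin K' (Set.range G.coeff)))
      (fun i : Fin r => Ideal.Quotient.mk IM (Polynomial.C
        (algebraMap K3 (RatFunc K3) (η ⟨(i : ℕ) + 1, by have := i.isLt; omega⟩)
          + RatFunc.X * algebraMap K3 (RatFunc K3)
              (ξ ⟨(i : ℕ) + 1, by have := i.isLt; omega⟩)))) ∧
    ¬ AlgebraicIndependent (↥(IntermediateField.adjoin K' (Set.range G.coeff)))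
      (Fin.snoc (fun i : Fin r => Ideal.Quotient.mk IM (Polynomial.C
          (algebraMap K3 (RatFunc K3) (η ⟨(i : ℕ) + 1, by have := i.isLt; omega⟩)
            + RatFunc.X * algebraMap K3 (RatFunc K3)
                (ξ ⟨(i : ℕ) + 1, by have := i.isLt; omega⟩))))
        (Ideal.Quotient.mk IM Polynomial.X)) := by
  obtain ⟨m, rfl⟩ : ∃ m, d = m + 1 := ⟨d - 1, by omega⟩
  obtain ⟨v, hv, _, hv2⟩ := hξtrdeg
  exact final (m := m) (by omega) hdq hqr G hG hY hb η hη0 hηz hηind ξ hξ0 hξ1 δ' hδ' J hJ hξgen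
    v hv hv2 hgen hFη IM hIM
end
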